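/- arXiv:1009.0035 — 2 statements merged into one kernel-verified Lean document; each statement's English description precedes it below -/
import Mathlib

section
/- For a strict partition κ ∈ Σ, let κ^∨ ∈ Σ be the strict partition such that ∫_Y [Y_κ]·[Y_{κ^∨}] = 1, i.e. [Y_{κ^∨}] is dual to [Y_κ] under the Poincaré pairing on H*(Y). Then every standard shifted tableau in SST(δ/κ) has rectification shape κ^∨. -/
open Polynomial OnePoint

namespace OG

/-! ### Tableaux, diagrams, jeu de taquin / tableau switching -/

/-- A cell `(row, column)` (0-indexed). -/
abbrev Cell := ℕ × ℕ

/-- A filling: a finite set of (cell, entry) pairs. -/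
abbrev Filling := Finset (Cell × ℕ)

def cellsOf (f : Filling) : Finset Cell := f.image Prod.fst

def entriesOf (f : Filling) : Finset ℕ := f.image Prod.snd

/-- A (perforated/partial) standard filling: at most one entry per cell, all entries
distinct, and entries strictly increase along rows and down columns. -/
def IsPartialTableau (f : Filling) : Prop :=
  (∀ p ∈ f, ∀ q ∈ f, p.1 = q.1 → p = q) ∧
  (∀ p ∈ f, ∀ q ∈ f, p.2 = q.2 → p = q) ∧
  (∀ p ∈ f, ∀ q ∈ f, p.1.1 = q.1.1 → p.1.2 < q.1.2 → p.2 < q.2) ∧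
  (∀ p ∈ f, ∀ q ∈ f, p.1.2 = q.1.2 → p.1.1 < q.1.1 → p.2 < q.2)

/-- A standard tableau on the diagram `D` with entry set `E`. -/
def IsTableauOn (f : Filling) (D : Finset Cell) (E : Finset ℕ) : Prop :=
  IsPartialTableau f ∧ cellsOf f = D ∧ entriesOf f = E

/-- One elementary switch of the tableau switching (jeu de taquin) algorithm:
an entry `u` of the inner (sliding) family `p.2` at cell `c` is interchanged with an
entry `t` of the outer family `p.1` lying immediately east or south of `c`, provided
both families remain partial standard tableaux. -/
def SwitchStep (p q : Filling × Filling) : Prop :=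
  ∃ c u d t, (c, u) ∈ p.2 ∧ (d, t) ∈ p.1 ∧
    (d = (c.1, c.2 + 1) ∨ d = (c.1 + 1, c.2)) ∧
    q.1 = insert (c, t) (p.1.erase (d, t)) ∧
    q.2 = insert (d, u) (p.2.erase (c, u)) ∧
    IsPartialTableau q.1 ∧ IsPartialTableau q.2

/-- `Switched T U A B`: applying the tableau switching algorithm to the outer tableau `T`
and the inner tableau `U` terminates with `A` (the rectification of `T`) inside and
`B` (the new outer tableau) outside. -/
def Switched (T U A B : Filling) : Prop :=
  Relation.ReflTransGen SwitchStep (T, U) (A, B) ∧ ∀ q, ¬ SwitchStep (A, B) q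

/-- `R` is the jeu de taquin rectification of the skew tableau `T` whose inner
(empty) region is the diagram `Din`. -/
def RectifiesTo (T : Filling) (Din : Finset Cell) (R : Filling) : Prop :=
  ∃ U B, IsTableauOn U Din (Finset.Icc 1 Din.card) ∧ Switched T U R B

/-- Dual equivalence of two skew tableaux with common inner diagram `Din`:
switching with any standard tableau `U` of shape `Din` produces the same outer
tableau `Û`. -/
def DualEquiv (Din : Finset Cell) (T T' : Filling) : Prop :=
  ∀ U A A' B B', IsTableauOn U Din (Finset.Icc 1 Din.card) →
    Switched T U A B → Switched T' U A' B' → B = B'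

/-- A partition `λ` with at most `n` parts, each of size at most `n+1`
(the indexing set `Λ` for the Schubert classes of `Gr(n, 2n+1)`). -/
structure PartitionIn (n : ℕ) where
  part : ℕ → ℕ
  antitone : Antitone part
  head_le : part 0 ≤ n + 1
  vanish : ∀ i, n ≤ i → part i = 0

/-- The weight `|λ|` of a partition. -/
def wt (n : ℕ) (lam : PartitionIn n) : ℕ := ∑ i ∈ Finset.range n, lam.part i

/-- The Young diagram of a partition `λ ∈ Λ`. -/
def partDiag (n : ℕ) (lam : PartitionIn n) : Finset Cell :=
  (Finset.range n ×ˢ Finset.range (n+1)).filter fun c => c.2 < lam.part c.1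

/-- The `n × (n+1)` rectangular diagram `⊞`. -/
def rectDiag (n : ℕ) : Finset Cell := Finset.range n ×ˢ Finset.range (n+1)

/-- A standard Young tableau of rectangular shape `⊞`, with entries `1, …, n(n+1)`. -/
def IsSYTRect (n : ℕ) (T : Filling) : Prop :=
  IsTableauOn T (rectDiag n) (Finset.Icc 1 (n*(n+1)))

/-- A strict partition with all parts distinct, of size at most `n`, and at most
`n` parts (the indexing set `Σ` for Schubert classes of `OG(n, 2n+1)`). -/
structure StrictPartitionIn (n : ℕ) where
  part : ℕ → ℕ
  le_n : ∀ i, part i ≤ n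
  strict : ∀ i, part i = 0 ∨ part (i+1) < part i

/-- The weight `|σ|` of a strict partition. -/
def swt (n : ℕ) (s : StrictPartitionIn n) : ℕ := ∑ i ∈ Finset.range n, s.part i

/-- The shifted diagram of a strict partition: row `i` has `σ i` boxes starting
at column `i`. -/
def shiftedDiag (n : ℕ) (s : StrictPartitionIn n) : Finset Cell :=
  (Finset.range n ×ˢ Finset.range (2*n)).filter fun c => c.1 ≤ c.2 ∧ c.2 < c.1 + s.part c.1

/-- The staircase strict partition `δ = (n > n-1 > … > 1)`. -/
def staircase (n : ℕ) : StrictPartitionIn n where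
  part i := n - i
  le_n i := Nat.sub_le n i
  strict i := by
    show n - i = 0 ∨ n - (i+1) < n - i
    omega

/-- A standard shifted tableau of staircase shape `δ`, with entries `1, …, n(n+1)/2`. -/
def IsSSTstaircase (n : ℕ) (T : Filling) : Prop :=
  IsTableauOn T (shiftedDiag n (staircase n)) (Finset.Icc 1 (n*(n+1)/2))

/-- The partition `σ̃` associated to a strict partition `σ`:
`σ̃ⁱ = σⁱ + #{j : j ≤ i < j + σʲ}` (0-indexed). -/
def tildeFun {n : ℕ} (s : StrictPartitionIn n) (i : ℕ) : ℕ :=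
  s.part i + ((Finset.range n).filter fun j => j ≤ i ∧ i < j + s.part j).card

/-- Doubling a shifted (skew) tableau `T` to a symmetrical tableau `T⋆`: an entry `k` at
shifted cell `(i,j)` produces the even entry `2k` at `(i, j+1)` and the odd entry
`2k-1` at the transposed cell `(j, i)`. -/
def doubleFill (T : Filling) : Filling :=
  T.image (fun p => ((p.1.1, p.1.2 + 1), 2 * p.2)) ∪
  T.image (fun p => ((p.1.2, p.1.1), 2 * p.2 - 1))

/-- Deleting the odd entries of a tableau, dividing the remaining entries by `2` and
shifting each remaining cell one column to the left. -/
def halveFill (T : Filling) : Filling :=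
  (T.filter fun p => 2 ∣ p.2).image fun p => ((p.1.1, p.1.2 - 1), p.2 / 2)

/-- A rectangular standard tableau is symmetrical if whenever `2k-1` occupies cell
`(i,j)`, the entry `2k` occupies cell `(j, i+1)` (0-indexed version of
`i₂ₖ = j₂ₖ₋₁`, `j₂ₖ = i₂ₖ₋₁ + 1`). -/
def IsSymmetrical (T : Filling) : Prop :=
  ∀ i j k : ℕ, 1 ≤ k → ((i, j), 2*k - 1) ∈ T → ((j, i + 1), 2*k) ∈ T

/-- The subtableau `T_{[i,j]}` of entries lying in the interval `[i, j]`. -/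
def subTab (T : Filling) (i j : ℕ) : Filling := T.filter fun p => i ≤ p.2 ∧ p.2 ≤ j

/-- The subtableau `T_{<i}`. -/
def lowTab (T : Filling) (i : ℕ) : Filling := T.filter fun p => p.2 < i

/-- The subtableau `T_{>j}`. -/
def highTab (T : Filling) (j : ℕ) : Filling := T.filter fun p => j < p.2

/-! ### The Grassmannian, the Wronski map and the orthogonal Grassmannian -/

/-- The Wronskian of an `n`-tuple of polynomials. -/
noncomputable def wronskian (n : ℕ) (f : Fin n → ℂ[X]) : ℂ[X] :=
  (Matrix.of fun i j : Fin n => (fun p : ℂ[X] => derivative p)^[(i : ℕ)] (f j)).det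

/-- `x` is a point of `X = Gr(n, C_{2n}[z])`: an `n`-dimensional subspace of the
space of polynomials of degree at most `2n`. -/
def IsGrassPt (n : ℕ) (x : Submodule ℂ ℂ[X]) : Prop :=
  x ≤ degreeLT ℂ (2*n+1) ∧ Module.finrank ℂ x = n

/-- `Wr(x; z) = h(z)` up to a nonzero scalar: some (hence any) basis of `x` has
Wronskian a nonzero scalar multiple of `h`. -/
def WrEq (n : ℕ) (x : Submodule ℂ ℂ[X]) (h : ℂ[X]) : Prop :=
  ∃ f : Fin n → ℂ[X], Submodule.span ℂ (Set.range f) = x ∧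
    ∃ c : ℂ, c ≠ 0 ∧ wronskian n f = c • h

/-- The symmetric bilinear form
`⟨Σ aₖ zᵏ/k!, Σ bₗ zˡ/l!⟩ = Σ_{m} (-1)ᵐ aₘ b_{2n-m}` on `C_{2n}[z]`. -/
noncomputable def form (n : ℕ) (p q : ℂ[X]) : ℂ :=
  ∑ m ∈ Finset.range (2*n+1),
    (-1 : ℂ)^m * (Nat.factorial m : ℂ) * (Nat.factorial (2*n-m) : ℂ) *
      p.coeff m * q.coeff (2*n-m)

/-- `y` is a point of the orthogonal Grassmannian `Y = OG(n, C_{2n}[z])`: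
an `n`-dimensional isotropic subspace. -/
def IsOGPt (n : ℕ) (y : Submodule ℂ ℂ[X]) : Prop :=
  IsGrassPt n y ∧ ∀ p ∈ y, ∀ q ∈ y, form n p q = 0

/-- The flag `F_•(a)`, for `a ∈ ℂ ∪ {∞}` (with `none` playing the role of `∞`):
`F_i(a)` is the space of polynomials of degree at most `2n` divisible by
`(z+a)^{2n+1-i}`, and `F_i(∞) = C_{i-1}[z]`. -/
noncomputable def flag (n : ℕ) (a : Option ℂ) (i : ℕ) : Submodule ℂ ℂ[X] :=
  match a with
  | Option.none => degreeLT ℂ i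
  | Option.some a0 =>
    { carrier := {p : ℂ[X] | p ∈ degreeLT ℂ (2*n+1) ∧ (X + C a0)^(2*n+1-i) ∣ p}
      add_mem' := fun hp hq => ⟨add_mem hp.1 hq.1, dvd_add hp.2 hq.2⟩
      zero_mem' := ⟨zero_mem _, dvd_zero _⟩
      smul_mem' := by
        rintro c p ⟨h1, h2⟩
        refine ⟨Submodule.smul_mem _ _ h1, ?_⟩
        rw [Polynomial.smul_eq_C_mul]
        exact h2.mul_left _ }

/-- The Schubert variety `X_λ(a) ⊆ X` relative to the flag `F_•(a)`. -/
def SchubertX (n : ℕ) (lam : PartitionIn n) (a : Option ℂ) : Set (Submodule ℂ ℂ[X]) :=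
  {x | IsGrassPt n x ∧
    ∀ i < n, i + 1 ≤ Module.finrank ℂ ↥(x ⊓ flag n a (n + 2 + i - lam.part i))}

/-- The Schubert variety `Y_σ(a) = Y ∩ X_{σ̃}(a) ⊆ Y`. -/
def SchubertY (n : ℕ) (s : StrictPartitionIn n) (a : Option ℂ) : Set (Submodule ℂ ℂ[X]) :=
  {y | IsOGPt n y ∧
    ∀ i < n, i + 1 ≤ Module.finrank ℂ ↥(y ⊓ flag n a (n + 2 + i - tildeFun s i))}

/-! ### `ℝP¹`, fibres of the Wronski map, zones and the correspondence -/

/-- The inclusion `ℝP¹ = ℝ ∪ {∞} ↪ ℂ ∪ {∞}`. -/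
def toC (t : OnePoint ℝ) : Option ℂ := Option.map (fun r : ℝ => (r : ℂ)) t

/-- The linear factor `z + a` associated to `a ∈ ℝP¹` (equal to `1` for `a = ∞`). -/
noncomputable def linFactor (t : OnePoint ℝ) : ℂ[X] :=
  (toC t).elim 1 fun a0 => X + C a0

/-- The polynomial `∏_{aᵢ ≠ ∞} (z + aᵢ)` associated to a multiset `a` of points
of `ℝP¹`. -/
noncomputable def fibrePoly (a : Multiset (OnePoint ℝ)) : ℂ[X] := (a.map linFactor).prod

/-- The fibre `X(a)` of the Wronski map over `∏_{aᵢ ≠ ∞} (z + aᵢ)`. -/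
def fibre (n : ℕ) (a : Multiset (OnePoint ℝ)) : Set (Submodule ℂ ℂ[X]) :=
  {x | IsGrassPt n x ∧ WrEq n x (fibrePoly a)}

/-- The total order `⪯` on `ℝP¹` refining `|a| ≤ |b|`:
`a ⪯ b` iff `a = b`, `|a| < |b|`, or `0 < a = -b < ∞`. -/
def ple (x y : OnePoint ℝ) : Prop :=
  x = y ∨ (y = (∞ : OnePoint ℝ) ∧ x ≠ (∞ : OnePoint ℝ)) ∨
    ∃ r s : ℝ, x = (r : OnePoint ℝ) ∧ y = (s : OnePoint ℝ) ∧
      (|r| < |s| ∨ (0 < r ∧ r = -s))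

/-- The multiset `{v 1, …, v N}`. -/
def msOfN (N : ℕ) (v : ℕ → OnePoint ℝ) : Multiset (OnePoint ℝ) :=
  (Finset.Icc 1 N).val.map v

/-- `v 1 ⪯ v 2 ⪯ … ⪯ v N`. -/
def SortedOn (N : ℕ) (v : ℕ → OnePoint ℝ) : Prop :=
  ∀ k l, 1 ≤ k → k ≤ l → l ≤ N → ple (v k) (v l)

/-- The `⪯`-zone of `A` determined by a choice of signs `ε`. -/
def zoneN (N : ℕ) (eps : ℕ → Bool) : Set (ℕ → OnePoint ℝ) :=
  {v | SortedOn N v ∧ ∀ k, 1 ≤ k → k ≤ N →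
    (v k = (∞ : OnePoint ℝ) ∨
      ∃ r : ℝ, v k = (r : OnePoint ℝ) ∧ (if eps k then 0 ≤ r else r ≤ 0))}

/-- The doubled multiset `b⋆ = {b₁, b₁, …, b_M, b_M}`. -/
def starMs (M : ℕ) (v : ℕ → OnePoint ℝ) : Multiset (OnePoint ℝ) :=
  msOfN M v + msOfN M v

/-- The polynomial with coefficient vector `v`. -/
noncomputable def polyOfVec {m : ℕ} (v : Fin m → ℂ) : ℂ[X] :=
  ∑ i, C (v i) * X ^ (i : ℕ)

/-- The topology of the Grassmannian `Gr(n, C_{2n}[z])`: the quotient (coinduced)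
topology along the map sending a linearly independent `n`-tuple of coefficient
vectors to its span. -/
noncomputable def grassTop (n : ℕ) : TopologicalSpace (Submodule ℂ ℂ[X]) :=
  TopologicalSpace.coinduced
    (fun M : {M : Fin n → Fin (2*n+1) → ℂ // LinearIndependent ℂ M} =>
      Submodule.span ℂ (Set.range fun i => polyOfVec (M.1 i)))
    inferInstance

/-- The tangent space at `x` to the Schubert variety `X_λ(a)` (at a point of the
open cell), viewed inside `Hom(x, ℂ[z]/x)`: the maps `φ` with
`φ(x ∩ F_j(a)) ⊆ (F_j(a) + x)/x` for all `j`. -/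
def tangentSchubertSet (n : ℕ) (a : Option ℂ) (x : Submodule ℂ ℂ[X]) :
    Set (↥x →ₗ[ℂ] (ℂ[X] ⧸ x)) :=
  {φ | ∀ j ≤ 2*n+1, ∀ v : x, (v : ℂ[X]) ∈ flag n a j →
      φ v ∈ (flag n a j ⊔ x).map x.mkQ}

/-- The tangent space at an isotropic `x` to the orthogonal Grassmannian `Y`,
inside `Hom(x, ℂ[z]/x)`: the maps `φ` with `⟨φ v, w⟩ + ⟨v, φ w⟩ = 0`. -/
def tangentYSet (n : ℕ) (x : Submodule ℂ ℂ[X]) : Set (↥x →ₗ[ℂ] (ℂ[X] ⧸ x)) :=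
  {φ | ∀ v w : x, ∀ pv pw : ℂ[X],
      x.mkQ pv = φ v → x.mkQ pw = φ w →
      form n pv (w : ℂ[X]) + form n (v : ℂ[X]) pw = 0}

/-- Divisibility of `h` by `(z+a)^k`, where for `a = ∞` this means
`deg h ≤ n(n+1) - k`. -/
def rootMultCond (n : ℕ) (a : Option ℂ) (k : ℕ) (h : ℂ[X]) : Prop :=
  match a with
  | Option.some a0 => (X + C a0)^k ∣ h
  | Option.none => h.natDegree + k ≤ n*(n+1)

/-- The characterizing properties (i)-(v) of the correspondence
`(T, a) ↦ x_T(a)` of Theorem 2.3: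
(i) `x_T(a)` lies in the fibre `X(a)`;
(ii) `T ↦ x_T(a)` is surjective onto `X(a)`, and injective when `a` is a set;
(iii) `a ↦ x_T(a)` is continuous on every `⪯`-zone;
(iv) if `a_i = … = a_j` in the `⪯`-sorted order then `x_T(a) ∈ X_λ(a_i)` where `λ`
is the rectification shape of `T_{[i,j]}`;
(v) under the hypotheses of (iv), if `T_{<i} = T'_{<i}` and `T_{>j} = T'_{>j}` then
`x_T(a) = x_{T'}(a)` iff `T_{[i,j]}` and `T'_{[i,j]}` are dual equivalent. -/
structure CorrProps (n : ℕ)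
    (xmap : Filling → Multiset (OnePoint ℝ) → Submodule ℂ ℂ[X]) : Prop where
  mem_fibre : ∀ T a, IsSYTRect n T → Multiset.card a = n*(n+1) →
    xmap T a ∈ fibre n a
  surj : ∀ a, Multiset.card a = n*(n+1) → ∀ x ∈ fibre n a,
    ∃ T, IsSYTRect n T ∧ xmap T a = x
  inj : ∀ a, Multiset.card a = n*(n+1) → Multiset.Nodup a →
    ∀ T T', IsSYTRect n T → IsSYTRect n T' → xmap T a = xmap T' a → T = T'
  contOn : ∀ T, IsSYTRect n T → ∀ eps : ℕ → Bool,
    @ContinuousOn (ℕ → OnePoint ℝ) (Submodule ℂ ℂ[X]) _ (grassTop n)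
      (fun v => xmap T (msOfN (n*(n+1)) v)) (zoneN (n*(n+1)) eps)
  schub : ∀ v : ℕ → OnePoint ℝ, SortedOn (n*(n+1)) v →
    ∀ i j, 1 ≤ i → i ≤ j → j ≤ n*(n+1) → (∀ k, i ≤ k → k ≤ j → v k = v i) →
    ∀ T, IsSYTRect n T →
    ∀ lam : PartitionIn n, ∀ R : Filling,
      RectifiesTo (subTab T i j) (cellsOf (lowTab T i)) R →
      cellsOf R = partDiag n lam →
      xmap T (msOfN (n*(n+1)) v) ∈ SchubertX n lam (toC (v i))
  dual : ∀ v : ℕ → OnePoint ℝ, SortedOn (n*(n+1)) v →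
    ∀ i j, 1 ≤ i → i ≤ j → j ≤ n*(n+1) → (∀ k, i ≤ k → k ≤ j → v k = v i) →
    ∀ T T', IsSYTRect n T → IsSYTRect n T' →
      lowTab T i = lowTab T' i → highTab T j = highTab T' j →
      (xmap T (msOfN (n*(n+1)) v) = xmap T' (msOfN (n*(n+1)) v) ↔
        DualEquiv (cellsOf (lowTab T i)) (subTab T i j) (subTab T' i j))


/-! ### Words -/
def adj (a b : ℤ) : Prop := a = b + 1 ∨ b = a + 1

instance (a b : ℤ) : Decidable (adj a b) := by unfold adj; infer_instance

/-- Projection of a word to the letters `k, k+1`. -/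
def FF (k : ℤ) (w : List ℤ) : List ℤ := w.filter (fun x => decide (x = k ∨ x = k + 1))

def Eqv (w w' : List ℤ) : Prop := ∀ k, FF k w = FF k w'

def VV (w : List ℤ) : Prop := ∀ k, (FF k w).IsChain (· ≠ ·)

def SS (w : List ℤ) : Prop := ∀ k,
  (k < 0 → (FF k w).head? ≠ Option.some k) ∧ (0 ≤ k → (FF k w).head? ≠ Option.some (k+1))

def EE (w : List ℤ) : Prop := ∀ k,
  (k < 1 → (FF k w).getLast? ≠ Option.some k) ∧ (1 ≤ k → (FF k w).getLast? ≠ Option.some (k+1))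

theorem adj_comm {a b : ℤ} : adj a b ↔ adj b a := by unfold adj; omega

theorem FF_append (k : ℤ) (a b : List ℤ) : FF k (a ++ b) = FF k a ++ FF k b := by
  simp [FF]

theorem FF_cons (k x : ℤ) (b : List ℤ) :
    FF k (x :: b) = if x = k ∨ x = k + 1 then x :: FF k b else FF k b := by
  simp [FF, List.filter_cons]

theorem FF_nil (k : ℤ) : FF k [] = [] := rfl

theorem mem_FF {k x : ℤ} {w : List ℤ} : x ∈ FF k w ↔ x ∈ w ∧ (x = k ∨ x = k+1) := by
  simp [FF]

theorem Eqv.refl (w : List ℤ) : Eqv w w := fun _ => rfl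
theorem Eqv.symm {a b : List ℤ} (h : Eqv a b) : Eqv b a := fun k => (h k).symm
theorem Eqv.trans {a b c : List ℤ} (h : Eqv a b) (h' : Eqv b c) : Eqv a c :=
  fun k => (h k).trans (h' k)
theorem Eqv.append {a b c d : List ℤ} (h : Eqv a b) (h' : Eqv c d) : Eqv (a ++ c) (b ++ d) :=
  fun k => by rw [FF_append, FF_append, h k, h' k]
theorem Eqv.cons {a b : List ℤ} (x : ℤ) (h : Eqv a b) : Eqv (x :: a) (x :: b) :=
  Eqv.append (Eqv.refl [x]) h
theorem Eqv.cancel_left {a b c : List ℤ} (h : Eqv (a ++ b) (a ++ c)) : Eqv b c :=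
  fun k => by have := h k; rw [FF_append, FF_append] at this; exact List.append_cancel_left this
theorem Eqv.cancel_right {a b c : List ℤ} (h : Eqv (b ++ a) (c ++ a)) : Eqv b c :=
  fun k => by have := h k; rw [FF_append, FF_append] at this; exact List.append_cancel_right this
theorem Eqv.cancel_cons {b c : List ℤ} {x : ℤ} (h : Eqv (x :: b) (x :: c)) : Eqv b c :=
  Eqv.cancel_left (a := [x]) h

theorem FF_count (k x : ℤ) (w : List ℤ) (hx : x = k ∨ x = k + 1) :
    (FF k w).count x = w.count x := by
  unfold FF
  rw [List.count_filter]
  simpa using hx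

theorem Eqv.count {a b : List ℤ} (h : Eqv a b) (x : ℤ) : a.count x = b.count x := by
  rw [← FF_count x x a (Or.inl rfl), ← FF_count x x b (Or.inl rfl), h x]

theorem Eqv.mem {a b : List ℤ} (h : Eqv a b) (x : ℤ) : x ∈ a ↔ x ∈ b := by
  rw [← List.count_pos_iff, ← List.count_pos_iff, h.count]

theorem Eqv.perm {a b : List ℤ} (h : Eqv a b) : a.Perm b :=
  List.perm_iff_count.2 fun x => h.count x

theorem Eqv.length {a b : List ℤ} (h : Eqv a b) : a.length = b.length := h.perm.length_eq

theorem Eqv.VV {a b : List ℤ} (h : Eqv a b) (ha : VV a) : VV b := fun k => h k ▸ ha k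
theorem Eqv.SS {a b : List ℤ} (h : Eqv a b) (ha : SS a) : SS b := fun k => h k ▸ ha k
theorem Eqv.EE {a b : List ℤ} (h : Eqv a b) (ha : EE a) : EE b := fun k => h k ▸ ha k

theorem VV.left {a b : List ℤ} (h : VV (a ++ b)) : VV a := fun k => by
  have := h k; rw [FF_append] at this; exact this.left_of_append
theorem VV.right {a b : List ℤ} (h : VV (a ++ b)) : VV b := fun k => by
  have := h k; rw [FF_append] at this; exact this.right_of_append
theorem VV.tail {b : List ℤ} {x : ℤ} (h : VV (x :: b)) : VV b := VV.right (a := [x]) h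

theorem SS.left {a b : List ℤ} (h : SS (a ++ b)) : SS a := fun k => by
  have := h k; rw [FF_append] at this
  cases hh : FF k a with
  | nil => simp
  | cons y l => rw [hh] at this; simpa using this
theorem EE.right {a b : List ℤ} (h : EE (a ++ b)) : EE b := fun k => by
  have := h k; rw [FF_append] at this
  rcases List.eq_nil_or_concat (FF k b) with hh | ⟨l, y, hh⟩
  · rw [hh]; simp
  · rw [hh] at this ⊢; simpa [← List.append_assoc] using this
theorem EE.tail {b : List ℤ} {x : ℤ} (h : EE (x :: b)) : EE b := EE.right (a := [x]) h

theorem Eqv.swap {x y : ℤ} (h : ¬ adj x y) (w : List ℤ) : Eqv (x :: y :: w) (y :: x :: w) := by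
  intro k
  by_cases hxy : x = y
  · rw [hxy]
  · simp only [FF_cons]
    unfold adj at h
    split_ifs <;> first | rfl | omega

theorem Eqv.swaps {y : ℤ} (P Q : List ℤ) (h : ∀ p ∈ P, ¬ adj p y) :
    Eqv (P ++ y :: Q) (y :: (P ++ Q)) := by
  induction P with
  | nil => exact Eqv.refl _
  | cons p P ih =>
    refine (Eqv.cons p (ih fun q hq => h q (by simp [hq]))).trans ?_
    exact Eqv.swap (h p (by simp)) _

/-! ### Slides -/
def slO : ℤ → List ℤ → List ℤ
  | _, [] => []
  | h, w :: ws => if adj h w then h :: slO w ws else w :: slO h ws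

def slH : ℤ → List ℤ → ℤ
  | h, [] => h
  | h, w :: ws => if adj h w then slH w ws else slH h ws

def swO : List ℤ → List ℤ → List ℤ
  | [], T => T
  | u :: us, T => slO u (swO us T)

def swH : List ℤ → List ℤ → List ℤ
  | [], _ => []
  | u :: us, T => slH u (swO us T) :: swH us T

theorem slide_eqv (h : ℤ) (w : List ℤ) : Eqv (slO h w ++ [slH h w]) (h :: w) := by
  induction w generalizing h with
  | nil => exact Eqv.refl _
  | cons x w ih =>
    simp only [slO, slH]
    split_ifs with hx
    · exact Eqv.cons h (ih x)
    · exact (Eqv.cons x (ih h)).trans (Eqv.swap (fun h' => hx (adj_comm.1 h')) _)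

theorem slO_append (h : ℤ) (x y : List ℤ) : slO h (x ++ y) = slO h x ++ slO (slH h x) y := by
  induction x generalizing h with
  | nil => rfl
  | cons a x ih => simp only [List.cons_append, slO, slH]; split_ifs <;> simp [ih]

theorem slH_append (h : ℤ) (x y : List ℤ) : slH h (x ++ y) = slH (slH h x) y := by
  induction x generalizing h with
  | nil => rfl
  | cons a x ih => simp only [List.cons_append, slH]; split_ifs <;> simp [ih]

theorem slO_length (h : ℤ) (x : List ℤ) : (slO h x).length = x.length := by
  induction x generalizing h with
  | nil => rfl
  | cons a x ih => simp only [slO]; split_ifs <;> simp [ih]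

theorem swO_length (U T : List ℤ) : (swO U T).length = T.length := by
  induction U with
  | nil => rfl
  | cons a x ih => simp [swO, slO_length, ih]

theorem swH_length (U T : List ℤ) : (swH U T).length = U.length := by
  induction U with
  | nil => rfl
  | cons a x ih => simp [swH, ih]

theorem sw_eqv (U T : List ℤ) : Eqv (swO U T ++ swH U T) (U ++ T) := by
  induction U with
  | nil => simp [swO, swH, Eqv.refl]
  | cons u us ih =>
    simp only [swO, swH]
    have h1 := (slide_eqv u (swO us T)).append (Eqv.refl (swH us T))
    simp only [List.append_assoc, List.singleton_append, List.cons_append] at h1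
    exact h1.trans (Eqv.cons u ih)

theorem swO_append_left (U1 U2 T : List ℤ) : swO (U1 ++ U2) T = swO U1 (swO U2 T) := by
  induction U1 with
  | nil => rfl
  | cons u us ih => simp [swO, ih]

theorem swH_append_left (U1 U2 T : List ℤ) :
    swH (U1 ++ U2) T = swH U1 (swO U2 T) ++ swH U2 T := by
  induction U1 with
  | nil => rfl
  | cons u us ih => simp [swH, ih, swO_append_left]

theorem sw_append_right (U X Y : List ℤ) :
    swO U (X ++ Y) = swO U X ++ swO (swH U X) Y ∧ swH U (X ++ Y) = swH (swH U X) Y := by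
  induction U with
  | nil => simp [swO, swH]
  | cons u us ih =>
    simp only [swO, swH, ih.1, ih.2, slO_append, slH_append, and_self]

theorem swO_append_right (U X Y : List ℤ) :
    swO U (X ++ Y) = swO U X ++ swO (swH U X) Y := (sw_append_right U X Y).1
theorem swH_append_right (U X Y : List ℤ) :
    swH U (X ++ Y) = swH (swH U X) Y := (sw_append_right U X Y).2

theorem sw_nil_right (U : List ℤ) : swO U [] = [] ∧ swH U [] = U := by
  induction U with
  | nil => simp [swO, swH]
  | cons u us ih => simp [swO, swH, ih.1, ih.2, slO, slH]

/-! ### Dual equivalence -/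
def DE (T T' : List ℤ) : Prop := ∀ U, VV (U ++ T) → swH U T = swH U T'

def El (T T' : List ℤ) : Prop := ∃ a b c : ℤ, a < b ∧ b < c ∧
  ((T = [a, c, b] ∧ T' = [c, a, b]) ∨ (T = [c, a, b] ∧ T' = [a, c, b]) ∨
   (T = [b, a, c] ∧ T' = [b, c, a]) ∨ (T = [b, c, a] ∧ T' = [b, a, c]))

theorem El.symm {T T' : List ℤ} (h : El T T') : El T' T := by
  obtain ⟨a, b, c, h1, h2, h3⟩ := h
  exact ⟨a, b, c, h1, h2, by tauto⟩

theorem El.eqv {T T' : List ℤ} (h : El T T') : Eqv T T' := by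
  obtain ⟨a, b, c, h1, h2, h3⟩ := h
  have hac : ¬ adj a c := by unfold adj; omega
  have hca : ¬ adj c a := by unfold adj; omega
  rcases h3 with ⟨rfl, rfl⟩ | ⟨rfl, rfl⟩ | ⟨rfl, rfl⟩ | ⟨rfl, rfl⟩
  · exact Eqv.swap hac _
  · exact Eqv.swap hca _
  · exact Eqv.cons _ (Eqv.swap hac _)
  · exact Eqv.cons _ (Eqv.swap hca _)


theorem VV_rep {h : ℤ} {P Q : List ℤ} (hV : VV (h :: (P ++ h :: Q))) : h + 1 ∈ P ∧ h - 1 ∈ P := by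
  constructor
  · by_contra hh
    have := hV h
    have hall : ∀ y ∈ FF h P, y = h := by
      intro y hy; rw [mem_FF] at hy
      rcases hy with ⟨h1, h2 | h2⟩
      · exact h2
      · subst h2; exact absurd h1 hh
    rw [FF_cons, FF_append, FF_cons] at this
    simp only [true_or, if_true] at this
    cases hP : FF h P with
    | nil => rw [hP] at this; simp at this
    | cons y l =>
      rw [hP] at this hall
      have hy := hall y (by simp)
      subst hy
      simp at this
  · by_contra hh
    have := hV (h-1)
    have hall : ∀ y ∈ FF (h-1) P, y = h := by
      intro y hy; rw [mem_FF] at hy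
      rcases hy with ⟨h1, h2 | h2⟩
      · subst h2; exact absurd h1 hh
      · omega
    rw [FF_cons, FF_append, FF_cons] at this
    simp only [sub_add_cancel, or_true, if_true] at this
    cases hP : FF (h-1) P with
    | nil => rw [hP] at this; simp at this
    | cons y l =>
      rw [hP] at this hall
      have hy := hall y (by simp)
      subst hy
      simp at this

theorem El_last {x y m : ℤ} (h : (x < m ∧ m < y) ∨ (y < m ∧ m < x)) : El [x, y, m] [y, x, m] := by
  rcases h with ⟨h1, h2⟩ | ⟨h1, h2⟩
  · exact ⟨x, m, y, h1, h2, by simp⟩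
  · exact ⟨y, m, x, h1, h2, by simp⟩

theorem El_first {x y m : ℤ} (h : (x < m ∧ m < y) ∨ (y < m ∧ m < x)) : El [m, x, y] [m, y, x] := by
  rcases h with ⟨h1, h2⟩ | ⟨h1, h2⟩
  · exact ⟨x, m, y, h1, h2, by simp⟩
  · exact ⟨y, m, x, h1, h2, by simp⟩

theorem el_slide1 {a b c h : ℤ} (h1 : a < b) (h2 : b < c) (hV : VV [h, a, c, b]) :
    slH h [a, c, b] = slH h [c, a, b] ∧ El (slO h [a, c, b]) (slO h [c, a, b]) := by
  have e1 : h ≠ a := by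
    rintro rfl; have := VV_rep (P := []) hV; simp at this
  have e2 : h ≠ c := by
    rintro rfl; have := VV_rep (P := [a]) hV; simp at this; omega
  have e3 : h = b → a = b - 1 ∧ c = b + 1 := by
    rintro rfl; have := VV_rep (P := [a, c]) hV; simp at this; omega
  by_cases ha : adj h a <;> by_cases hc : adj h c <;> by_cases hab : adj a b <;>
    by_cases hcb : adj c b <;> by_cases hb : adj h b <;> by_cases hac : adj a c <;>
    simp only [slH, slO, ha, hc, hab, hcb, hac, adj_comm (a := c) (b := a), hb, if_true, if_false] <;>
    (unfold adj at ha hc hab hcb hac hb) <;> first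
      | omega
      | exact ⟨by first | trivial | omega, El_last (by omega)⟩
      | exact ⟨by first | trivial | omega, El_first (by omega)⟩

theorem el_slide2 {a b c h : ℤ} (h1 : a < b) (h2 : b < c) (hV : VV [h, b, a, c]) :
    slH h [b, a, c] = slH h [b, c, a] ∧ El (slO h [b, a, c]) (slO h [b, c, a]) := by
  have e1 : h ≠ b := by
    rintro rfl; have := VV_rep (P := []) hV; simp at this
  have e2 : h ≠ a := by
    rintro rfl; have := VV_rep (P := [b]) hV; simp at this; omega
  have e3 : h ≠ c := by
    rintro rfl; have := VV_rep (P := [b, a]) hV; simp at this; omega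
  by_cases ha : adj h a <;> by_cases hc : adj h c <;> by_cases hab : adj b a <;>
    by_cases hcb : adj b c <;> by_cases hb : adj h b <;> by_cases hac : adj a c <;>
    simp only [slH, slO, ha, hc, hab, hcb, hac, adj_comm (a := c) (b := a), hb, if_true, if_false] <;>
    (unfold adj at ha hc hab hcb hac hb) <;> first
      | omega
      | exact ⟨by first | trivial | omega, El_last (by omega)⟩
      | exact ⟨by first | trivial | omega, El_first (by omega)⟩

theorem el_slide {h : ℤ} {T T' : List ℤ} (hE : El T T') (hV : VV (h :: T)) :
    slH h T = slH h T' ∧ El (slO h T) (slO h T') := by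
  have hV' : VV (h :: T') := (Eqv.cons h hE.eqv).VV hV
  obtain ⟨a, b, c, h1, h2, h3⟩ := hE
  rcases h3 with ⟨rfl, rfl⟩ | ⟨rfl, rfl⟩ | ⟨rfl, rfl⟩ | ⟨rfl, rfl⟩
  · exact el_slide1 h1 h2 hV
  · exact ⟨(el_slide1 h1 h2 hV').1.symm, (el_slide1 h1 h2 hV').2.symm⟩
  · exact el_slide2 h1 h2 hV
  · exact ⟨(el_slide2 h1 h2 hV').1.symm, (el_slide2 h1 h2 hV').2.symm⟩

theorem el_sw {T T' : List ℤ} (hE : El T T') (U : List ℤ) (hV : VV (U ++ T)) :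
    swH U T = swH U T' ∧ El (swO U T) (swO U T') := by
  induction U with
  | nil => exact ⟨rfl, hE⟩
  | cons u us ih =>
    obtain ⟨i1, i2⟩ := ih (VV.tail hV)
    have hV2 : VV (u :: swO us T) := by
      have h3 := (Eqv.cons u (sw_eqv us T)).symm.VV hV
      exact VV.left (b := swH us T) h3
    obtain ⟨j1, j2⟩ := el_slide i2 hV2
    exact ⟨by simp only [swH, i1, j1], j2⟩

theorem DE.ctx {M M' : List ℤ} (h : DE M M') (X Y : List ℤ) :
    DE (X ++ (M ++ Y)) (X ++ (M' ++ Y)) := by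
  intro U hV
  rw [swH_append_right, swH_append_right, swH_append_right, swH_append_right]
  rw [h]
  have h2 : VV ((U ++ X) ++ M) := VV.left (b := Y) (by simpa using hV)
  have h3 := ((sw_eqv U X).symm.append (Eqv.refl M)).VV h2
  rw [List.append_assoc] at h3
  exact h3.right

theorem El.DE {T T' : List ℤ} (hE : El T T') : DE T T' := fun U hV => (el_sw hE U hV).1

theorem DE.trans {A B C : List ℤ} (h : DE A B) (he : Eqv A B) (h' : DE B C) : DE A C :=
  fun U hV => (h U hV).trans (h' U (((Eqv.refl U).append he).VV hV))

theorem DE.symm {A B : List ℤ} (h : DE A B) (he : Eqv A B) : DE B A :=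
  fun U hV => (h U (((Eqv.refl U).append he.symm).VV hV)).symm

theorem first_split {α : Type*} (p : α → Prop) (l : List α) (h : ∃ x ∈ l, p x) :
    ∃ A x B, l = A ++ x :: B ∧ p x ∧ ∀ a ∈ A, ¬ p a := by
  induction l with
  | nil => simp at h
  | cons y l ih =>
    by_cases hy : p y
    · exact ⟨[], y, l, rfl, hy, by simp⟩
    · obtain ⟨x, hx, hp⟩ := h
      have hx' : x ∈ l := by
        rcases List.mem_cons.1 hx with rfl | h
        · exact absurd hp hy
        · exact h
      obtain ⟨A, x, B, rfl, h2, h3⟩ := ih ⟨x, hx', hp⟩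
      refine ⟨y :: A, x, B, rfl, h2, ?_⟩
      intro a ha
      rcases List.mem_cons.1 ha with rfl | h
      · exact hy
      · exact h3 a h

theorem front_nonadj {P Q T' : List ℤ} {y : ℤ} (h : Eqv (P ++ y :: Q) (y :: T')) (hy : y ∉ P) :
    ∀ p ∈ P, ¬ adj p y := by
  intro p hp hadj
  obtain ⟨k, hk1, hk2⟩ : ∃ k : ℤ, (p = k ∨ p = k + 1) ∧ (y = k ∨ y = k + 1) := by
    rcases hadj with h | h
    · exact ⟨y, by omega, by omega⟩
    · exact ⟨p, by omega, by omega⟩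
  have := h k
  rw [FF_append, FF_cons k y T', if_pos hk2] at this
  cases hP : FF k P with
  | nil =>
    have : p ∈ FF k P := mem_FF.2 ⟨hp, hk1⟩
    rw [hP] at this; simp at this
  | cons z l =>
    rw [hP] at this
    simp only [List.cons_append, List.cons.injEq] at this
    have hz : z ∈ FF k P := by rw [hP]; simp
    rw [this.1] at hz
    exact hy (mem_FF.1 hz).1

theorem front_pull {T T' : List ℤ} {y : ℤ} (h : Eqv T (y :: T')) :
    ∃ P Q, T = P ++ y :: Q ∧ y ∉ P ∧ (∀ p ∈ P, ¬ adj p y) ∧ Eqv T (y :: (P ++ Q)) := by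
  have hm : y ∈ T := (h.mem y).2 (by simp)
  obtain ⟨P, z, Q, rfl, rfl, h3⟩ := first_split (· = y) T ⟨y, hm, rfl⟩
  have hP : z ∉ P := fun hh => h3 z hh rfl
  exact ⟨P, Q, rfl, hP, front_nonadj h hP, Eqv.swaps P Q (front_nonadj h hP)⟩

theorem trace_split {x y : ℤ} {T T' : List ℤ} (hxy : x ≠ y) (h : Eqv (x :: T) (y :: T')) :
    ¬ adj x y ∧ ∃ Z, Eqv T (y :: Z) ∧ Eqv T' (x :: Z) := by
  obtain ⟨P, Q, hPQ, hy, ha, he⟩ := front_pull h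
  cases P with
  | nil => simp at hPQ; exact absurd hPQ.1 hxy
  | cons p P =>
    simp only [List.cons_append, List.cons.injEq] at hPQ
    obtain ⟨rfl, rfl⟩ := hPQ
    have h1 : Eqv (P ++ y :: Q) (y :: (P ++ Q)) :=
      Eqv.swaps P Q fun p hp => ha p (by simp [hp])
    exact ⟨ha x (by simp), P ++ Q, h1, (Eqv.cancel_cons (h.symm.trans he))⟩

theorem EE_up {w : List ℤ} (h : EE w) {x : ℤ} (hx : x ∈ w) (h1 : x < 1) : x + 1 ∈ w := by
  have := (h x).1 h1
  have hx' : x ∈ FF x w := mem_FF.2 ⟨hx, by simp⟩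
  have hne : FF x w ≠ [] := List.ne_nil_of_mem hx'
  have hl := mem_FF.1 (List.getLast_mem hne)
  rw [List.getLast?_eq_getLast_of_ne_nil hne] at this
  rcases hl.2 with h2 | h2
  · exact absurd (congrArg Option.some h2) this
  · rw [h2] at hl; exact hl.1

theorem EE_down {w : List ℤ} (h : EE w) {x : ℤ} (hx : x ∈ w) (h1 : 2 ≤ x) : x - 1 ∈ w := by
  have := (h (x-1)).2 (by omega)
  have hx' : x ∈ FF (x-1) w := mem_FF.2 ⟨hx, by simp⟩
  have hne : FF (x-1) w ≠ [] := List.ne_nil_of_mem hx'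
  have hl := mem_FF.1 (List.getLast_mem hne)
  rw [List.getLast?_eq_getLast_of_ne_nil hne] at this
  rcases hl.2 with h2 | h2
  · rw [h2] at hl; exact hl.1
  · exact absurd (congrArg Option.some h2) this

theorem between_split {x y : ℤ} {Z : List ℤ} (hxy : x < y) (ha : ¬ adj x y)
    (hV : VV (x :: y :: Z)) (hE : EE (x :: y :: Z)) :
    ∃ z Z', x < z ∧ z < y ∧ Eqv Z (z :: Z') := by
  unfold adj at ha
  have hex : ∃ z ∈ Z, x < z ∧ z < y := by
    by_cases h1 : x < 1
    · have := EE_up hE (x := x) (by simp) h1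
      simp only [List.mem_cons] at this
      rcases this with h | h | h
      · omega
      · omega
      · exact ⟨_, h, by omega, by omega⟩
    · have := EE_down hE (x := y) (by simp) (by omega)
      simp only [List.mem_cons] at this
      rcases this with h | h | h
      · omega
      · omega
      · exact ⟨_, h, by omega, by omega⟩
  obtain ⟨Z1, z, Z2, rfl, ⟨hz1, hz2⟩, hz3⟩ := first_split (fun z => x < z ∧ z < y) Z hex
  refine ⟨z, Z1 ++ Z2, hz1, hz2, Eqv.swaps Z1 Z2 ?_⟩
  have hx : x ∉ Z1 := by
    intro hx
    obtain ⟨A, w, B, rfl, rfl, -⟩ := first_split (· = x) Z1 ⟨x, hx, rfl⟩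
    have := (VV_rep (h := w) (P := y :: A) (Q := B ++ z :: Z2) (by simpa using hV)).1
    simp only [List.mem_cons] at this
    rcases this with h | h
    · omega
    · exact hz3 (w + 1) (by simp [h]) (by omega)
  have hy : y ∉ Z1 := by
    intro hx
    obtain ⟨A, w, B, rfl, rfl, -⟩ := first_split (· = y) Z1 ⟨y, hx, rfl⟩
    have := (VV_rep (h := w) (P := A) (Q := B ++ z :: Z2) (by simpa using hV.tail)).2
    exact hz3 (w - 1) (by simp [this]) (by omega)
  intro p hp hadj
  have := hz3 p hp
  have h1 : p ≠ x := by rintro rfl; exact hx hp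
  have h2 : p ≠ y := by rintro rfl; exact hy hp
  unfold adj at hadj
  omega

theorem DE.cons {A B : List ℤ} (x : ℤ) (h : DE A B) : DE (x :: A) (x :: B) := by
  simpa using h.ctx [x] []

theorem DE.refl (A : List ℤ) : DE A A := fun _ _ => rfl

theorem DEall (m : ℕ) : ∀ T T' : List ℤ, T.length ≤ m → VV T → EE T → Eqv T T' → DE T T' := by
  induction m with
  | zero =>
    intro T T' hl _ _ he
    have h1 : T = [] := by simpa using hl
    have h2 : T' = [] := by have := he.length; rw [h1] at this; simpa using this.symm
    rw [h1, h2]; exact DE.refl _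
  | succ m ih =>
    intro T T' hl hV hE he
    cases T with
    | nil =>
      have h2 : T' = [] := by have := he.length; simpa using this.symm
      rw [h2]; exact DE.refl _
    | cons x T1 =>
    cases T' with
    | nil => have := he.length; simp at this
    | cons y T1' =>
    simp only [List.length_cons, Nat.add_le_add_iff_right] at hl
    by_cases hxy : x = y
    · subst hxy
      exact (ih T1 T1' hl hV.tail hE.tail he.cancel_cons).cons x
    · obtain ⟨hna, Z, hZ1, hZ2⟩ := trace_split hxy he
      have e1 : Eqv (x :: T1) (x :: y :: Z) := hZ1.cons x
      obtain ⟨z, Z', hz, hZ'⟩ : ∃ z Z', ((x < z ∧ z < y) ∨ (y < z ∧ z < x)) ∧ Eqv Z (z :: Z') := by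
        rcases lt_or_gt_of_ne hxy with h | h
        · obtain ⟨z, Z', h1, h2, h3⟩ := between_split h hna (e1.VV hV) (e1.EE hE)
          exact ⟨z, Z', Or.inl ⟨h1, h2⟩, h3⟩
        · have e2 := e1.trans (Eqv.swap hna Z)
          obtain ⟨z, Z', h1, h2, h3⟩ := between_split h (fun h => hna (adj_comm.1 h))
            (e2.VV hV) (e2.EE hE)
          exact ⟨z, Z', Or.inr ⟨h1, h2⟩, h3⟩
      have f1 : Eqv T1 (y :: z :: Z') := hZ1.trans (hZ'.cons y)
      have f2 : Eqv T1' (x :: z :: Z') := hZ2.trans (hZ'.cons x)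
      have d1 := (ih T1 _ hl hV.tail hE.tail f1).cons x
      have d2 : DE (x :: y :: z :: Z') (y :: x :: z :: Z') := by
        simpa using (El_last hz).DE.ctx [] Z'
      have e2 : Eqv (x :: y :: z :: Z') (y :: x :: z :: Z') := Eqv.swap hna _
      have hl' : T1'.length ≤ m := by have := he.length; simp at this; omega
      have d3 := ((ih T1' _ hl' (he.VV hV).tail (he.EE hE).tail f2).cons y).symm (f2.cons y)
      exact (d1.trans (f1.cons x) (d2.trans e2 d3))

theorem DE_of {T T' : List ℤ} (hV : VV T) (hE : EE T) (he : Eqv T T') : DE T T' :=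
  DEall T.length T T' le_rfl hV hE he

/-! ### The anti-involution -/
def iot (w : List ℤ) : List ℤ := (w.map (fun x => 1 - x)).reverse

theorem iot_iot (w : List ℤ) : iot (iot w) = w := by
  simp [iot, List.map_reverse, Function.comp_def]

theorem iot_cons (x : ℤ) (w : List ℤ) : iot (x :: w) = iot w ++ [1 - x] := by simp [iot]
theorem iot_nil : iot [] = [] := rfl
theorem iot_append (a b : List ℤ) : iot (a ++ b) = iot b ++ iot a := by simp [iot]
theorem iot_length (a : List ℤ) : (iot a).length = a.length := by simp [iot]

theorem iot_count (w : List ℤ) (k : ℤ) : (iot w).count k = w.count (1 - k) := by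
  unfold iot
  rw [List.count_reverse]
  have : k = (fun x : ℤ => 1 - x) (1 - k) := by simp
  conv_lhs => rw [this]
  rw [List.count_map_of_injective]
  intro a b h; simpa using h

theorem FF_iot (k : ℤ) (w : List ℤ) : FF k (iot w) = ((FF (-k) w).map (fun x => 1 - x)).reverse := by
  unfold FF iot
  rw [List.filter_reverse, List.filter_map]
  congr 2
  apply List.filter_congr
  intro x _
  simp only [Function.comp, decide_eq_decide]
  omega

theorem Eqv.iot {a b : List ℤ} (h : Eqv a b) : Eqv (iot a) (iot b) := fun k => by
  rw [FF_iot, FF_iot, h (-k)]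

theorem VV.iot {w : List ℤ} (h : VV w) : VV (iot w) := fun k => by
  rw [FF_iot, List.isChain_reverse, List.isChain_map]
  refine List.IsChain.imp ?_ (h (-k))
  intro a b hab hh
  simp [flip] at hh
  exact hab hh.symm

theorem SS.iot {w : List ℤ} (h : SS w) : EE (iot w) := fun k => by
  rw [FF_iot, List.getLast?_reverse, List.head?_map]
  have := h (-k)
  constructor
  · intro hk hh
    rw [Option.map_eq_some_iff] at hh
    obtain ⟨a, h1, h2⟩ := hh
    exact this.2 (by omega) (by rw [h1]; congr 1; omega)
  · intro hk hh
    rw [Option.map_eq_some_iff] at hh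
    obtain ⟨a, h1, h2⟩ := hh
    exact this.1 (by omega) (by rw [h1]; congr 1; omega)

theorem EE.iot {w : List ℤ} (h : EE w) : SS (iot w) := fun k => by
  rw [FF_iot, List.head?_reverse, List.getLast?_map]
  have := h (-k)
  constructor
  · intro hk hh
    rw [Option.map_eq_some_iff] at hh
    obtain ⟨a, h1, h2⟩ := hh
    exact this.2 (by omega) (by rw [h1]; congr 1; omega)
  · intro hk hh
    rw [Option.map_eq_some_iff] at hh
    obtain ⟨a, h1, h2⟩ := hh
    exact this.1 (by omega) (by rw [h1]; congr 1; omega)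

theorem iot_slide (h : ℤ) (T : List ℤ) :
    swO (iot T) [1 - h] = [1 - slH h T] ∧ swH (iot T) [1 - h] = iot (slO h T) := by
  induction T generalizing h with
  | nil => simp [iot, swO, swH, slO, slH]
  | cons w ws ih =>
    have hc : adj (1 - w) (1 - h) ↔ adj h w := by unfold adj; omega
    rw [iot_cons, swO_append_left, swH_append_left]
    by_cases ha : adj h w
    · simp [swO, swH, slO, slH, hc, ha, (ih w).1, (ih w).2, iot_cons]
    · simp [swO, swH, slO, slH, hc, ha, (ih h).1, (ih h).2, iot_cons]

theorem iot_sw (U T : List ℤ) :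
    swO (iot T) (iot U) = iot (swH U T) ∧ swH (iot T) (iot U) = iot (swO U T) := by
  induction U with
  | nil => simp [iot_nil, swO, swH, sw_nil_right]
  | cons u us ih =>
    rw [iot_cons, swO_append_right, swH_append_right, ih.1, ih.2, (iot_slide _ _).1,
      (iot_slide _ _).2]
    simp [swO, swH, iot_cons]

theorem DE_left {U U' T : List ℤ} (hV : VV (U ++ T)) (hS : SS U) (he : Eqv U U') :
    swO U T = swO U' T := by
  have := DE_of hV.left.iot hS.iot he.iot (iot T) (by rw [← iot_append]; exact hV.iot)
  rw [(iot_sw _ _).2, (iot_sw _ _).2] at this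
  rw [← iot_iot (swO U T), this, iot_iot]

/-! ### Involution -/
theorem slide_inv (h : ℤ) (T : List ℤ) :
    swO (slO h T) [slH h T] = [h] ∧ swH (slO h T) [slH h T] = T := by
  induction T generalizing h with
  | nil => simp [swO, swH, slO, slH]
  | cons w ws ih =>
    have hc : adj w h ↔ adj h w := adj_comm
    by_cases ha : adj h w
    · simp [swO, swH, slO, slH, ha, (ih w).1, (ih w).2]
    · simp [swO, swH, slO, slH, ha, hc, (ih h).1, (ih h).2]

theorem sw_inv (U T : List ℤ) :
    swO (swO U T) (swH U T) = U ∧ swH (swO U T) (swH U T) = T := by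
  induction U with
  | nil => simp [swO, swH, sw_nil_right]
  | cons u us ih =>
    simp only [swO, swH]
    rw [← List.singleton_append (l := swH us T), swO_append_right, swH_append_right,
      (slide_inv _ _).1, (slide_inv _ _).2, ih.1, ih.2]
    simp

/-! ### Normal words -/
theorem alt_unique {a b : ℤ} : ∀ l l' : List ℤ, a ≠ b → l.length = l'.length →
    l.IsChain (· ≠ ·) → l'.IsChain (· ≠ ·) → (∀ x ∈ l, x = a ∨ x = b) → (∀ x ∈ l', x = a ∨ x = b) →
    l.head? ≠ Option.some a → l'.head? ≠ Option.some a → l = l' := by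
  intro l
  induction l generalizing a b with
  | nil => intro l' _ hl _ _ _ _ _ _; simpa using hl.symm
  | cons x l ih =>
    intro l' hab hl c1 c2 m1 m2 h1 h2
    cases l' with
    | nil => simp at hl
    | cons x' l' =>
      have e1 : x = b := by
        rcases m1 x (by simp) with h | h
        · rw [h] at h1; simp at h1
        · exact h
      have e2 : x' = b := by
        rcases m2 x' (by simp) with h | h
        · rw [h] at h2; simp at h2
        · exact h
      subst e1 e2
      rw [List.isChain_cons] at c1 c2
      congr 1
      refine ih (a := x') (b := a) l' hab.symm (by simpa using hl) c1.2 c2.2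
        (fun y hy => (m1 y (by simp [hy])).symm) (fun y hy => (m2 y (by simp [hy])).symm) ?_ ?_
      · intro h; exact c1.1 x' (by simp [h]) rfl
      · intro h; exact c2.1 x' (by simp [h]) rfl

theorem FF_length (k : ℤ) (w : List ℤ) : (FF k w).length = w.count k + w.count (k+1) := by
  induction w with
  | nil => rfl
  | cons x w ih =>
    rw [FF_cons]
    simp only [List.count_cons, beq_iff_eq]
    split_ifs <;> (try simp only [List.length_cons]) <;> omega

theorem normal_eqv {w w' : List ℤ} (hV : VV w) (hV' : VV w') (hS : SS w) (hS' : SS w')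
    (hc : ∀ k, w.count k = w'.count k) : Eqv w w' := by
  intro k
  have hl : (FF k w).length = (FF k w').length := by rw [FF_length, FF_length, hc, hc]
  by_cases hk : k < 0
  · exact alt_unique (a := k) (b := k + 1) _ _ (by omega) hl (hV k) (hV' k)
      (fun x hx => (mem_FF.1 hx).2) (fun x hx => (mem_FF.1 hx).2) ((hS k).1 hk) ((hS' k).1 hk)
  · exact alt_unique (a := k + 1) (b := k) _ _ (by omega) hl (hV k) (hV' k)
      (fun x hx => (mem_FF.1 hx).2.symm) (fun x hx => (mem_FF.1 hx).2.symm)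
      ((hS k).2 (by omega)) ((hS' k).2 (by omega))

/-! ### Complementation -/
def good (U T : List ℤ) : Prop := ∀ k, (swH U T).count k = U.count (1 - k)

theorem good_congr {U U' T : List ℤ} (hV : VV (U ++ T)) (hS : SS U) (he : Eqv U U')
    (hg : good U T) : good U' T := by
  have h1 : swO U T = swO U' T := DE_left hV hS he
  have h2 : Eqv (swO U T ++ swH U T) (swO U' T ++ swH U' T) :=
    (sw_eqv U T).trans ((he.append (Eqv.refl T)).trans (sw_eqv U' T).symm)
  rw [← h1] at h2
  have h3 := h2.cancel_left
  intro k
  rw [← h3.count, hg k, he.count]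

theorem claim1 {U0 T : List ℤ} {x : ℤ} (hV : VV ((U0 ++ [x]) ++ T))
    (hE : EE ((U0 ++ [x]) ++ T)) :
    ∃ b, Eqv (swH (U0 ++ [x]) T) (b :: swH U0 (x :: T)) := by
  simp only [List.append_assoc, List.singleton_append] at hV hE
  have h1 := DE_of hV.right hE.right (slide_eqv x T).symm U0 hV
  rw [swH_append_right] at h1
  have h2 : swH (U0 ++ [x]) T = swH U0 (slO x T) ++ [slH x T] := by
    rw [swH_append_left]; simp [swO, swH]
  rw [h1, h2]
  have h3 := sw_eqv (swH U0 (slO x T)) [slH x T]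
  have h4 := swO_length (swH U0 (slO x T)) [slH x T]
  rw [List.length_singleton, List.length_eq_one_iff] at h4
  obtain ⟨b, hb⟩ := h4
  rw [hb] at h3
  exact ⟨b, h3.symm⟩

theorem two_rem {W : List ℤ} (hV : VV W) (hS : SS W) (hE : EE W)
    {U0 U1 T : List ℤ} {x z : ℤ} (hU : Eqv ((U0 ++ [x]) ++ T) W)
    (h0 : good U0 (x :: T))
    (h1 : good U1 (z :: T))
    (he : Eqv (U0 ++ [x]) (U1 ++ [z])) (hzx : z ≠ x) : good (U0 ++ [x]) T := by
  have hV1 := hU.symm.VV hV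
  have hS1 := hU.symm.SS hS
  have hE1 := hU.symm.EE hE
  have hU' : Eqv ((U1 ++ [z]) ++ T) W := (he.symm.append (Eqv.refl T)).trans hU
  obtain ⟨b, hb⟩ := claim1 hV1 hE1
  obtain ⟨b', hb'⟩ := claim1 (hU'.symm.VV hV) (hU'.symm.EE hE)
  have hB : Eqv (swH (U0 ++ [x]) T) (swH (U1 ++ [z]) T) := by
    have e1 : swO (U0 ++ [x]) T = swO (U1 ++ [z]) T := DE_left hV1 hS1.left he
    have e2 := (sw_eqv (U0 ++ [x]) T).trans (hU.trans (hU'.symm.trans (sw_eqv (U1 ++ [z]) T).symm))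
    rw [← e1] at e2
    exact e2.cancel_left
  have key : ∀ k, (if b = k then 1 else 0) + U0.count (1 - k) =
      (if b' = k then 1 else 0) + U1.count (1 - k) := by
    intro k
    have := hB.count k
    rw [hb.count, hb'.count, List.count_cons, List.count_cons, h0 k, h1 k] at this
    simp only [beq_iff_eq] at this
    omega
  have key2 : ∀ k, U0.count k + (if x = k then 1 else 0) = U1.count k + (if z = k then 1 else 0) := by
    intro k
    have := he.count k
    simpa [List.count_append, List.count_singleton] using this
  have hbx : b = 1 - x := by
    by_contra hne
    have k1 := key (1 - x)
    have k2 := key2 x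
    rw [if_neg hne] at k1
    rw [sub_sub_cancel] at k1
    rw [if_pos rfl, if_neg hzx] at k2
    omega
  intro k
  rw [hb.count, List.count_cons, h0 k, List.count_append, List.count_singleton]
  simp only [beq_iff_eq]
  congr 1
  have : b = k ↔ x = 1 - k := by omega
  simp only [this]

theorem main_words {W : List ℤ} (hV : VV W) (hS : SS W) (hE : EE W)
    (hc : ∀ k, W.count k = W.count (1 - k))
    (H2 : ∀ T, Eqv ([0, 1] ++ T) W → good [0, 1] T) :
    ∀ m : ℕ, ∀ U T : List ℤ, U.length = m → Eqv (U ++ T) W → good U T := by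
  have hWi : Eqv (iot W) W := by
    apply normal_eqv hV.iot hV hE.iot hS
    intro k; rw [iot_count, ← hc]
  intro m
  induction m with
  | zero =>
    intro U T hl _
    have : U = [] := by simpa using hl
    subst this
    intro k; simp [swH]
  | succ m ih =>
    intro U T hl hU
    rcases List.eq_nil_or_concat U with rfl | ⟨U0, x, rfl⟩
    · simp at hl
    rw [List.concat_eq_append] at hl hU ⊢
    have hl0 : U0.length = m := by simpa using hl
    have two : ∀ (U1 T : List ℤ) (x z : ℤ), Eqv ((U0 ++ [x]) ++ T) W →
        Eqv (U0 ++ [x]) (U1 ++ [z]) → z ≠ x → good (U0 ++ [x]) T := by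
      intro U1 T x z hU he hzx
      refine two_rem hV hS hE hU (ih _ _ hl0 ?_) (ih U1 _ ?_ ?_) he hzx
      · simpa using hU
      · have := he.length; simp at this; omega
      · have := (he.symm.append (Eqv.refl T)).trans hU
        simpa using this
    have hg0 : good U0 (x :: T) := ih _ _ hl0 (by simpa using hU)
    have hV1 := hU.symm.VV hV
    obtain ⟨b, hb⟩ := claim1 hV1 (hU.symm.EE hE)
    by_cases hbx : b = 1 - x
    · intro k
      rw [hb.count, List.count_cons, hg0 k, List.count_append, List.count_singleton]
      simp only [beq_iff_eq]
      congr 1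
      have : b = k ↔ x = 1 - k := by omega
      simp only [this]
    -- the mirror pair
    set A := swO (U0 ++ [x]) T with hA
    set B := swH (U0 ++ [x]) T with hB
    have hAB : Eqv (iot B ++ iot A) W := by
      rw [← iot_append]
      exact ((sw_eqv (U0 ++ [x]) T).trans hU).iot.trans hWi
    obtain ⟨y, hy⟩ : ∃ y, y = 1 - b := ⟨_, rfl⟩
    have hyx : y ≠ x := by omega
    have hB' : Eqv (iot B) (U0 ++ [y]) := by
      have h1 := hb.iot
      rw [iot_cons] at h1
      refine h1.trans (Eqv.append ?_ (by rw [hy]; exact Eqv.refl _))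
      have h2 : Eqv ((iot (swH U0 (x :: T)) ++ [1 - b]) ++ iot A) W :=
        (h1.symm.append (Eqv.refl _)).trans hAB
      rw [List.append_assoc] at h2
      rw [List.append_assoc] at hU
      refine normal_eqv (h2.symm.VV hV).left (hU.symm.VV hV).left (h2.symm.SS hS).left
        (hU.symm.SS hS).left ?_
      intro k
      rw [iot_count, hg0]; congr 1; omega
    have hU' : Eqv ((U0 ++ [y]) ++ iot A) W := (hB'.symm.append (Eqv.refl _)).trans hAB
    have mirror : good (U0 ++ [y]) (iot A) → good (U0 ++ [x]) T := by
      intro hg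
      have h1 : good (iot B) (iot A) :=
        good_congr (hU'.symm.VV hV) (hU'.symm.SS hS).left hB'.symm hg
      intro k
      have h2 := h1 k
      rw [(iot_sw _ _).2, (sw_inv _ _).1, iot_count, iot_count] at h2
      simp only [sub_sub_cancel] at h2
      exact h2.symm
    by_contra hng
    have hng' : ¬ good (U0 ++ [y]) (iot A) := fun h => hng (mirror h)
    have hVx : VV (U0 ++ [x]) := (hU.symm.VV hV).left
    have hVy : VV (U0 ++ [y]) := (hU'.symm.VV hV).left
    rcases List.eq_nil_or_concat U0 with rfl | ⟨U00, z, rfl⟩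
    · -- single letter
      have aux : ∀ (x : ℤ) (T : List ℤ), Eqv (([] ++ [x]) ++ T) W → x = 0 := by
        intro x T h
        have h1 := (h.symm.SS hS).left
        simp only [List.nil_append] at h1
        have a1 := (h1 x).1
        have a2 := (h1 (x-1)).2
        simp [FF_cons, FF_nil] at a1 a2
        omega
      exact hyx ((aux y _ hU').trans (aux x _ hU).symm)
    rw [List.concat_eq_append] at *
    have swp : ∀ x, VV ((U00 ++ [z]) ++ [x]) → (¬ adj z x) →
        z ≠ x ∧ Eqv ((U00 ++ [z]) ++ [x]) ((U00 ++ [x]) ++ [z]) := by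
      intro x hVx h
      constructor
      · rintro rfl
        rw [List.append_assoc] at hVx
        have := VV_rep (P := []) (Q := []) hVx.right
        simp at this
      · rw [List.append_assoc, List.append_assoc]
        exact (Eqv.refl U00).append (Eqv.swap h [])
    have hzx : adj z x := by
      by_contra h
      obtain ⟨h1, h2⟩ := swp x hVx h
      exact hng (two _ _ _ _ hU h2 h1)
    have hzy : adj z y := by
      by_contra h
      obtain ⟨h1, h2⟩ := swp y hVy h
      exact hng' (two _ _ _ _ hU' h2 h1)
    rcases List.eq_nil_or_concat U00 with rfl | ⟨V, z', rfl⟩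
    · have hz0 : z = 0 := by
        have h1 : SS [z] := by
          have := (hU.symm.SS hS).left.left
          simpa using this
        have a1 := (h1 z).1
        have a2 := (h1 (z-1)).2
        simp [FF_cons, FF_nil] at a1 a2
        omega
      subst hz0
      have hx1 : x = 1 ∨ y = 1 := by unfold adj at hzx hzy; omega
      rcases hx1 with rfl | rfl
      · exact hng (H2 T (by simpa using hU))
      · exact hng' (H2 _ (by simpa using hU'))
    · rw [List.concat_eq_append] at *
      by_cases hz'z : adj z' z
      · have h3 : z' = x ∨ z' = y := by unfold adj at hzx hzy hz'z; omega
        have aux : ∀ x, VV (((V ++ [z']) ++ [z]) ++ [x]) → z' ≠ x := by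
          rintro x hv rfl
          have hv' : VV ([z', z, z']) := by
            have : VV (V ++ [z', z, z']) := by simpa using hv
            exact this.right
          have := VV_rep (P := [z]) (Q := []) hv'
          simp at this; omega
        rcases h3 with h | h
        · exact aux x hVx h
        · exact aux y hVy h
      · have hne : z' ≠ z := by
          rintro rfl
          have hv' : VV [z', z'] := by
            have : VV (V ++ [z', z'] ++ [x]) := by simpa using hVx
            exact this.left.right
          have := VV_rep (P := []) (Q := []) hv'
          simp at this
        have aux : ∀ x, adj z x → (¬ adj z' x) → z' ≠ x ∧
            Eqv (((V ++ [z']) ++ [z]) ++ [x]) ((V ++ [z, x]) ++ [z']) := by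
          intro x h1 h2
          refine ⟨by rintro rfl; exact hz'z (adj_comm.1 h1), ?_⟩
          have e1 : Eqv [z', z, x] [z, x, z'] :=
            (Eqv.swap hz'z [x]).trans ((Eqv.swap h2 []).cons z)
          simpa using (Eqv.refl V).append e1
        have hx' : adj z' x := by
          by_contra h
          obtain ⟨h1, h2⟩ := aux x hzx h
          exact hng (two _ _ _ _ hU h2 h1)
        have hy' : adj z' y := by
          by_contra h
          obtain ⟨h1, h2⟩ := aux y hzy h
          exact hng' (two _ _ _ _ hU' h2 h1)
        unfold adj at hx' hy' hzx hzy
        omega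

/-! ### Folding -/
def dbl : List ℤ → List ℤ
  | [] => []
  | k :: w => -k :: (k + 1) :: dbl w

def VB (w : List ℤ) : Prop := ∀ k, 0 ≤ k → (FF k w).IsChain (· ≠ ·)

theorem Eqv.VB {a b : List ℤ} (h : Eqv a b) (ha : VB a) : VB b := fun k hk => h k ▸ ha k hk
theorem VB.left {a b : List ℤ} (h : VB (a ++ b)) : VB a := fun k hk => by
  have := h k hk; rw [FF_append] at this; exact this.left_of_append
theorem VB.right {a b : List ℤ} (h : VB (a ++ b)) : VB b := fun k hk => by
  have := h k hk; rw [FF_append] at this; exact this.right_of_append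
theorem VB.tail {b : List ℤ} {x : ℤ} (h : VB (x :: b)) : VB b := VB.right (a := [x]) h

theorem dbl_append (a b : List ℤ) : dbl (a ++ b) = dbl a ++ dbl b := by
  induction a with
  | nil => rfl
  | cons x a ih => simp [dbl, ih]

theorem fold_step {h w : ℤ} (h0 : 0 ≤ h) (w0 : 0 ≤ w) (hw : h ≠ w) :
    swO [-h, h + 1] [-w, w + 1] = (if adj h w then [-h, h + 1] else [-w, w + 1]) ∧
    swH [-h, h + 1] [-w, w + 1] = (if adj h w then [-w, w + 1] else [-h, h + 1]) := by
  have n1 : ¬ adj (h + 1) (-w) := by unfold adj; omega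
  have n2 : adj (h + 1) (w + 1) ↔ adj h w := by unfold adj; omega
  have n3 : adj (-h) (-w) ↔ adj h w := by unfold adj; omega
  have n4 : ¬ adj (-w) (h + 1) := by unfold adj; omega
  have n5 : ¬ adj (-h) (w + 1) := by unfold adj; omega
  by_cases ha : adj h w
  · simp [swO, swH, slO, slH, n1, n2, n3, n4, ha]
  · simp [swO, swH, slO, slH, n1, n2, n3, n5, ha]

theorem fold_slide (h : ℤ) (ws : List ℤ) (h0 : 0 ≤ h) (hn : ∀ x ∈ ws, 0 ≤ x) (hV : VB (h :: ws)) :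
    swO [-h, h + 1] (dbl ws) = dbl (slO h ws) ∧
    swH [-h, h + 1] (dbl ws) = [-slH h ws, slH h ws + 1] := by
  induction ws generalizing h with
  | nil => simp [dbl, slO, slH, sw_nil_right]
  | cons w ws ih =>
    have w0 : 0 ≤ w := hn w (by simp)
    have hw : h ≠ w := by
      rintro rfl
      have := hV h h0
      simp [FF_cons] at this
    have hd : dbl (w :: ws) = [-w, w + 1] ++ dbl ws := rfl
    have hn' : ∀ x ∈ ws, 0 ≤ x := fun x hx => hn x (by simp [hx])
    rw [hd, swO_append_right, swH_append_right, (fold_step h0 w0 hw).1, (fold_step h0 w0 hw).2]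
    by_cases ha : adj h w
    · obtain ⟨i1, i2⟩ := ih w w0 hn' hV.tail
      simp [ha, slO, slH, i1, i2, dbl]
    · obtain ⟨i1, i2⟩ := ih h h0 hn' ((Eqv.swap ha ws).VB hV).tail
      simp [ha, slO, slH, i1, i2, dbl]

theorem mem_swO {U T : List ℤ} {x : ℤ} (h : x ∈ swO U T) : x ∈ U ++ T :=
  ((sw_eqv U T).mem x).1 (by simp [h])

theorem fold_sw (U T : List ℤ) (hn : ∀ x ∈ U ++ T, 0 ≤ x) (hV : VB (U ++ T)) :
    swO (dbl U) (dbl T) = dbl (swO U T) ∧ swH (dbl U) (dbl T) = dbl (swH U T) := by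
  induction U with
  | nil => simp [dbl, swO, swH]
  | cons u us ih =>
    obtain ⟨i1, i2⟩ := ih (fun x hx => hn x (by simp only [List.cons_append, List.mem_cons]; exact Or.inr hx)) hV.tail
    have hd : dbl (u :: us) = [-u, u + 1] ++ dbl us := rfl
    have hV2 : VB (u :: swO us T) := by
      have h3 := (Eqv.cons u (sw_eqv us T)).symm.VB hV
      exact VB.left (b := swH us T) h3
    obtain ⟨j1, j2⟩ := fold_slide u (swO us T) (hn u (by simp))
      (fun x hx => hn x (by simp only [List.cons_append, List.mem_cons]; exact Or.inr (mem_swO hx))) hV2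
    rw [hd, swO_append_left, swH_append_left, i1, i2, j1, j2]
    simp [swO, swH, dbl]

structure TB (w : List ℤ) : Prop where
  nn : ∀ x ∈ w, 0 ≤ x
  vb : VB w
  hd : ∀ k, 0 ≤ k → (FF k w).head? ≠ Option.some (k + 1)
  lt : ∀ k, 0 ≤ k → (FF k w).getLast? ≠ Option.some (k + 1)

theorem dbl_cons_FF (m x : ℤ) (w : List ℤ) : FF m (dbl (x :: w)) = FF m [-x, x+1] ++ FF m (dbl w) := by
  rw [← FF_append]; rfl

theorem FF_dbl_pos {w : List ℤ} (hn : ∀ x ∈ w, 0 ≤ x) {m : ℤ} (hm : 1 ≤ m) :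
    FF m (dbl w) = (FF (m - 1) w).map (· + 1) := by
  induction w with
  | nil => rfl
  | cons x w ih =>
    have hx := hn x (by simp)
    rw [dbl_cons_FF, ih fun y hy => hn y (by simp [hy])]
    simp only [FF_cons, FF_nil]
    split_ifs <;> first | omega | simp

theorem FF_dbl_neg {w : List ℤ} (hn : ∀ x ∈ w, 0 ≤ x) {m : ℤ} (hm : m < 0) :
    FF m (dbl w) = (FF (-m - 1) w).map (fun x => -x) := by
  induction w with
  | nil => rfl
  | cons x w ih =>
    have hx := hn x (by simp)
    rw [dbl_cons_FF, ih fun y hy => hn y (by simp [hy])]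
    simp only [FF_cons, FF_nil]
    split_ifs <;> first | omega | simp

theorem FF_dbl_zero {w : List ℤ} (hn : ∀ x ∈ w, 0 ≤ x) :
    (FF 0 (dbl w)).IsChain (· ≠ ·) ∧ (FF 0 (dbl w)).head? ≠ Option.some 1 ∧
      (FF 0 (dbl w)).getLast? ≠ Option.some 0 := by
  induction w with
  | nil => simp [dbl, FF]
  | cons x w ih =>
    have hx := hn x (by simp)
    obtain ⟨i1, i2, i3⟩ := ih fun y hy => hn y (by simp [hy])
    rw [dbl_cons_FF]
    by_cases h0 : x = 0
    · subst h0
      have : FF 0 [-0, 0 + 1] = [0, 1] := by decide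
      rw [this]
      refine ⟨?_, by simp, ?_⟩
      · simp only [List.cons_append, List.nil_append, List.isChain_cons]
        refine ⟨by simp, ?_, i1⟩
        rintro y hy rfl
        exact i2 (by simpa using hy)
      · rcases List.eq_nil_or_concat (FF 0 (dbl w)) with h | ⟨l, y, h⟩
        · rw [h]; simp
        · rw [h] at i3 ⊢; rw [List.concat_eq_append] at i3 ⊢
          rw [← List.append_assoc, List.getLast?_concat]
          rwa [List.getLast?_concat] at i3
    · have : FF 0 [-x, x + 1] = [] := by
        simp only [FF_cons, FF_nil]
        split_ifs <;> first | omega | rfl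
      rw [this]
      exact ⟨i1, i2, i3⟩

theorem TB.VVd {w : List ℤ} (h : TB w) : VV (dbl w) := by
  intro k
  rcases lt_trichotomy k 0 with hk | rfl | hk
  · rw [FF_dbl_neg h.nn hk, List.isChain_map]
    refine (h.vb (-k-1) (by omega)).imp ?_
    intro a b hab; simpa using hab
  · exact (FF_dbl_zero h.nn).1
  · rw [FF_dbl_pos h.nn (by omega), List.isChain_map]
    refine (h.vb (k-1) (by omega)).imp ?_
    intro a b hab; simpa using hab

theorem TB.SSd {w : List ℤ} (h : TB w) : SS (dbl w) := by
  intro k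
  rcases lt_trichotomy k 0 with hk | rfl | hk
  · refine ⟨fun _ hh => ?_, fun h => by omega⟩
    rw [FF_dbl_neg h.nn hk, List.head?_map, Option.map_eq_some_iff] at hh
    obtain ⟨a, h1, h2⟩ := hh
    exact h.hd (-k-1) (by omega) (by rw [h1]; congr 1; omega)
  · exact ⟨fun h => by omega, fun _ => (FF_dbl_zero h.nn).2.1⟩
  · refine ⟨fun h => by omega, fun _ hh => ?_⟩
    rw [FF_dbl_pos h.nn (by omega), List.head?_map, Option.map_eq_some_iff] at hh
    obtain ⟨a, h1, h2⟩ := hh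
    exact h.hd (k-1) (by omega) (by rw [h1]; congr 1; omega)

theorem TB.EEd {w : List ℤ} (h : TB w) : EE (dbl w) := by
  intro k
  rcases lt_trichotomy k 0 with hk | rfl | hk
  · refine ⟨fun _ hh => ?_, fun h => by omega⟩
    rw [FF_dbl_neg h.nn hk, List.getLast?_map, Option.map_eq_some_iff] at hh
    obtain ⟨a, h1, h2⟩ := hh
    exact h.lt (-k-1) (by omega) (by rw [h1]; congr 1; omega)
  · exact ⟨fun _ => (FF_dbl_zero h.nn).2.2, fun h => by omega⟩
  · refine ⟨fun h => by omega, fun _ hh => ?_⟩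
    rw [FF_dbl_pos h.nn (by omega), List.getLast?_map, Option.map_eq_some_iff] at hh
    obtain ⟨a, h1, h2⟩ := hh
    exact h.lt (k-1) (by omega) (by rw [h1]; congr 1; omega)

theorem dbl_count {w : List ℤ} (hn : ∀ x ∈ w, 0 ≤ x) {k : ℤ} (hk : 0 ≤ k) :
    (dbl w).count (k + 1) = w.count k ∧ (dbl w).count (-k) = w.count k := by
  induction w with
  | nil => simp [dbl]
  | cons x w ih =>
    have hx := hn x (by simp)
    obtain ⟨i1, i2⟩ := ih fun y hy => hn y (by simp [hy])
    simp only [dbl, List.count_cons, i1, i2, beq_iff_eq]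
    constructor <;> split_ifs <;> omega

theorem TB.symm_count {w : List ℤ} (h : TB w) (k : ℤ) :
    (dbl w).count k = (dbl w).count (1 - k) := by
  rcases le_or_gt k 0 with hk | hk
  · have := dbl_count h.nn (k := -k) (by omega)
    rw [neg_neg] at this
    rw [this.2, ← this.1]; congr 1; ring
  · have := dbl_count h.nn (k := k - 1) (by omega)
    rw [sub_add_cancel] at this
    rw [this.1, ← this.2]; congr 1; ring

theorem typeB_count {U T : List ℤ} (h : TB (U ++ T)) {k : ℤ} (hk : 0 ≤ k) :
    (swO U T).count k = T.count k := by
  have hg : good (dbl U) (dbl T) := by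
    refine main_words h.VVd h.SSd h.EEd h.symm_count ?_ _ _ _ rfl
      (by rw [← dbl_append]; exact Eqv.refl _)
    intro T' hT'
    obtain ⟨W, hW⟩ : ∃ W, W = U ++ T := ⟨_, rfl⟩
    rw [← hW] at h hT'
    cases W with
    | nil => have := hT'.length; simp [dbl] at this
    | cons x W1 =>
      have hx : x = 0 := by
        by_contra hne
        have h0 := h.nn x (by simp)
        have := h.hd (x - 1) (by omega)
        rw [FF_cons] at this
        simp at this
      subst hx
      have hd : dbl (0 :: W1) = [0, 1] ++ dbl W1 := rfl
      rw [hd] at hT'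
      have hT1 := hT'.cancel_left
      have hV := hT'.symm.VV (hd ▸ h.VVd)
      have hE := hT'.symm.EE (hd ▸ h.EEd)
      have e1 := DE_of hV.right hE.right hT1 [0, 1] hV
      have e2 := fold_slide 0 W1 le_rfl (fun y hy => h.nn y (by simp [hy])) h.vb
      simp only [neg_zero, zero_add] at e2
      rw [e2.2] at e1
      have e3 := sw_eqv [0, 1] (dbl W1)
      have e4 : EE (swH [0, 1] (dbl W1)) := (e3.symm.EE (hd ▸ h.EEd)).right
      rw [e2.2] at e4
      have e5 : 0 ≤ slH 0 W1 := by
        have : slH 0 W1 ∈ 0 :: W1 := ((slide_eqv 0 W1).mem _).1 (by simp)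
        exact h.nn _ this
      have e6 : slH 0 W1 = 0 := by
        by_contra hne
        have := (e4 (slH 0 W1)).2 (by omega)
        apply this
        rw [FF_cons, if_neg (by omega), FF_cons, if_pos (by omega), FF_nil]
        rfl
      rw [e6] at e1
      intro k
      rw [e1]
      simp only [List.count_cons, beq_iff_eq, List.count_nil]
      split_ifs <;> omega
  have hnU : ∀ x ∈ U, 0 ≤ x := fun x hx => h.nn x (by simp [hx])
  have hp := sw_eqv U T
  have hnH : ∀ x ∈ swH U T, 0 ≤ x := fun x hx => h.nn x ((hp.mem x).1 (by simp [hx]))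
  have h1 := hg (k + 1)
  rw [(fold_sw U T h.nn h.vb).2, (dbl_count hnH hk).1] at h1
  have h2 : 1 - (k + 1) = -k := by ring
  rw [h2, (dbl_count hnU hk).2] at h1
  have h3 := hp.count k
  rw [List.count_append, List.count_append] at h3
  omega

/-! ### Confluence of switching -/
def Good (p : Filling × Filling) : Prop :=
  IsPartialTableau p.1 ∧ IsPartialTableau p.2 ∧ ∀ x ∈ p.1, ∀ y ∈ p.2, x.1 ≠ y.1

theorem Good.step {p q : Filling × Filling} (hp : Good p) (h : SwitchStep p q) : Good q := by
  obtain ⟨c, u, d, t, h1, h2, hcd, e1, e2, h3, h4⟩ := h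
  refine ⟨h3, h4, ?_⟩
  obtain ⟨g1, g2, g3⟩ := hp
  have hne : c ≠ d := by rintro rfl; exact g3 _ h2 _ h1 rfl
  intro x hx y hy
  rw [e1, Finset.mem_insert, Finset.mem_erase] at hx
  rw [e2, Finset.mem_insert, Finset.mem_erase] at hy
  rcases hx with rfl | ⟨hx1, hx2⟩ <;> rcases hy with rfl | ⟨hy1, hy2⟩
  · exact hne
  · intro h
    exact hy1 (g2.1 _ hy2 _ h1 h.symm)
  · intro h
    exact hx1 (g1.1 _ hx2 _ h2 h)
  · exact g3 _ hx2 _ hy2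

theorem PT_glue {r f1 f2 : Filling} {a b : Cell × ℕ}
    (hf1 : IsPartialTableau f1) (hf2 : IsPartialTableau f2)
    (h1 : ∀ x ∈ r, x = b ∨ x ∈ f1) (h2 : ∀ x ∈ r, x = a ∨ x ∈ f2)
    (n1 : a.1 ≠ b.1) (n2 : a.2 ≠ b.2)
    (r1 : a.1.1 = b.1.1 → a.1.2 < b.1.2 → a.2 < b.2)
    (r2 : a.1.1 = b.1.1 → b.1.2 < a.1.2 → b.2 < a.2)
    (r3 : a.1.2 = b.1.2 → a.1.1 < b.1.1 → a.2 < b.2)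
    (r4 : a.1.2 = b.1.2 → b.1.1 < a.1.1 → b.2 < a.2) : IsPartialTableau r := by
  have key : ∀ x ∈ r, ∀ y ∈ r, (x ∈ f1 ∧ y ∈ f1) ∨ (x ∈ f2 ∧ y ∈ f2) ∨ (x = a ∧ y = b) ∨
      (x = b ∧ y = a) := by
    intro x hx y hy
    have hab : a ≠ b := fun h => n1 (by rw [h])
    have k1 := h1 x hx
    have k2 := h2 x hx
    have k3 := h1 y hy
    have k4 := h2 y hy
    have k5 : x = a → x ≠ b := fun h => by rw [h]; exact hab
    have k6 : y = a → y ≠ b := fun h => by rw [h]; exact hab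
    clear h1 h2 r1 r2 r3 r4 hf1 hf2 hx hy n1 n2
    tauto
  refine ⟨?_, ?_, ?_, ?_⟩
  · intro x hx y hy h
    rcases key x hx y hy with ⟨k1, k2⟩ | ⟨k1, k2⟩ | ⟨rfl, rfl⟩ | ⟨rfl, rfl⟩
    · exact hf1.1 _ k1 _ k2 h
    · exact hf2.1 _ k1 _ k2 h
    · exact absurd h n1
    · exact absurd h.symm n1
  · intro x hx y hy h
    rcases key x hx y hy with ⟨k1, k2⟩ | ⟨k1, k2⟩ | ⟨rfl, rfl⟩ | ⟨rfl, rfl⟩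
    · exact hf1.2.1 _ k1 _ k2 h
    · exact hf2.2.1 _ k1 _ k2 h
    · exact absurd h n2
    · exact absurd h.symm n2
  · intro x hx y hy h h'
    rcases key x hx y hy with ⟨k1, k2⟩ | ⟨k1, k2⟩ | ⟨rfl, rfl⟩ | ⟨rfl, rfl⟩
    · exact hf1.2.2.1 _ k1 _ k2 h h'
    · exact hf2.2.2.1 _ k1 _ k2 h h'
    · exact r1 h h'
    · exact r2 h.symm h'
  · intro x hx y hy h h'
    rcases key x hx y hy with ⟨k1, k2⟩ | ⟨k1, k2⟩ | ⟨rfl, rfl⟩ | ⟨rfl, rfl⟩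
    · exact hf1.2.2.2 _ k1 _ k2 h h'
    · exact hf2.2.2.2 _ k1 _ k2 h h'
    · exact r3 h h'
    · exact r4 h.symm h'

/-- Comparison of two moved outer entries. -/
theorem moved_outer {p1 q1 q2 : Filling} {c1 d1 c2 d2 : Cell} {t1 t2 : ℕ}
    (hp : IsPartialTableau p1) (hq1 : IsPartialTableau q1) (hq2 : IsPartialTableau q2)
    (e1 : d1 = (c1.1, c1.2 + 1) ∨ d1 = (c1.1 + 1, c1.2))
    (e2 : d2 = (c2.1, c2.2 + 1) ∨ d2 = (c2.1 + 1, c2.2))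
    (m1 : (d1, t1) ∈ p1) (m2 : (d2, t2) ∈ p1)
    (m3 : (c1, t1) ∈ q1) (m4 : (d2, t2) ∈ q1)
    (m5 : (d1, t1) ∈ q2) (m6 : (c2, t2) ∈ q2) (hne : d1 ≠ c2) :
    (c1.1 = c2.1 → c1.2 < c2.2 → t1 < t2) ∧ (c1.2 = c2.2 → c1.1 < c2.1 → t1 < t2) := by
  obtain ⟨i1, j1⟩ := c1
  obtain ⟨i2, j2⟩ := c2
  simp only at *
  constructor
  · intro h1 h2
    rcases e2 with rfl | rfl
    · exact hq1.2.2.1 _ m3 _ m4 h1 (by simp only; omega)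
    · rcases e1 with rfl | rfl
      · refine hq2.2.2.1 _ m5 _ m6 h1 ?_
        simp only [ne_eq, Prod.mk.injEq, not_and] at hne ⊢
        have := hne h1
        omega
      · exact hp.2.2.1 _ m1 _ m2 (by simp only; omega) h2
  · intro h1 h2
    rcases e2 with rfl | rfl
    · rcases e1 with rfl | rfl
      · exact hp.2.2.2 _ m1 _ m2 (by simp only; omega) h2
      · refine hq2.2.2.2 _ m5 _ m6 h1 ?_
        simp only [ne_eq, Prod.mk.injEq, not_and] at hne ⊢
        by_contra h3
        exact hne (by omega) h1
    · exact hq1.2.2.2 _ m3 _ m4 h1 (by simp only; omega)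

/-- Comparison of two moved inner entries. -/
theorem moved_inner {p2 q1 q2 : Filling} {c1 d1 c2 d2 : Cell} {t1 t2 : ℕ}
    (hp : IsPartialTableau p2) (hq1 : IsPartialTableau q1) (hq2 : IsPartialTableau q2)
    (e1 : d1 = (c1.1, c1.2 + 1) ∨ d1 = (c1.1 + 1, c1.2))
    (e2 : d2 = (c2.1, c2.2 + 1) ∨ d2 = (c2.1 + 1, c2.2))
    (m1 : (c1, t1) ∈ p2) (m2 : (c2, t2) ∈ p2)
    (m3 : (d1, t1) ∈ q1) (m4 : (c2, t2) ∈ q1)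
    (m5 : (c1, t1) ∈ q2) (m6 : (d2, t2) ∈ q2) (hne : d1 ≠ c2) :
    (d1.1 = d2.1 → d1.2 < d2.2 → t1 < t2) ∧ (d1.2 = d2.2 → d1.1 < d2.1 → t1 < t2) := by
  obtain ⟨i1, j1⟩ := c1
  obtain ⟨i2, j2⟩ := c2
  simp only at *
  constructor
  · intro h1 h2
    rcases e2 with rfl | rfl
    · refine hq1.2.2.1 _ m3 _ m4 h1 ?_
      obtain ⟨i, j⟩ := d1
      simp only [ne_eq, Prod.mk.injEq, not_and] at hne h1 h2 ⊢
      have := hne h1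
      omega
    · rcases e1 with rfl | rfl
      · exact hq2.2.2.1 _ m5 _ m6 h1 (by simp only at h2 ⊢; omega)
      · exact hp.2.2.1 _ m1 _ m2 (by simp only at h1 ⊢; omega) h2
  · intro h1 h2
    rcases e2 with rfl | rfl
    · rcases e1 with rfl | rfl
      · exact hp.2.2.2 _ m1 _ m2 (by simp only at h1 ⊢; omega) h2
      · exact hq2.2.2.2 _ m5 _ m6 h1 (by simp only at h2 ⊢; omega)
    · refine hq1.2.2.2 _ m3 _ m4 h1 ?_
      obtain ⟨i, j⟩ := d1
      simp only [ne_eq, Prod.mk.injEq, not_and] at hne h1 h2 ⊢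
      by_contra h3
      exact hne (by omega) h1

theorem ins_comm {α : Type*} [DecidableEq α] (s : Finset α) {a1 a2 b1 b2 : α}
    (h1 : a1 ≠ b2) (h2 : a2 ≠ b1) :
    insert a2 ((insert a1 (s.erase b1)).erase b2) =
      insert a1 ((insert a2 (s.erase b2)).erase b1) := by
  ext x
  simp only [Finset.mem_insert, Finset.mem_erase]
  have k1 : x = a1 → x ≠ b2 := fun h => by rw [h]; exact h1
  have k2 : x = a2 → x ≠ b1 := fun h => by rw [h]; exact h2
  clear h1 h2
  tauto

theorem diamond {p q1 q2 : Filling × Filling} (hp : Good p) (s1 : SwitchStep p q1)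
    (s2 : SwitchStep p q2) : q1 = q2 ∨ ∃ r, SwitchStep q1 r ∧ SwitchStep q2 r := by
  obtain ⟨c1, u1, d1, t1, hu1, ht1, a1, e1, f1, pt1, pu1⟩ := s1
  obtain ⟨c2, u2, d2, t2, hu2, ht2, a2, e2, f2, pt2, pu2⟩ := s2
  obtain ⟨g1, g2, g3⟩ := hp
  have m1 : (c1, t1) ∈ q1.1 := by rw [e1]; simp
  have m2 : (c2, t2) ∈ q2.1 := by rw [e2]; simp
  have m3 : (d1, u1) ∈ q1.2 := by rw [f1]; simp
  have m4 : (d2, u2) ∈ q2.2 := by rw [f2]; simp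
  by_cases hc : c1 = c2
  · subst hc
    have hu : u1 = u2 := by have := g2.1 _ hu1 _ hu2 rfl; simpa using this
    subst hu
    by_cases hd : d1 = d2
    · subst hd
      have ht : t1 = t2 := by have := g1.1 _ ht1 _ ht2 rfl; simpa using this
      subst ht
      left; exact Prod.ext (e1.trans e2.symm) (f1.trans f2.symm)
    · exfalso
      have m5 : (d2, t2) ∈ q1.1 := by
        rw [e1]; simp only [Finset.mem_insert, Finset.mem_erase, ne_eq, Prod.mk.injEq]
        exact Or.inr ⟨fun h => hd h.1.symm, ht2⟩
      have m6 : (d1, t1) ∈ q2.1 := by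
        rw [e2]; simp only [Finset.mem_insert, Finset.mem_erase, ne_eq, Prod.mk.injEq]
        exact Or.inr ⟨fun h => hd h.1, ht1⟩
      rcases a1 with rfl | rfl <;> rcases a2 with rfl | rfl
      · exact hd rfl
      · have x1 := pt1.2.2.2 _ m1 _ m5 rfl (by simp)
        have x2 := pt2.2.2.1 _ m2 _ m6 rfl (by simp)
        simp only at x1 x2; omega
      · have x1 := pt1.2.2.1 _ m1 _ m5 rfl (by simp)
        have x2 := pt2.2.2.2 _ m2 _ m6 rfl (by simp)
        simp only at x1 x2; omega
      · exact hd rfl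
  have hu : u1 ≠ u2 := by
    rintro rfl; have := g2.2.1 _ hu1 _ hu2 rfl; simp at this; exact hc this
  by_cases hd : d1 = d2
  · exfalso
    subst hd
    have m5 : (c2, u2) ∈ q1.2 := by
      rw [f1]; simp only [Finset.mem_insert, Finset.mem_erase, ne_eq, Prod.mk.injEq]
      exact Or.inr ⟨fun h => hc h.1.symm, hu2⟩
    have m6 : (c1, u1) ∈ q2.2 := by
      rw [f2]; simp only [Finset.mem_insert, Finset.mem_erase, ne_eq, Prod.mk.injEq]
      exact Or.inr ⟨fun h => hc h.1, hu1⟩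
    obtain ⟨i1, j1⟩ := c1
    obtain ⟨i2, j2⟩ := c2
    rcases a1 with rfl | rfl <;> rcases a2 with h | h <;>
      simp only [Prod.mk.injEq] at h <;> obtain ⟨h1, h2⟩ := h
    · exact hc (by simp only [Prod.mk.injEq]; omega)
    · have x1 := pu1.2.2.2 _ m5 _ m3 h2.symm (by simp only; omega)
      have x2 := pu2.2.2.1 _ m6 _ m4 rfl (by simp)
      simp only at x1 x2; omega
    · have x1 := pu1.2.2.1 _ m5 _ m3 h1.symm (by simp only; omega)
      have x2 := pu2.2.2.2 _ m6 _ m4 rfl (by simp)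
      simp only at x1 x2; omega
    · exact hc (by simp only [Prod.mk.injEq]; omega)
  have ht : t1 ≠ t2 := by
    rintro rfl; have := g1.2.1 _ ht1 _ ht2 rfl; simp at this; exact hd this
  have hdc12 : d1 ≠ c2 := g3 _ ht1 _ hu2
  have hdc21 : d2 ≠ c1 := g3 _ ht2 _ hu1
  have hdc11 : d1 ≠ c1 := g3 _ ht1 _ hu1
  have hdc22 : d2 ≠ c2 := g3 _ ht2 _ hu2
  have n1 : (d2, t2) ∈ q1.1 := by
    rw [e1]; simp only [Finset.mem_insert, Finset.mem_erase, ne_eq, Prod.mk.injEq]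
    exact Or.inr ⟨fun h => hd h.1.symm, ht2⟩
  have n2 : (d1, t1) ∈ q2.1 := by
    rw [e2]; simp only [Finset.mem_insert, Finset.mem_erase, ne_eq, Prod.mk.injEq]
    exact Or.inr ⟨fun h => hd h.1, ht1⟩
  have n3 : (c2, u2) ∈ q1.2 := by
    rw [f1]; simp only [Finset.mem_insert, Finset.mem_erase, ne_eq, Prod.mk.injEq]
    exact Or.inr ⟨fun h => hc h.1.symm, hu2⟩
  have n4 : (c1, u1) ∈ q2.2 := by
    rw [f2]; simp only [Finset.mem_insert, Finset.mem_erase, ne_eq, Prod.mk.injEq]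
    exact Or.inr ⟨fun h => hc h.1, hu1⟩
  right
  refine ⟨(insert (c2, t2) (q1.1.erase (d2, t2)), insert (d2, u2) (q1.2.erase (c2, u2))), ?_⟩
  have E1 : insert (c2, t2) (q1.1.erase (d2, t2)) = insert (c1, t1) (q2.1.erase (d1, t1)) := by
    rw [e1, e2]
    exact ins_comm p.1 (fun h => hdc21 (Prod.ext_iff.1 h).1.symm)
      (fun h => hdc12 (Prod.ext_iff.1 h).1.symm)
  have E2 : insert (d2, u2) (q1.2.erase (c2, u2)) = insert (d1, u1) (q2.2.erase (c1, u1)) := by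
    rw [f1, f2]
    exact ins_comm p.2 (fun h => hdc12 (Prod.ext_iff.1 h).1)
      (fun h => hdc21 (Prod.ext_iff.1 h).1)
  obtain ⟨o1, o2⟩ := moved_outer g1 pt1 pt2 a1 a2 ht1 ht2 m1 n1 n2 m2 hdc12
  obtain ⟨o3, o4⟩ := moved_outer g1 pt2 pt1 a2 a1 ht2 ht1 m2 n2 n1 m1 hdc21
  obtain ⟨o5, o6⟩ := moved_inner g2 pu1 pu2 a1 a2 hu1 hu2 m3 n3 n4 m4 hdc12
  obtain ⟨o7, o8⟩ := moved_inner g2 pu2 pu1 a2 a1 hu2 hu1 m4 n4 n3 m3 hdc21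
  have PT : IsPartialTableau (insert (c2, t2) (q1.1.erase (d2, t2))) := by
    refine PT_glue (a := (c1, t1)) (b := (c2, t2)) pt1 pt2 ?_ ?_ hc ht o1
      (fun h => o3 h.symm) o2 (fun h => o4 h.symm)
    · intro x hx; simp only [Finset.mem_insert, Finset.mem_erase] at hx
      exact hx.imp id fun h => h.2
    · intro x hx; rw [E1] at hx; simp only [Finset.mem_insert, Finset.mem_erase] at hx
      exact hx.imp id fun h => h.2
  have PU : IsPartialTableau (insert (d2, u2) (q1.2.erase (c2, u2))) := by
    refine PT_glue (a := (d1, u1)) (b := (d2, u2)) pu1 pu2 ?_ ?_ hd hu o5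
      (fun h => o7 h.symm) o6 (fun h => o8 h.symm)
    · intro x hx; simp only [Finset.mem_insert, Finset.mem_erase] at hx
      exact hx.imp id fun h => h.2
    · intro x hx; rw [E2] at hx; simp only [Finset.mem_insert, Finset.mem_erase] at hx
      exact hx.imp id fun h => h.2
  exact ⟨⟨c2, u2, d2, t2, n3, n1, a2, rfl, rfl, PT, PU⟩,
    ⟨c1, u1, d1, t1, n4, n2, a1, E1, E2, PT, PU⟩⟩

theorem switch_unique {p a b : Filling × Filling} (hp : Good p)
    (ha : Relation.ReflTransGen SwitchStep p a) (hb : Relation.ReflTransGen SwitchStep p b)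
    (ta : ∀ q, ¬ SwitchStep a q) (tb : ∀ q, ¬ SwitchStep b q) : a = b := by
  let r : Filling × Filling → Filling × Filling → Prop := fun x y => Good x ∧ SwitchStep x y
  have lift : ∀ c, Relation.ReflTransGen SwitchStep p c → Good c ∧ Relation.ReflTransGen r p c := by
    intro c hc
    induction hc with
    | refl => exact ⟨hp, .refl⟩
    | tail _ h ih => exact ⟨ih.1.step h, ih.2.tail ⟨ih.1, h⟩⟩
  have cr := Relation.church_rosser (r := r) (a := p) (b := a) (c := b) ?_ (lift a ha).2 (lift b hb).2
  · obtain ⟨d, h1, h2⟩ := cr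
    have k1 : a = d := by
      rcases Relation.ReflTransGen.cases_head h1 with h | ⟨e, h, _⟩
      · exact h
      · exact absurd h.2 (ta e)
    have k2 : b = d := by
      rcases Relation.ReflTransGen.cases_head h2 with h | ⟨e, h, _⟩
      · exact h
      · exact absurd h.2 (tb e)
    rw [k1, k2]
  · rintro x y z ⟨hx, hy⟩ ⟨_, hz⟩
    rcases diamond hx hy hz with rfl | ⟨w, h1, h2⟩
    · exact ⟨y, .refl, .refl⟩
    · exact ⟨w, .single ⟨hx.step hy, h1⟩, .single ⟨hx.step hz, h2⟩⟩

/-! ### Switching along a linear extension -/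
def cont (c : Cell) : ℤ := (c.2 : ℤ) - c.1

def itemsOf (b : Bool) (L : List (Bool × Cell × ℕ)) : List (Cell × ℕ) :=
  (L.filter (fun x => x.1 = b)).map (fun x => x.2)

def fillOf (L : List (Bool × Cell × ℕ)) : Filling × Filling :=
  ((itemsOf true L).toFinset, (itemsOf false L).toFinset)

structure Inv (n : ℕ) (L : List (Bool × Cell × ℕ)) : Prop where
  lin : (L.map (fun x => x.2.1)).Pairwise (fun a b => ¬ b ≤ a)
  cells : ∀ c : Cell, c ∈ L.map (fun x => x.2.1) ↔ c.1 ≤ c.2 ∧ c.2 < n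
  ent : ∀ b, ((itemsOf b L).map (fun x => x.2)).Pairwise (· < ·)

def LStep (L L' : List (Bool × Cell × ℕ)) : Prop :=
  ∃ P Q c u d t, L = P ++ (false, c, u) :: (true, d, t) :: Q ∧
    L' = if adj (cont c) (cont d) then P ++ (true, c, t) :: (false, d, u) :: Q
      else P ++ (true, d, t) :: (false, c, u) :: Q

theorem itemsOf_append (b : Bool) (L M : List (Bool × Cell × ℕ)) :
    itemsOf b (L ++ M) = itemsOf b L ++ itemsOf b M := by simp [itemsOf]

theorem itemsOf_sub (b : Bool) (L : List (Bool × Cell × ℕ)) :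
    ((itemsOf b L).map (fun x => x.1)).Sublist (L.map (fun x => x.2.1)) := by
  unfold itemsOf
  rw [List.map_map]
  exact (List.filter_sublist (l := L)).map _

theorem PT_of_list (M : List (Cell × ℕ))
    (h1 : (M.map (fun x => x.1)).Pairwise (fun a b => ¬ b ≤ a))
    (h2 : (M.map (fun x => x.2)).Pairwise (· < ·)) : IsPartialTableau M.toFinset := by
  rw [List.pairwise_map] at h1 h2
  have h := h1.and h2
  have key : ∀ x ∈ M, ∀ y ∈ M, x = y ∨ (¬ y.1 ≤ x.1 ∧ x.2 < y.2) ∨ (¬ x.1 ≤ y.1 ∧ y.2 < x.2) := by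
    intro x hx y hy
    induction h with
    | nil => simp at hx
    | @cons a l ha hl ih =>
      rcases List.mem_cons.1 hx with rfl | hx'
      · rcases List.mem_cons.1 hy with rfl | hy'
        · exact Or.inl rfl
        · exact Or.inr (Or.inl (ha _ hy'))
      · rcases List.mem_cons.1 hy with rfl | hy'
        · exact Or.inr (Or.inr (ha _ hx'))
        · exact ih (List.pairwise_cons.1 h1).2 (List.pairwise_cons.1 h2).2 hx' hy'
  refine ⟨?_, ?_, ?_, ?_⟩ <;> intro p hp q hq <;>
    rcases key p (List.mem_toFinset.1 hp) q (List.mem_toFinset.1 hq) with rfl | ⟨k1, k2⟩ | ⟨k1, k2⟩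
  · exact fun _ => rfl
  · intro h; exact absurd h.ge k1
  · intro h; exact absurd h.le k1
  · exact fun _ => rfl
  · intro h; omega
  · intro h; omega
  · intro _ h; omega
  · intro _ _; exact k2
  · intro h h'; exact absurd (Prod.mk_le_mk.2 ⟨h.le, h'.le⟩) k1
  · intro _ h; omega
  · intro _ _; exact k2
  · intro h h'; exact absurd (Prod.mk_le_mk.2 ⟨h'.le, h.le⟩) k1

theorem Inv.good {n : ℕ} {L : List (Bool × Cell × ℕ)} (h : Inv n L) (b : Bool) :
    IsPartialTableau (itemsOf b L).toFinset :=
  PT_of_list _ (h.lin.sublist (itemsOf_sub b L)) (h.ent b)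

theorem mem_itemsOf {b : Bool} {L : List (Bool × Cell × ℕ)} {x : Cell × ℕ} :
    x ∈ itemsOf b L ↔ (b, x) ∈ L := by
  simp [itemsOf]

theorem pw_between {α : Type*} {r : α → α → Prop} {P Q : List α} {a b x : α}
    (h : (P ++ a :: b :: Q).Pairwise (fun a b => ¬ r b a)) (hx : x ∈ P ++ a :: b :: Q)
    (h1 : r a x) (h2 : r x b) : x = a ∨ x = b := by
  rw [List.pairwise_append] at h
  obtain ⟨_, h3, h4⟩ := h
  simp only [List.mem_append, List.mem_cons] at hx
  rcases hx with hx | rfl | rfl | hx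
  · exact absurd h1 (h4 x hx a (by simp))
  · exact Or.inl rfl
  · exact Or.inr rfl
  · rw [List.pairwise_cons, List.pairwise_cons] at h3
    exact absurd h2 (h3.2.1 x hx)

theorem LStep.inv {n : ℕ} {L L' : List (Bool × Cell × ℕ)} (h : Inv n L) (hs : LStep L L') :
    Inv n L' ∧ Relation.ReflTransGen SwitchStep (fillOf L) (fillOf L') := by
  obtain ⟨P, Q, c, u, d, t, rfl, rfl⟩ := hs
  have hc : c.1 ≤ c.2 ∧ c.2 < n := (h.cells c).1 (by simp)
  have hd : d.1 ≤ d.2 ∧ d.2 < n := (h.cells d).1 (by simp)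
  have hlin := h.lin
  simp only [List.map_append, List.map_cons] at hlin
  have hdc : ¬ d ≤ c := by
    have := (List.pairwise_append.1 hlin).2.1
    exact (List.pairwise_cons.1 this).1 d (by simp)
  have hcover : c ≤ d → d = (c.1, c.2 + 1) ∨ d = (c.1 + 1, c.2) := by
    intro hle
    have hle' := Prod.le_def.1 hle
    have hbt : ∀ x : Cell, (x.1 ≤ x.2 ∧ x.2 < n) → c ≤ x → x ≤ d → x = c ∨ x = d := by
      intro x hx h1 h2
      have hm := (h.cells x).2 hx
      simp only [List.map_append, List.map_cons] at hm
      exact pw_between (r := (· ≤ ·)) hlin hm h1 h2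
    by_cases h2 : c.2 < d.2
    · left
      rcases hbt (c.1, c.2 + 1) ⟨by simp; omega, by simp; omega⟩ (Prod.le_def.2 ⟨le_rfl, by simp⟩)
        (Prod.le_def.2 ⟨hle'.1, h2⟩) with hh | hh
      · have := congrArg Prod.snd hh; simp at this
      · exact hh.symm
    · have h1 : c.1 < d.1 := by
        by_contra hcon
        exact hdc (Prod.le_def.2 ⟨by omega, by omega⟩)
      right
      rcases hbt (c.1 + 1, c.2) ⟨by simp; omega, by simp; omega⟩ (Prod.le_def.2 ⟨by simp, le_rfl⟩)
        (Prod.le_def.2 ⟨h1, hle'.2⟩) with hh | hh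
      · have := congrArg Prod.fst hh; simp at this
      · exact hh.symm
  have hent : ∀ c' d' : Cell, ∀ b,
      (itemsOf b (P ++ (true, c', t) :: (false, d', u) :: Q)).map (fun x => x.2) =
      (itemsOf b (P ++ (false, c, u) :: (true, d, t) :: Q)).map (fun x => x.2) := by
    intro c' d' b
    cases b <;> simp [itemsOf]
  split_ifs with hadj
  · have hle : c ≤ d := by
      unfold adj cont at hadj
      have hdc' := hdc
      rw [Prod.le_def] at hdc' ⊢
      omega
    have hinv : Inv n (P ++ (true, c, t) :: (false, d, u) :: Q) := by
      refine ⟨?_, ?_, ?_⟩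
      · simpa using hlin
      · intro x; rw [← h.cells x]; simp
      · intro b; rw [hent]; exact h.ent b
    refine ⟨hinv, Relation.ReflTransGen.single ?_⟩
    refine ⟨c, u, d, t, ?_, ?_, hcover hle, ?_, ?_, hinv.good true, hinv.good false⟩
    · simp [fillOf, mem_itemsOf]
    · simp [fillOf, mem_itemsOf]
    · have he := h.ent true
      have e1 : itemsOf true (P ++ (false, c, u) :: (true, d, t) :: Q) =
        itemsOf true P ++ (d, t) :: itemsOf true Q := by simp [itemsOf]
      have e2 : itemsOf true (P ++ (true, c, t) :: (false, d, u) :: Q) =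
        itemsOf true P ++ (c, t) :: itemsOf true Q := by simp [itemsOf]
      have hnd : (itemsOf true P ++ (d, t) :: itemsOf true Q).Nodup := by
        rw [e1] at he
        exact List.Nodup.of_map _ (he.imp (fun h => ne_of_lt h))
      rw [List.nodup_append'] at hnd
      obtain ⟨hP, hQ, hPQ⟩ := hnd
      rw [List.nodup_cons] at hQ
      have hP' : (d, t) ∉ itemsOf true P := fun hh => hPQ hh (by simp)
      show (itemsOf true _).toFinset = insert _ ((itemsOf true _).toFinset.erase _)
      rw [e1, e2]
      ext x
      simp only [List.mem_toFinset, List.mem_append, List.mem_cons, Finset.mem_insert,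
        Finset.mem_erase]
      by_cases hx : x = (d, t)
      · subst hx; simp [hP', hQ.1]
      · simp [hx]; tauto
    · have he := h.ent false
      have e1 : itemsOf false (P ++ (false, c, u) :: (true, d, t) :: Q) =
        itemsOf false P ++ (c, u) :: itemsOf false Q := by simp [itemsOf]
      have e2 : itemsOf false (P ++ (true, c, t) :: (false, d, u) :: Q) =
        itemsOf false P ++ (d, u) :: itemsOf false Q := by simp [itemsOf]
      have hnd : (itemsOf false P ++ (c, u) :: itemsOf false Q).Nodup := by
        rw [e1] at he
        exact List.Nodup.of_map _ (he.imp (fun h => ne_of_lt h))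
      rw [List.nodup_append'] at hnd
      obtain ⟨hP, hQ, hPQ⟩ := hnd
      rw [List.nodup_cons] at hQ
      have hP' : (c, u) ∉ itemsOf false P := fun hh => hPQ hh (by simp)
      show (itemsOf false _).toFinset = insert _ ((itemsOf false _).toFinset.erase _)
      rw [e1, e2]
      ext x
      simp only [List.mem_toFinset, List.mem_append, List.mem_cons, Finset.mem_insert,
        Finset.mem_erase]
      by_cases hx : x = (c, u)
      · subst hx; simp [hP', hQ.1]
      · simp [hx]; tauto
  · have hcd : ¬ c ≤ d := by
      intro hle
      apply hadj
      unfold adj cont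
      rcases hcover hle with hh | hh <;> rw [hh] <;> push_cast <;> omega
    refine ⟨⟨?_, ?_, ?_⟩, ?_⟩
    · simp only [List.map_append, List.map_cons]
      rw [List.pairwise_append, List.pairwise_cons, List.pairwise_cons] at hlin ⊢
      obtain ⟨h1, ⟨h2, h3, h4⟩, h5⟩ := hlin
      refine ⟨h1, ⟨?_, ?_, h4⟩, ?_⟩
      · intro a ha
        rcases List.mem_cons.1 ha with rfl | ha
        · exact hcd
        · exact h3 a ha
      · intro a ha; exact h2 a (List.mem_cons_of_mem _ ha)
      · intro a ha b hb
        refine h5 a ha b ?_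
        simp only [List.mem_cons] at hb ⊢; tauto
    · intro x; rw [← h.cells x]; simp; tauto
    · intro b; rw [hent]; exact h.ent b
    · have : fillOf (P ++ (true, d, t) :: (false, c, u) :: Q) =
        fillOf (P ++ (false, c, u) :: (true, d, t) :: Q) := by
        simp [fillOf, itemsOf]
      rw [this]

theorem LSteps.inv {n : ℕ} {L L' : List (Bool × Cell × ℕ)} (h : Inv n L)
    (hs : Relation.ReflTransGen LStep L L') :
    Inv n L' ∧ Relation.ReflTransGen SwitchStep (fillOf L) (fillOf L') := by
  induction hs with
  | refl => exact ⟨h, .refl⟩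
  | tail _ h2 ih => exact ⟨(h2.inv ih.1).1, ih.2.trans (h2.inv ih.1).2⟩

def isO : Cell → List (Cell × ℕ) → List (Cell × ℕ)
  | _, [] => []
  | c, x :: ts => if adj (cont c) (cont x.1) then (c, x.2) :: isO x.1 ts else x :: isO c ts

def isH : Cell → List (Cell × ℕ) → Cell
  | c, [] => c
  | c, x :: ts => if adj (cont c) (cont x.1) then isH x.1 ts else isH c ts

def iwO : List (Cell × ℕ) → List (Cell × ℕ) → List (Cell × ℕ)
  | [], T => T
  | u :: us, T => isO u.1 (iwO us T)

def iwH : List (Cell × ℕ) → List (Cell × ℕ) → List (Cell × ℕ)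
  | [], _ => []
  | u :: us, T => (isH u.1 (iwO us T), u.2) :: iwH us T

theorem isO_cont (c : Cell) (ts : List (Cell × ℕ)) :
    (isO c ts).map (fun x => cont x.1) = slO (cont c) (ts.map (fun x => cont x.1)) := by
  induction ts generalizing c with
  | nil => rfl
  | cons x ts ih => simp only [isO, List.map_cons, slO]; split_ifs <;> simp [ih]

theorem iwO_cont (us ts : List (Cell × ℕ)) :
    (iwO us ts).map (fun x => cont x.1) =
      swO (us.map (fun x => cont x.1)) (ts.map (fun x => cont x.1)) := by
  induction us with
  | nil => rfl
  | cons x us ih => simp only [iwO, List.map_cons, swO, isO_cont, ih]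

def tg (b : Bool) (l : List (Cell × ℕ)) : List (Bool × Cell × ℕ) := l.map (fun x => (b, x))

theorem LStep_slide (P Q : List (Bool × Cell × ℕ)) (c : Cell) (u : ℕ) (ts : List (Cell × ℕ)) :
    Relation.ReflTransGen LStep (P ++ (false, c, u) :: (tg true ts ++ Q))
      (P ++ (tg true (isO c ts) ++ (false, isH c ts, u) :: Q)) := by
  induction ts generalizing P c with
  | nil => exact .refl
  | cons x ts ih =>
    refine Relation.ReflTransGen.head (b := if adj (cont c) (cont x.1) then
      P ++ (true, c, x.2) :: (false, x.1, u) :: (tg true ts ++ Q)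
      else P ++ (true, x.1, x.2) :: (false, c, u) :: (tg true ts ++ Q)) ?_ ?_
    · exact ⟨P, tg true ts ++ Q, c, u, x.1, x.2, rfl, rfl⟩
    · simp only [isO, isH]
      split_ifs with h
      · have := ih (P ++ [(true, c, x.2)]) x.1
        simpa [tg] using this
      · have := ih (P ++ [(true, x.1, x.2)]) c
        simpa [tg] using this

theorem LStep_switch (P : List (Bool × Cell × ℕ)) (us ts : List (Cell × ℕ)) :
    Relation.ReflTransGen LStep (P ++ (tg false us ++ tg true ts))
      (P ++ (tg true (iwO us ts) ++ tg false (iwH us ts))) := by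
  induction us generalizing P with
  | nil => simp only [tg, iwO, iwH, List.map_nil, List.nil_append, List.append_nil]; exact .refl
  | cons x us ih =>
    have h1 := ih (P ++ [(false, x.1, x.2)])
    have h2 := LStep_slide P (tg false (iwH us ts)) x.1 x.2 (iwO us ts)
    refine Relation.ReflTransGen.trans (b := P ++ (false, x.1, x.2) ::
      (tg true (iwO us ts) ++ tg false (iwH us ts))) ?_ ?_
    · simpa [tg] using h1
    · simpa [tg, iwO, iwH] using h2

theorem fillOf_start (us ts : List (Cell × ℕ)) :
    fillOf (tg false us ++ tg true ts) = (ts.toFinset, us.toFinset) := by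
  have h1 : itemsOf true (tg false us ++ tg true ts) = ts := by
    simp [itemsOf, tg, List.filter_map, Function.comp_def]
  have h2 : itemsOf false (tg false us ++ tg true ts) = us := by
    simp [itemsOf, tg, List.filter_map, Function.comp_def]
  rw [fillOf, h1, h2]

theorem fillOf_end (us ts : List (Cell × ℕ)) :
    fillOf (tg true ts ++ tg false us) = (ts.toFinset, us.toFinset) := by
  have h1 : itemsOf true (tg true ts ++ tg false us) = ts := by
    simp [itemsOf, tg, List.filter_map, Function.comp_def]
  have h2 : itemsOf false (tg true ts ++ tg false us) = us := by
    simp [itemsOf, tg, List.filter_map, Function.comp_def]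
  rw [fillOf, h1, h2]

theorem Inv.Good {n : ℕ} {L : List (Bool × Cell × ℕ)} (h : Inv n L) : OG.Good (fillOf L) := by
  refine ⟨h.good true, h.good false, ?_⟩
  intro x hx y hy hxy
  simp only [fillOf, List.mem_toFinset, mem_itemsOf] at hx hy
  have hl := h.lin
  rw [List.pairwise_map] at hl
  have hl' : L.Pairwise (fun a b => a.2.1 ≠ b.2.1) := hl.imp fun h e => h e.ge
  have hne : (true, x) ≠ (false, y) := by simp
  haveI : Std.Symm (fun a b : Bool × Cell × ℕ => a.2.1 ≠ b.2.1) := ⟨fun _ _ h => h.symm⟩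
  exact hl'.forall hx hy hne hxy

theorem switch_path {n : ℕ} {us ts : List (Cell × ℕ)} (h : Inv n (tg false us ++ tg true ts))
    {R B : Filling} (hR : Switched ts.toFinset us.toFinset R B) :
    R = (iwO us ts).toFinset ∧ Inv n (tg true (iwO us ts) ++ tg false (iwH us ts)) := by
  have h0 := LSteps.inv h (by simpa using LStep_switch [] us ts)
  refine ⟨?_, h0.1⟩
  have hg := h.Good
  have hp := h0.2
  rw [fillOf_start] at hg hp
  rw [fillOf_end] at hp
  have := switch_unique hg hR.1 hp hR.2 ?_
  · exact congrArg Prod.fst this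
  · rintro q ⟨c, u, d, t, h1, h2, h3, -⟩
    simp only [List.mem_toFinset] at h1 h2
    have hl := h0.1.lin
    rw [List.map_append, List.pairwise_append] at hl
    refine hl.2.2 d ?_ c ?_ ?_
    · simp only [tg, List.map_map, List.mem_map]; exact ⟨_, h2, rfl⟩
    · simp only [tg, List.map_map, List.mem_map]; exact ⟨_, h1, rfl⟩
    · rcases h3 with rfl | rfl <;> exact Prod.le_def.2 (by simp)



theorem sorted_list (f : Filling) (h : ∀ p ∈ f, ∀ q ∈ f, p.2 = q.2 → p = q) :
    ∃ l : List (Cell × ℕ), l.toFinset = f ∧ (l.map (fun x => x.2)).Pairwise (· < ·) := by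
  classical
  let l := f.toList.mergeSort (fun a b => decide (a.2 ≤ b.2))
  have hp : l.Perm f.toList := List.mergeSort_perm _ _
  have hs : l.Pairwise (fun a b => decide (a.2 ≤ b.2) = true) :=
    List.pairwise_mergeSort (by intro a b c; simp; omega) (by intro a b; simp; omega) _
  have hnd : l.Nodup := hp.nodup_iff.2 f.nodup_toList
  have hm : ∀ x, x ∈ l ↔ x ∈ f := fun x => by rw [hp.mem_iff]; simp
  refine ⟨l, ?_, ?_⟩
  · ext x; simp [hm]
  · rw [List.pairwise_map]
    have := hs.and hnd
    refine this.imp_of_mem ?_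
    rintro a b ha hb ⟨h1, h2⟩
    simp at h1
    exact lt_of_le_of_ne h1 (fun e => h2 (h a ((hm a).1 ha) b ((hm b).1 hb) e))

theorem lin_of_tableau {f : Filling} {l : List (Cell × ℕ)} (hl : l.toFinset = f)
    (hs : (l.map (fun x => x.2)).Pairwise (· < ·)) (hf : IsPartialTableau f)
    (hconv : ∀ c ∈ cellsOf f, ∀ d ∈ cellsOf f, c ≤ d → (c.1, d.2) ∈ cellsOf f) :
    (l.map (fun x => x.1)).Pairwise (fun a b => ¬ b ≤ a) := by
  have hm : ∀ x, x ∈ l ↔ x ∈ f := fun x => by rw [← hl]; simp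
  rw [List.pairwise_map] at hs ⊢
  refine hs.imp_of_mem ?_
  intro a b ha hb hab hle
  rw [hm] at ha hb
  have h1 := hconv b.1 (Finset.mem_image_of_mem _ hb) a.1 (Finset.mem_image_of_mem _ ha) hle
  obtain ⟨e, he, he'⟩ := Finset.mem_image.1 h1
  have hle' := Prod.le_def.1 hle
  have e1 : e.1.1 = b.1.1 := by rw [he']
  have e2 : e.1.2 = a.1.2 := by rw [he']
  have k1 : b.2 ≤ e.2 := by
    rcases hle'.2.lt_or_eq with h | h
    · exact (hf.2.2.1 b hb e he e1.symm (by omega)).le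
    · exact (congrArg Prod.snd (hf.1 b hb e he (Prod.ext e1.symm (by omega)))).le
  have k2 : e.2 ≤ a.2 := by
    rcases hle'.1.lt_or_eq with h | h
    · exact (hf.2.2.2 e he a ha e2 (by omega)).le
    · exact (congrArg Prod.snd (hf.1 e he a ha (Prod.ext (by omega) e2))).le
  omega

theorem TB_of_Inv {n : ℕ} {l : List Cell}
    (lin : l.Pairwise (fun a b => ¬ b ≤ a))
    (cells : ∀ c : Cell, c ∈ l ↔ c.1 ≤ c.2 ∧ c.2 < n) : TB (l.map cont) := by
  have hFF : ∀ k, FF k (l.map cont) = (l.filter (fun c => decide (cont c = k ∨ cont c = k+1))).map cont := by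
    intro k
    rw [FF, List.filter_map]; rfl
  have hlin : ∀ k, (l.filter (fun c => decide (cont c = k ∨ cont c = k+1))).Pairwise
      (fun a b => ¬ b ≤ a) := fun k => lin.filter _
  have hmem : ∀ k (c : Cell), c ∈ l.filter (fun c => decide (cont c = k ∨ cont c = k+1)) ↔
      (c.1 ≤ c.2 ∧ c.2 < n) ∧ (cont c = k ∨ cont c = k+1) := by
    intro k c; rw [List.mem_filter, cells]; simp
  refine ⟨?_, ?_, ?_, ?_⟩
  · intro x hx
    obtain ⟨c, hc, rfl⟩ := List.mem_map.1 hx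
    rw [cells] at hc
    unfold cont; omega
  · intro k hk
    rw [hFF, List.isChain_map, List.isChain_iff_forall_rel_of_append_cons_cons]
    intro a b P Q hPQ heq
    have h1 := hlin k
    have ha := (hmem k a).1 (by rw [hPQ]; simp)
    have hb := (hmem k b).1 (by rw [hPQ]; simp)
    have hbt : ∀ x : Cell, (x.1 ≤ x.2 ∧ x.2 < n) ∧ (cont x = k ∨ cont x = k+1) → a ≤ x → x ≤ b →
        x = a ∨ x = b := by
      intro x hx h3 h4
      rw [← hmem, hPQ] at hx
      rw [hPQ] at h1
      exact pw_between (r := (· ≤ ·)) h1 hx h3 h4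
    have hba : ¬ b ≤ a := by
      rw [hPQ] at h1
      exact (List.pairwise_cons.1 (List.pairwise_append.1 h1).2.1).1 b (by simp)
    rw [Prod.le_def] at hba
    unfold cont at *
    by_cases hk1 : (a.2 : ℤ) - a.1 = k
    · rcases hbt (a.1, a.2 + 1) ⟨⟨by simp; omega, by simp; omega⟩, by push_cast; omega⟩
        (Prod.le_def.2 ⟨le_rfl, by simp⟩) (Prod.le_def.2 ⟨by simp; omega, by simp; omega⟩) with h | h
      · have := congrArg Prod.snd h; simp at this
      · rw [← h] at heq; push_cast at heq; omega
    · rcases hbt (a.1 + 1, a.2) ⟨⟨by simp; omega, by simp; omega⟩, by push_cast; omega⟩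
        (Prod.le_def.2 ⟨by simp, le_rfl⟩) (Prod.le_def.2 ⟨by simp; omega, by simp; omega⟩) with h | h
      · have := congrArg Prod.fst h; simp at this
      · rw [← h] at heq; push_cast at heq; omega
  · intro k hk
    rw [hFF]
    have h1 := hlin k
    have h2 := hmem k
    cases hl : l.filter (fun c => decide (cont c = k ∨ cont c = k+1)) with
    | nil => simp
    | cons a Q =>
      rw [hl] at h1 h2
      simp only [List.map_cons, List.head?_cons, ne_eq, Option.some.injEq]
      intro ha
      have ha' := (h2 a).1 (by simp)
      unfold cont at *
      have hx := (h2 (a.1, a.2 - 1)).2 (by simp; omega)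
      rcases List.mem_cons.1 hx with hx | hx
      · have := congrArg Prod.snd hx; simp at this; omega
      · exact (List.pairwise_cons.1 h1).1 _ hx (Prod.le_def.2 ⟨le_rfl, by simp⟩)
  · intro k hk
    rw [hFF]
    have h1 := hlin k
    have h2 := hmem k
    rcases List.eq_nil_or_concat (l.filter (fun c => decide (cont c = k ∨ cont c = k+1))) with hl | ⟨P, a, hl⟩
    · rw [hl]; simp
    · rw [List.concat_eq_append] at hl
      rw [hl] at h1 h2 ⊢
      simp only [List.map_append, List.map_cons, List.map_nil, List.getLast?_append, List.getLast?_singleton, ne_eq]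
      intro ha
      have ha : cont a = k + 1 := by simpa using ha
      have ha' := (h2 a).1 (by simp)
      unfold cont at *
      have hx := (h2 (a.1 + 1, a.2)).2 (by simp; omega)
      rcases List.mem_append.1 hx with hx | hx
      · exact (List.pairwise_append.1 h1).2.2 _ hx a (by simp) (Prod.le_def.2 ⟨by simp, le_rfl⟩)
      · have := congrArg Prod.fst (List.mem_singleton.1 hx); simp at this

theorem count_cont {n : ℕ} (l : List Cell) (hnd : l.Nodup) (hl : ∀ c ∈ l, c.1 ≤ c.2 ∧ c.2 < n) (k : ℕ) :
    (l.map cont).count (k : ℤ) = ((Finset.range n).filter (fun i => (i, i + k) ∈ l)).card := by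
  rw [List.count_eq_countP, List.countP_map, List.countP_eq_length_filter]
  have hnd' : (l.filter ((fun x => x == (k:ℤ)) ∘ cont)).Nodup := hnd.filter _
  rw [← List.toFinset_card_of_nodup hnd']
  symm
  refine Finset.card_bij (fun i _ => (i, i + k)) ?_ ?_ ?_
  · intro i hi
    rw [Finset.mem_filter] at hi
    simp [hi.2, cont]
  · intro i _ j _ h
    exact congrArg Prod.fst h
  · intro c hc
    simp only [List.mem_toFinset, List.mem_filter, Function.comp, beq_iff_eq] at hc
    have h1 := hl c hc.1
    have h2 := hc.2
    unfold cont at h2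
    have : (c.1, c.1 + k) = c := Prod.ext rfl (by simp; omega)
    refine ⟨c.1, ?_, this⟩
    rw [Finset.mem_filter, this, Finset.mem_range]
    exact ⟨by omega, hc.1⟩

theorem down_closed_iff {n N : ℕ} {p : ℕ → Prop} [DecidablePred p] (hp : ∀ i, p i → i < n)
    (hd : ∀ i j, i ≤ j → p j → p i) (hN : ((Finset.range n).filter p).card = N) (i : ℕ) :
    p i ↔ i < N := by
  have hfl : ∀ m, p m → m < N := by
    intro m hm
    rw [← hN]
    have : Finset.range (m+1) ⊆ (Finset.range n).filter p := by
      intro x hx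
      rw [Finset.mem_range] at hx
      have := hd x m (by omega) hm
      rw [Finset.mem_filter, Finset.mem_range]
      exact ⟨hp x this, this⟩
    have := Finset.card_le_card this
    rw [Finset.card_range] at this
    omega
  refine ⟨hfl i, fun h => ?_⟩
  by_contra hi
  have : (Finset.range n).filter p ⊆ Finset.range i := by
    intro x hx
    rw [Finset.mem_filter] at hx
    rw [Finset.mem_range]
    by_contra hxi
    exact hi (hd i x (by omega) hx.2)
  have := Finset.card_le_card this
  rw [Finset.card_range] at this
  omega

def Genuine {n : ℕ} (s : StrictPartitionIn n) : Prop :=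
  ∀ i j, i ≤ j → j < n → 0 < s.part j → j + s.part j ≤ i + s.part i

theorem mem_shiftedDiag {n : ℕ} (s : StrictPartitionIn n) (c : Cell) :
    c ∈ shiftedDiag n s ↔ c.1 < n ∧ c.1 ≤ c.2 ∧ c.2 < c.1 + s.part c.1 := by
  have := s.le_n c.1
  simp only [shiftedDiag, Finset.mem_filter, Finset.mem_product, Finset.mem_range]
  omega

theorem combinatorial_part (n : ℕ) (kap kapd : StrictPartitionIn n)
    (hkd : shiftedDiag n kap ⊆ shiftedDiag n (staircase n))
    (g1 : Genuine kap) (g2 : Genuine kapd)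
    (hcomp : ∀ k, k ≤ n → ((Finset.range n).filter (fun i => k < kap.part i)).card +
      ((Finset.range n).filter (fun i => k < kapd.part i)).card = n - k)
    (T : Filling)
    (hT : IsTableauOn T (shiftedDiag n (staircase n) \ shiftedDiag n kap)
      (Finset.Icc 1 ((shiftedDiag n (staircase n) \ shiftedDiag n kap).card)))
    (R : Filling) (hR : RectifiesTo T (shiftedDiag n kap) R) :
    cellsOf R = shiftedDiag n kapd := by
  obtain ⟨U, B, hU, hS⟩ := hR
  have hδ : ∀ c : Cell, c ∈ shiftedDiag n (staircase n) ↔ c.1 ≤ c.2 ∧ c.2 < n := by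
    intro c
    rw [mem_shiftedDiag]
    simp only [staircase]; omega
  have hκ := mem_shiftedDiag kap
  have hκδ : ∀ i, i < n → i + kap.part i ≤ n := by
    intro i hi
    by_contra hcon
    have := (hδ _).1 (hkd ((hκ (i, i + kap.part i - 1)).2 ⟨hi, by simp; omega, by simp; omega⟩))
    simp at this; omega
  have hideal : ∀ c d : Cell, c ≤ d → c.1 ≤ c.2 → d ∈ shiftedDiag n kap → c ∈ shiftedDiag n kap := by
    intro c d hcd hc hd
    rw [hκ] at hd ⊢
    rw [Prod.le_def] at hcd
    have := g1 c.1 d.1 hcd.1 hd.1 (by omega)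
    omega
  obtain ⟨us, hus, hus'⟩ := sorted_list U hU.1.2.1
  obtain ⟨ts, hts, hts'⟩ := sorted_list T hT.1.2.1
  have hcu : ∀ c, c ∈ us.map (fun x => x.1) ↔ c ∈ shiftedDiag n kap := by
    intro c; rw [← hU.2.1, ← hus]; simp [cellsOf]
  have hct : ∀ c, c ∈ ts.map (fun x => x.1) ↔ c ∈ shiftedDiag n (staircase n) \ shiftedDiag n kap := by
    intro c; rw [← hT.2.1, ← hts]; simp [cellsOf]
  have lu := lin_of_tableau hus hus' hU.1 (by
    rw [hU.2.1]
    intro c hc d hd hcd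
    have h1 := (hδ _).1 (hkd hc)
    have h2 := Prod.le_def.1 hcd
    exact hideal _ d (Prod.le_def.2 ⟨h2.1, le_rfl⟩) (by simp; omega) hd)
  have lt := lin_of_tableau hts hts' hT.1 (by
    rw [hT.2.1]
    intro c hc d hd hcd
    rw [Finset.mem_sdiff, hδ] at hc hd ⊢
    have h2 := Prod.le_def.1 hcd
    refine ⟨by simp; omega, fun h => hc.2 (hideal c (c.1, d.2) (Prod.le_def.2 ⟨le_rfl, h2.2⟩) hc.1.1 h)⟩)
  have e1 : (tg false us ++ tg true ts).map (fun x => x.2.1) =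
      us.map (fun x => x.1) ++ ts.map (fun x => x.1) := by
    simp [tg, Function.comp_def]
  have hinv : Inv n (tg false us ++ tg true ts) := by
    refine ⟨?_, ?_, ?_⟩
    · rw [e1, List.pairwise_append]
      refine ⟨lu, lt, ?_⟩
      intro a ha b hb hba
      rw [hcu] at ha
      rw [hct, Finset.mem_sdiff, hδ] at hb
      exact hb.2 (hideal b a hba hb.1.1 ha)
    · intro c
      rw [e1, List.mem_append, hcu, hct, Finset.mem_sdiff, ← hδ]
      constructor
      · rintro (h | h)
        · exact hkd h
        · exact h.1
      · intro h; by_cases hc : c ∈ shiftedDiag n kap <;> simp [h, hc]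
    · intro b
      cases b
      · simpa [itemsOf, tg, List.filter_map, Function.comp_def] using hus'
      · simpa [itemsOf, tg, List.filter_map, Function.comp_def] using hts'
  rw [← hus, ← hts] at hS
  obtain ⟨hRe, hinv2⟩ := switch_path hinv hS
  have e2 : (tg true (iwO us ts) ++ tg false (iwH us ts)).map (fun x => x.2.1) =
      (iwO us ts).map (fun x => x.1) ++ (iwH us ts).map (fun x => x.1) := by
    simp [tg, Function.comp_def]
  have lin2 := hinv2.lin
  have cells2 := hinv2.cells
  rw [e2] at lin2 cells2
  rw [List.pairwise_append] at lin2
  set A := (iwO us ts).map (fun x => x.1) with hA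
  have hAδ : ∀ c ∈ A, c.1 ≤ c.2 ∧ c.2 < n := fun c hc => (cells2 c).1 (List.mem_append_left _ hc)
  have hAid : ∀ c d : Cell, c ≤ d → c.1 ≤ c.2 → d ∈ A → c ∈ A := by
    intro c d hcd hc hd
    have h1 := hAδ d hd
    have h2 := Prod.le_def.1 hcd
    rcases List.mem_append.1 ((cells2 c).2 ⟨hc, by omega⟩) with h | h
    · exact h
    · exact absurd hcd (lin2.2.2 d hd c h)
  have hnd : ∀ l : List Cell, l.Pairwise (fun a b => ¬ b ≤ a) → l.Nodup := by
    intro l hl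
    exact hl.imp fun h e => h e.ge
  have hTB := TB_of_Inv hinv.lin hinv.cells
  rw [e1, List.map_append] at hTB
  have hcount : ∀ k : ℕ, (A.map cont).count (k : ℤ) = ((ts.map (fun x => x.1)).map cont).count (k : ℤ) := by
    intro k
    rw [← typeB_count hTB (k := (k : ℤ)) (by omega), hA, List.map_map, List.map_map, List.map_map]
    have := iwO_cont us ts
    simp only [Function.comp_def] at this ⊢
    rw [this]
  have hmain : ∀ k, k ≤ n → ((Finset.range n).filter (fun i => (i, i + k) ∈ A)).card =
      ((Finset.range n).filter (fun i => k < kapd.part i)).card := by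
    intro k hk
    rw [← count_cont A (hnd _ lin2.1) hAδ k, hcount k, count_cont _ (hnd _ lt)
      (fun c hc => by rw [hct, Finset.mem_sdiff, hδ] at hc; exact hc.1) k]
    have h1 := hcomp k hk
    have h2 : ((Finset.range n).filter (fun i => (i, i + k) ∈ ts.map (fun x => x.1))) =
        (Finset.range (n - k)) \ ((Finset.range n).filter (fun i => k < kap.part i)) := by
      ext i
      rw [Finset.mem_filter, hct, Finset.mem_sdiff, Finset.mem_sdiff, hδ, hκ]
      simp only [Finset.mem_filter, Finset.mem_range]
      omega
    have h3 : ((Finset.range n).filter (fun i => k < kap.part i)) ⊆ Finset.range (n - k) := by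
      intro i hi
      simp only [Finset.mem_filter, Finset.mem_range] at hi ⊢
      have := hκδ i hi.1
      omega
    rw [h2, Finset.card_sdiff_of_subset h3, Finset.card_range]
    omega
  have hRA : cellsOf R = A.toFinset := by
    rw [hRe, hA]; ext c; simp [cellsOf]
  rw [hRA]
  ext c
  rw [List.mem_toFinset, mem_shiftedDiag]
  have key : ∀ i k, i < n → ((i, i + k) ∈ A ↔ k < kapd.part i) := by
    intro i k hi
    by_cases hk : k ≤ n
    · have a1 := down_closed_iff (n := n) (p := fun i => (i, i + k) ∈ A)
        (fun i h => by have := hAδ _ h; simp at this; omega)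
        (fun i j hij h => hAid _ _ (Prod.le_def.2 ⟨hij, by simpa using hij⟩) (by simp) h) (hmain k hk) i
      have a2 := down_closed_iff (n := n) (p := fun i => i < n ∧ k < kapd.part i)
        (fun i h => h.1)
        (fun i j hij h => ⟨by omega, by have := g2 i j hij h.1 (by omega); omega⟩) (N := ((Finset.range n).filter (fun i => k < kapd.part i)).card)
        (by congr 1; ext j; simp) i
      simp only [hi, true_and] at a2
      exact a1.trans a2.symm
    · have := kapd.le_n i
      constructor
      · intro h; have := hAδ _ h; simp at this; omega
      · intro h; omega
  constructor
  · intro hc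
    have h1 := hAδ c hc
    have h2 := key c.1 (c.2 - c.1) (by omega)
    have h3 : (c.1, c.1 + (c.2 - c.1)) = c := Prod.ext rfl (by simp; omega)
    rw [h3] at h2
    have := h2.1 hc
    omega
  · rintro ⟨h1, h4, h5⟩
    have h2 := key c.1 (c.2 - c.1) (by omega)
    have h3 : (c.1, c.1 + (c.2 - c.1)) = c := Prod.ext rfl (by simp; omega)
    rw [h3] at h2
    exact h2.2 (by omega)


/-! ### A weight inequality for doubled strict partitions -/

def decr (n : ℕ) (f : ℕ → ℕ) (j : ℕ) : ℕ := if n < j + f j then f j - 1 else f j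

theorem sum_decr (n : ℕ) (f : ℕ → ℕ) (m : ℕ) (hm : m ≤ n) :
    ∑ i ∈ Finset.range m, f i = ∑ i ∈ Finset.range m, decr n f i +
      ((Finset.range m).filter (fun j => n < j + f j)).card := by
  rw [Finset.card_filter, ← Finset.sum_add_distrib]
  apply Finset.sum_congr rfl
  intro i hi
  rw [Finset.mem_range] at hi
  unfold decr
  split_ifs <;> omega

theorem card_filter_range_succ (n : ℕ) (p : ℕ → Prop) [DecidablePred p] :
    ((Finset.range (n+1)).filter p).card = ((Finset.range n).filter p).card + if p n then 1 else 0 := by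
  simp only [Finset.card_filter, Finset.sum_range_succ]

theorem shape_ind (n : ℕ) : ∀ (d : ℕ) (σ s : ℕ → ℕ), d ≤ n → (∀ j, j < d → 0 < σ j ∧ j + σ j ≤ n) →
    (∀ j j', j ≤ j' → j' < d → j' + σ j' ≤ j + σ j) →
    (∀ i, i < n → s i + ((Finset.range (i+1)).filter (fun j => i < j + s j)).card ≤
      if i < d then σ i + i + 1 else ((Finset.range d).filter (fun j => i < j + σ j)).card) →
    ∑ i ∈ Finset.range n, s i ≤ ∑ i ∈ Finset.range d, σ i ∧
    (∑ i ∈ Finset.range n, s i = ∑ i ∈ Finset.range d, σ i → ∀ i, i < n → (0 < s i ↔ i < d)) := by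
  induction n with
  | zero => intro d σ s hd; simp
  | succ n ih =>
    intro d σ s hd hσ hanti hs
    have hp' : ∀ i, i < n → ((Finset.range (i+1)).filter (fun j => i < j + decr n s j)).card =
        ((Finset.range (i+1)).filter (fun j => i < j + s j)).card := by
      intro i hi
      congr 1
      apply Finset.filter_congr
      intro j hj
      unfold decr
      split_ifs <;> omega
    have hdec : ∀ i, decr n s i = if n < i + s i then s i - 1 else s i := fun i => rfl
    have hpos : ∀ i, i < n → (0 < decr n s i ↔ 0 < s i) := by
      intro i hi
      rw [hdec]
      split_ifs <;> omega
    have hple : ∀ i, ((Finset.range (i+1)).filter (fun j => i < j + s j)).card ≤ i + 1 := by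
      intro i
      exact (Finset.card_filter_le _ _).trans (by simp)
    have hsum := sum_decr n s n le_rfl
    have hlast := hs n (by omega)
    rw [card_filter_range_succ] at hlast
    have hqle : ((Finset.range n).filter (fun j => n < j + s j)).card ≤ n :=
      (Finset.card_filter_le _ _).trans (by simp)
    rw [Finset.sum_range_succ, hsum]
    rcases Nat.lt_or_ge n d with hdn | hdn
    · obtain rfl : d = n + 1 := by omega
      have hfull : ∀ j, j ≤ n → j + σ j = n + 1 := by
        intro j hj
        have h1 := hanti j n hj (by omega)
        have h2 := hσ n (by omega)
        have h3 := hσ j (by omega)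
        omega
      have hsumσ := sum_decr n σ n le_rfl
      have hcard : ((Finset.range n).filter (fun j => n < j + σ j)).card = n := by
        rw [Finset.filter_true_of_mem, Finset.card_range]
        intro j hj
        rw [Finset.mem_range] at hj
        have := hfull j (by omega)
        omega
      have hd' : ∀ j, j < n → decr n σ j = σ j - 1 := by
        intro j hj
        have := hfull j (by omega)
        unfold decr
        rw [if_pos (by omega)]
      have hIH := ih n (decr n σ) (decr n s) le_rfl (by
          intro j hj
          rw [hd' j hj]
          have := hfull j (by omega)
          omega) (by
          intro j j' h1 h2
          rw [hd' j (by omega), hd' j' h2]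
          have := hfull j (by omega)
          have := hfull j' (by omega)
          omega) (by
          intro i hi
          rw [if_pos hi, hp' i hi, hd' i hi, hdec]
          have h1 := hs i (by omega)
          rw [if_pos (by omega)] at h1
          have h2 := hfull i (by omega)
          have h3 := hple i
          split_ifs <;> omega)
      obtain ⟨hI1, hI2⟩ := hIH
      have hσn := hfull n le_rfl
      rw [if_pos hdn] at hlast
      rw [Finset.sum_range_succ, hsumσ, hcard]
      by_cases hsn : 0 < s n
      · rw [if_pos (by omega)] at hlast
        refine ⟨by omega, fun he i hi => ?_⟩
        by_cases hin : i = n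
        · subst hin; omega
        · rw [← hpos i (by omega), hI2 (by omega) i (by omega)]; omega
      · refine ⟨by omega, fun he i hi => ?_⟩
        omega
    · have hsumσ := sum_decr n σ d hdn
      have hdecσ : ∀ i, decr n σ i = if n < i + σ i then σ i - 1 else σ i := fun i => rfl
      have hhd : ∀ i, i < d → (n < i + σ i ↔ i < ((Finset.range d).filter (fun j => n < j + σ j)).card) := by
        intro i hi
        have := down_closed_iff (n := d) (p := fun j => j < d ∧ n < j + σ j)
          (fun i h => h.1) (fun a b hab hb => ⟨by omega, by have := hanti a b hab hb.1; omega⟩)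
          (N := ((Finset.range d).filter (fun j => n < j + σ j)).card)
          (by congr 1; ext j; simp) i
        simpa [hi] using this
      have hIH := ih d (decr n σ) (decr n s) hdn (by
          intro j hj
          rw [hdecσ]
          have := hσ j hj
          split_ifs <;> omega) (by
          intro j j' h1 h2
          rw [hdecσ, hdecσ]
          have := hanti j j' h1 h2
          have := hσ j (by omega)
          have := hσ j' h2
          split_ifs <;> omega) (by
          intro i hi
          rw [hp' i hi]
          have h1 := hs i (by omega)
          have h3 := hple i
          have h4 := hdec i
          by_cases hid : i < d
          · rw [if_pos hid] at h1 ⊢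
            have := hσ i hid
            rw [hdecσ]
            split_ifs at h4 ⊢ <;> omega
          · rw [if_neg hid] at h1 ⊢
            have : ((Finset.range d).filter (fun j => i < j + decr n σ j)).card =
              ((Finset.range d).filter (fun j => i < j + σ j)).card := by
              congr 1
              apply Finset.filter_congr
              intro j hj
              unfold decr
              split_ifs <;> omega
            rw [this]
            split_ifs at h4 <;> omega)
      obtain ⟨hI1, hI2⟩ := hIH
      rw [if_neg (show ¬ n < d by omega)] at hlast
      rw [hsumσ]
      by_cases hsn : 0 < s n
      · rw [if_pos (show n < n + s n by omega)] at hlast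
        exact ⟨by omega, fun he i hi => by omega⟩
      · rw [if_neg (show ¬ n < n + s n by omega)] at hlast
        refine ⟨by omega, fun he i hi => ?_⟩
        by_cases hin : i = n
        · subst hin; omega
        · rw [← hpos i (by omega), hI2 (by omega) i (by omega)]


theorem exists_count_eq (p : ℕ → Prop) [DecidablePred p] (x j : ℕ) (h : j < Nat.count p x) :
    ∃ m, m < x ∧ p m ∧ Nat.count p m = j := by
  induction x with
  | zero => simp at h
  | succ x ih =>
    rw [Nat.count_succ] at h
    by_cases hj : j < Nat.count p x
    · obtain ⟨m, h1, h2⟩ := ih hj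
      exact ⟨m, by omega, h2⟩
    · split_ifs at h with hp
      · exact ⟨x, by omega, hp, by omega⟩
      · omega

theorem count_lip (p : ℕ → Prop) [DecidablePred p] (a b : ℕ) :
    Nat.count p (a + b) ≤ Nat.count p a + b := by
  induction b with
  | zero => simp
  | succ b ih =>
    rw [← Nat.add_assoc, Nat.count_succ]
    split_ifs <;> omega

theorem count_sym (n : ℕ) (p : ℕ → Prop) [DecidablePred p]
    (hsym : ∀ m, m < n → (p m ↔ ¬ p (2*n - m))) (hpn : ¬ p n) (r : ℕ) (hr : r ≤ n) :
    Nat.count p (n + 1 + r) = r + Nat.count p (n - r) := by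
  induction r with
  | zero => simp [Nat.count_succ, hpn]
  | succ r ih =>
    have h1 := ih (by omega)
    have h2 : n - r = (n - (r+1)) + 1 := by omega
    rw [h2, Nat.count_succ] at h1
    rw [← Nat.add_assoc, Nat.count_succ, h1]
    have h3 := hsym (n - (r+1)) (by omega)
    have h4 : 2*n - (n - (r+1)) = n + 1 + r := by omega
    rw [h4] at h3
    by_cases hp : p (n + 1 + r)
    · have : ¬ p (n - (r+1)) := fun h => (h3.1 h) hp
      rw [if_pos hp, if_neg this]; omega
    · have : p (n - (r+1)) := h3.2 hp
      rw [if_neg hp, if_pos this]; omega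

theorem schubert_comb (n : ℕ) (p : ℕ → Prop) [DecidablePred p]
    (hsym : ∀ m, m < n → (p m ↔ ¬ p (2*n - m))) (hpn : ¬ p n) (s : StrictPartitionIn n)
    (hc : ∀ i, i < n → i + 1 ≤ Nat.count p (n + 2 + i - tildeFun s i)) :
    swt n s ≤ ∑ m ∈ (Finset.range n).filter p, (n - m) ∧
    (swt n s = ∑ m ∈ (Finset.range n).filter p, (n - m) → Genuine s ∧
      ∀ k, k ≤ n → ((Finset.range n).filter (fun i => k < s.part i)).card = Nat.count p (n - k)) := by
  have hsymc := count_sym n p hsym hpn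
  have htot : Nat.count p (2*n+1) = n := by
    have := hsymc n le_rfl
    rw [show n + 1 + n = 2*n+1 by ring] at this
    simpa using this
  have hex : ∀ j, ∃ m, j < n → (m < 2*n+1 ∧ p m ∧ Nat.count p m = j) := by
    intro j
    by_cases hj : j < n
    · obtain ⟨m, hm⟩ := exists_count_eq p (2*n+1) j (by omega)
      exact ⟨m, fun _ => hm⟩
    · exact ⟨0, fun h => absurd h hj⟩
  choose e he using hex
  have hmono : ∀ {a b : ℕ}, a ≤ b → Nat.count p a ≤ Nat.count p b := fun h => Nat.count_monotone p h
  have hlt : ∀ j x, j < n → (e j < x ↔ j < Nat.count p x) := by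
    intro j x hj
    obtain ⟨h1, h2, h3⟩ := he j hj
    constructor
    · intro h
      have := hmono (show e j + 1 ≤ x from h)
      rw [Nat.count_succ, if_pos h2] at this
      omega
    · intro h
      by_contra hcon
      have := hmono (show x ≤ e j by omega)
      omega
  have hlip : ∀ i j, i ≤ j → j < n → e i + (j - i) ≤ e j := by
    intro i j hij hj
    have h1 := he i (by omega)
    have h2 := he j hj
    have h3 : e i ≤ e j := by
      by_contra hcon
      have := (hlt j (e i) hj).1 (by omega)
      omega
    have := count_lip p (e i) (e j - e i)
    rw [show e i + (e j - e i) = e j by omega] at this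
    omega
  set d := Nat.count p n with hd
  have hdn : d ≤ n := Nat.count_le p
  have hend : ∀ j, j < n → (e j < n ↔ j < d) := fun j hj => hlt j n hj
  have htl : ∀ i, i < n → tildeFun s i = s.part i +
      ((Finset.range (i+1)).filter (fun j => i < j + s.part j)).card := by
    intro i hi
    unfold tildeFun
    congr 2
    ext j
    simp only [Finset.mem_filter, Finset.mem_range]
    omega
  have hjn : ∀ j, j < n → j ≤ e j := by
    intro j hj
    have := he j hj
    have h2 : Nat.count p (e j) ≤ e j := Nat.count_le p
    omega
  have hti : ∀ i, i < n → tildeFun s i + e i ≤ n + 1 + i := by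
    intro i hi
    have := (hlt i _ hi).2 (hc i hi)
    omega
  have hind := shape_ind n d (fun j => n - e j) s.part hdn (by
      intro j hj
      have h1 := (hend j (by omega)).2 hj
      have := hjn j (by omega)
      omega) (by
      intro j j' h1 h2
      have h3 := (hend j' (by omega)).2 h2
      have := hlip j j' h1 (by omega)
      omega) (by
      intro i hi
      rw [← htl i hi]
      have h1 := hti i hi
      by_cases hid : i < d
      · rw [if_pos hid]
        have := (hend i hi).2 hid
        omega
      · rw [if_neg hid]
        have h2 : ¬ e i < n := fun h => hid ((hend i hi).1 h)
        obtain ⟨h3, h4, h5⟩ := he i hi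
        have h6 : e i ≠ n := by intro h; rw [h] at h4; exact hpn h4
        obtain ⟨r, hr⟩ : ∃ r, e i = n + 1 + r := ⟨e i - (n+1), by omega⟩
        have h7 := hsymc r (by omega)
        rw [← hr, h5, show n - r = (n - 1 - r) + 1 by omega, Nat.count_succ, if_neg] at h7
        swap
        · rw [hsym _ (by omega), show 2*n - (n-1-r) = e i by omega]
          simpa using h4
        have hsub : Finset.range (n + 1 + i - e i) ⊆
            (Finset.range d).filter (fun j => i < j + (n - e j)) := by
          intro j hj
          rw [Finset.mem_range] at hj
          have hRd : Nat.count p (n-1-r) ≤ d := hmono (by omega)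
          rw [Finset.mem_filter, Finset.mem_range]
          refine ⟨by omega, ?_⟩
          have h8 := (hlt j (n-1-r) (by omega)).2 (by omega)
          have h9 := count_lip p (e j + 1) (n-1-r-(e j + 1))
          obtain ⟨-, h10, h11⟩ := he j (by omega)
          rw [show e j + 1 + (n-1-r-(e j + 1)) = n-1-r by omega, Nat.count_succ, if_pos h10] at h9
          omega
        have := Finset.card_le_card hsub
        rw [Finset.card_range] at this
        omega)
  have hsum : ∑ i ∈ Finset.range d, (n - e i) = ∑ m ∈ (Finset.range n).filter p, (n - m) := by
    refine Finset.sum_bij (fun j _ => e j) ?_ ?_ ?_ ?_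
    · intro j hj
      rw [Finset.mem_range] at hj
      rw [Finset.mem_filter, Finset.mem_range]
      exact ⟨(hend j (by omega)).2 hj, (he j (by omega)).2.1⟩
    · intro i hi j hj hij
      rw [Finset.mem_range] at hi hj
      rw [← (he i (by omega)).2.2, ← (he j (by omega)).2.2]
      rw [hij]
    · intro m hm
      rw [Finset.mem_filter, Finset.mem_range] at hm
      have hlt' : Nat.count p m < d := by
        have := hmono (show m + 1 ≤ n from hm.1)
        rw [Nat.count_succ, if_pos hm.2] at this
        omega
      refine ⟨Nat.count p m, Finset.mem_range.2 hlt', ?_⟩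
      have h1 := he (Nat.count p m) (by omega)
      have k1 := (hlt (Nat.count p m) (m+1) (by omega)).2 (by rw [Nat.count_succ, if_pos hm.2]; omega)
      have k2 : ¬ e (Nat.count p m) < m := fun h => lt_irrefl _ ((hlt (Nat.count p m) m (by omega)).1 h)
      omega
    · intro _ _; rfl
  rw [hsum] at hind
  refine ⟨hind.1, fun heq => ?_⟩
  have hpos := hind.2 heq
  have hanti : ∀ i k, i + k < n → 0 < s.part (i + k) → i + k + s.part (i + k) ≤ i + s.part i := by
    intro i k
    induction k with
    | zero => intro _ _; simp
    | succ k ih =>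
      intro h1 h2
      have h3 := (hpos _ h1).1 h2
      have h4 := (hpos (i + k) (by omega)).2 (by omega)
      have h5 := ih (by omega) h4
      have h6 := s.strict (i + k)
      rw [← Nat.add_assoc] at h2 ⊢
      omega
  have hgen : Genuine s := by
    intro i j hij hj hpj
    have := hanti i (j - i) (by rw [Nat.add_sub_cancel' hij]; exact hj)
      (by rw [Nat.add_sub_cancel' hij]; exact hpj)
    rwa [Nat.add_sub_cancel' hij] at this
  refine ⟨hgen, ?_⟩
  have hle : ∀ i ∈ Finset.range d, s.part i ≤ n - e i := by
    intro i hi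
    rw [Finset.mem_range] at hi
    have h1 := hti i (by omega)
    rw [htl i (by omega), Finset.filter_true_of_mem, Finset.card_range] at h1
    · omega
    · intro j hj
      rw [Finset.mem_range] at hj
      have := hgen j i (by omega) (by omega) ((hpos i (by omega)).2 hi)
      have := (hpos i (by omega)).2 hi
      omega
  have hse : ∑ i ∈ Finset.range d, s.part i = ∑ i ∈ Finset.range d, (n - e i) := by
    rw [hsum, ← heq]
    apply Finset.sum_subset
    · intro x; simp only [Finset.mem_range]; omega
    · intro x hx hx'
      rw [Finset.mem_range] at hx hx'
      have := (hpos x hx).not.2 hx'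
      omega
  have hpt := (Finset.sum_eq_sum_iff_of_le hle).1 hse
  intro k hk
  have : (Finset.range n).filter (fun i => k < s.part i) = Finset.range (Nat.count p (n - k)) := by
    ext i
    rw [Finset.mem_filter, Finset.mem_range, Finset.mem_range]
    have hcn : Nat.count p (n - k) ≤ d := hmono (by omega)
    by_cases hi : i < d
    · rw [hpt i (Finset.mem_range.2 hi), ← hlt i _ (by omega)]
      omega
    · constructor
      · rintro ⟨h1, h2⟩
        have := (hpos i h1).1 (by omega)
        omega
      · intro h; omega
  rw [this, Finset.card_range]

theorem comb_pair (n : ℕ) (p q : ℕ → Prop) [DecidablePred p] [DecidablePred q]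
    (hsym : ∀ m, m < n → (p m ↔ ¬ p (2*n - m))) (hpn : ¬ p n)
    (hq : ∀ m, m ≤ 2*n → (q m ↔ p (2*n - m)))
    (kap kapd : StrictPartitionIn n)
    (hdim : 2 * (swt n kap + swt n kapd) = n*(n+1))
    (hc : ∀ i, i < n → i + 1 ≤ Nat.count p (n + 2 + i - tildeFun kap i))
    (hc' : ∀ i, i < n → i + 1 ≤ Nat.count q (n + 2 + i - tildeFun kapd i)) :
    Genuine kap ∧ Genuine kapd ∧
    ∀ k, k ≤ n → ((Finset.range n).filter (fun i => k < kap.part i)).card +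
      ((Finset.range n).filter (fun i => k < kapd.part i)).card = n - k := by
  have hqn : ∀ m, m < n → (q m ↔ ¬ p m) := by
    intro m hm
    rw [hq m (by omega), hsym m hm, not_not]
  have h1 := schubert_comb n p hsym hpn kap hc
  have h2 := schubert_comb n q (by
    intro m hm
    rw [hq m (by omega), hq (2*n - m) (by omega), show 2*n - (2*n-m) = m by omega, hsym m hm, not_not])
    (by rw [hq n (by omega), show 2*n - n = n by omega]; exact hpn) kapd hc'
  have h3 : ∑ m ∈ (Finset.range n).filter p, (n - m) + ∑ m ∈ (Finset.range n).filter q, (n - m) =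
      ∑ m ∈ Finset.range n, (n - m) := by
    rw [← Finset.sum_filter_add_sum_filter_not (Finset.range n) p]
    congr 1
    apply Finset.sum_congr _ (fun _ _ => rfl)
    apply Finset.filter_congr
    intro m hm
    exact hqn m (Finset.mem_range.1 hm)
  have h4 : ∀ n : ℕ, 2 * ∑ m ∈ Finset.range n, (n - m) = n * (n+1) := by
    intro n
    have h5 := Finset.sum_range_reflect (fun m => m + 1) n
    have h6 : ∑ m ∈ Finset.range n, (n - m) = ∑ m ∈ Finset.range n, (m + 1) := by
      rw [← h5]
      apply Finset.sum_congr rfl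
      intro m hm
      rw [Finset.mem_range] at hm
      omega
    rw [h6, Finset.sum_add_distrib, Nat.mul_add, mul_comm 2, Finset.sum_range_id_mul_two]
    simp
    cases n with
    | zero => rfl
    | succ n => simp; ring
  have h5 := h4 n
  have h6 := h1.1
  have h7 := h2.1
  have h8 := h1.2 (by omega)
  have h9 := h2.2 (by omega)
  refine ⟨h8.1, h9.1, fun k hk => ?_⟩
  rw [h8.2 k hk, h9.2 k hk]
  have : ∀ x, x ≤ n → Nat.count p x + Nat.count q x = x := by
    intro x
    induction x with
    | zero => simp
    | succ x ih =>
      intro hx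
      have := ih (by omega)
      rw [Nat.count_succ, Nat.count_succ]
      have := hqn x (by omega)
      by_cases hp : p x
      · have hq : ¬ q x := fun h => this.1 h hp
        rw [if_pos hp, if_neg hq]; omega
      · have hq : q x := this.2 hp
        rw [if_neg hp, if_pos hq]; omega
  exact this _ (by omega)

/-! ### Torus-fixed point -/

/-- Polynomials whose coefficients vanish on `A`. -/
def ZZ (A : Set ℕ) : Submodule ℂ ℂ[X] where
  carrier := {f | ∀ m ∈ A, f.coeff m = 0}
  add_mem' := by intro a b ha hb m hm; rw [coeff_add, ha m hm, hb m hm, add_zero]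
  zero_mem' := by intro m _; simp
  smul_mem' := by intro c f hf m hm; rw [coeff_smul, hf m hm, smul_zero]

theorem mem_ZZ {A : Set ℕ} {f : ℂ[X]} : f ∈ ZZ A ↔ ∀ m ∈ A, f.coeff m = 0 := Iff.rfl

theorem degreeLT_eq (i : ℕ) : degreeLT ℂ i = ZZ {m | i ≤ m} := by
  ext f
  rw [mem_degreeLT, degree_lt_iff_coeff_zero]
  rfl

theorem flag_none (n i : ℕ) : flag n (toC (∞ : OnePoint ℝ)) i = ZZ {m | i ≤ m} := degreeLT_eq i

theorem flag_zero (n i : ℕ) : flag n (toC ((0 : ℝ) : OnePoint ℝ)) i =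
    ZZ {m | 2*n+1 ≤ m ∨ m < 2*n+1-i} := by
  ext f
  have : f ∈ flag n (toC ((0 : ℝ) : OnePoint ℝ)) i ↔
    f ∈ degreeLT ℂ (2*n+1) ∧ (X + C ((0:ℝ):ℂ))^(2*n+1-i) ∣ f := Iff.rfl
  rw [this, degreeLT_eq, mem_ZZ, mem_ZZ, Complex.ofReal_zero, C_0, add_zero, X_pow_dvd_iff]
  constructor
  · rintro ⟨h1, h2⟩ m (h | h)
    · exact h1 m h
    · exact h2 m h
  · intro h
    exact ⟨fun m hm => h m (Or.inl hm), fun m hm => h m (Or.inr hm)⟩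

noncomputable def scal : ℂ[X] →ₗ[ℂ] ℂ[X] :=
  (aeval (C 2 * X : ℂ[X])).toLinearMap

theorem scal_coeff (f : ℂ[X]) (m : ℕ) : (scal f).coeff m = f.coeff m * 2^m := by
  have : scal f = f.comp (C 2 * X) := by
    rw [scal, AlgHom.toLinearMap_apply, aeval_def, comp]; rfl
  rw [this, comp_C_mul_X_coeff]

theorem scal_inj : Function.Injective scal := by
  intro f g h
  ext m
  have := congrArg (fun p => coeff p m) h
  simp only [scal_coeff] at this
  exact mul_right_cancel₀ (pow_ne_zero _ two_ne_zero) this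

theorem ZZ_map (A : Set ℕ) : (ZZ A).map scal = ZZ A := by
  apply le_antisymm
  · rintro _ ⟨f, hf, rfl⟩ m hm
    rw [scal_coeff, hf m hm, zero_mul]
  · intro f hf
    refine ⟨f.comp (C (1/2) * X), ?_, ?_⟩
    · intro m hm
      rw [comp_C_mul_X_coeff, hf m hm, zero_mul]
    · ext m
      rw [scal_coeff, comp_C_mul_X_coeff, mul_assoc, ← mul_pow]
      norm_num

theorem finrank_scal (y : Submodule ℂ ℂ[X]) :
    Module.finrank ℂ (y.map scal) = Module.finrank ℂ y :=
  (Submodule.equivMapOfInjective scal scal_inj y).finrank_eq.symm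

theorem form_scal (n : ℕ) (p q : ℂ[X]) : form n (scal p) (scal q) = 2^(2*n) * form n p q := by
  unfold form
  rw [Finset.mul_sum]
  apply Finset.sum_congr rfl
  intro m hm
  rw [Finset.mem_range] at hm
  rw [scal_coeff, scal_coeff]
  have : (2:ℂ)^(2*n) = 2^m * 2^(2*n-m) := by rw [← pow_add]; congr 1; omega
  rw [this]; ring

theorem SchubertY_scal (n : ℕ) (s : StrictPartitionIn n) (a : Option ℂ)
    (ha : ∀ i, ∃ A, flag n a i = ZZ A) (y : Submodule ℂ ℂ[X]) (hy : y ∈ SchubertY n s a) :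
    y.map scal ∈ SchubertY n s a := by
  obtain ⟨⟨⟨h1, h2⟩, h3⟩, h4⟩ := hy
  refine ⟨⟨⟨?_, ?_⟩, ?_⟩, ?_⟩
  · have := Submodule.map_mono (f := scal) h1
    rwa [degreeLT_eq, ZZ_map, ← degreeLT_eq] at this
  · rw [finrank_scal, h2]
  · rintro _ ⟨p, hp, rfl⟩ _ ⟨q, hq, rfl⟩
    rw [form_scal, h3 p hp q hq, mul_zero]
  · intro i hi
    obtain ⟨A, hA⟩ := ha (n + 2 + i - tildeFun s i)
    have := h4 i hi
    rw [hA] at this ⊢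
    rw [← ZZ_map A, ← Submodule.map_inf _ scal_inj, finrank_scal]
    exact this

theorem mono_mem {y : Submodule ℂ ℂ[X]} (hy : y.map scal = y) (N : ℕ) :
    ∀ f ∈ y, f.support.card = N → ∀ m, f.coeff m ≠ 0 → (X ^ m : ℂ[X]) ∈ y := by
  induction N using Nat.strong_induction_on with
  | _ N ih =>
    intro f hf hN m hm
    by_cases hex : ∃ m', m' ≠ m ∧ f.coeff m' ≠ 0
    · obtain ⟨m', h1, h2⟩ := hex
      have hg : scal f - (2^m' : ℂ) • f ∈ y := by
        refine Submodule.sub_mem _ ?_ (Submodule.smul_mem _ _ hf)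
        rw [← hy]
        exact Submodule.mem_map_of_mem hf
      have hc : ∀ k, (scal f - (2^m' : ℂ) • f).coeff k = f.coeff k * (2^k - 2^m') := by
        intro k
        rw [coeff_sub, scal_coeff, coeff_smul, smul_eq_mul]; ring
      refine ih _ ?_ _ hg rfl m ?_
      · rw [← hN]
        apply Finset.card_lt_card
        rw [Finset.ssubset_iff_of_subset]
        · refine ⟨m', by simpa using h2, ?_⟩
          rw [mem_support_iff, hc]; simp
        · intro k hk
          rw [mem_support_iff, hc] at hk
          rw [mem_support_iff]
          exact left_ne_zero_of_mul hk
      · rw [hc]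
        refine mul_ne_zero hm ?_
        rw [sub_ne_zero]
        intro h
        have h' : (2:ℕ)^m = 2^m' := by exact_mod_cast h
        exact h1 (Nat.pow_right_injective le_rfl h').symm
    · push Not at hex
      have hfm : f = f.coeff m • X ^ m := by
        ext k
        rw [coeff_smul, coeff_X_pow, smul_eq_mul]
        by_cases hk : k = m
        · subst hk; simp
        · rw [hex k hk, if_neg hk, mul_zero]
      have h1 := Submodule.smul_mem y (f.coeff m)⁻¹ hf
      rw [hfm] at h1
      rwa [coeff_smul, coeff_X_pow, if_pos rfl, smul_eq_mul, mul_one, smul_smul,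
        inv_mul_cancel₀ hm, one_smul] at h1

theorem finrank_ZZ (B : Finset ℕ) : Module.finrank ℂ (ZZ {m | m ∉ B}) = B.card := by
  let φ : ZZ {m | m ∉ B} →ₗ[ℂ] (B → ℂ) :=
    { toFun := fun f b => f.1.coeff b
      map_add' := by intro f g; ext b; simp
      map_smul' := by intro c f; ext b; simp }
  have hφ : ∀ f b, φ f b = f.1.coeff b := fun f b => rfl
  have hb : Function.Bijective φ := by
    constructor
    · intro f g h
      apply Subtype.ext
      ext m
      by_cases hm : m ∈ B
      · exact congrFun h ⟨m, hm⟩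
      · rw [f.2 m hm, g.2 m hm]
    · intro g
      refine ⟨⟨∑ b : B, monomial b.1 (g b), ?_⟩, ?_⟩
      · intro m hm
        rw [finset_sum_coeff]
        apply Finset.sum_eq_zero
        intro b _
        rw [coeff_monomial, if_neg]
        rintro rfl
        exact hm b.2
      · ext b
        rw [hφ]
        simp only [finset_sum_coeff, coeff_monomial]
        rw [Finset.sum_eq_single b]
        · simp
        · intro c _ hc
          rw [if_neg]
          intro h; exact hc (Subtype.ext h)
        · simp
  rw [(LinearEquiv.ofBijective φ hb).finrank_eq]
  simp

theorem form_mono (n m : ℕ) (hm : m ≤ 2*n) : form n (X^m) (X^(2*n-m)) ≠ 0 := by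
  unfold form
  rw [Finset.sum_eq_single m]
  · simp [coeff_X_pow, Nat.factorial_ne_zero]
  · intro k _ hk
    rw [coeff_X_pow, if_neg hk]; simp
  · intro h; exact absurd (Finset.mem_range.2 (by omega)) h

theorem geometric_part (n : ℕ) (kap kapd : StrictPartitionIn n)
    (hdim : 2 * (swt n kap + swt n kapd) = n*(n+1))
    (hdual : ∀ u v : OnePoint ℝ, u ≠ v →
      (SchubertY n kap (toC u) ∩ SchubertY n kapd (toC v)).ncard = 1) :
    Genuine kap ∧ Genuine kapd ∧
    ∀ k, k ≤ n → ((Finset.range n).filter (fun i => k < kap.part i)).card +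
      ((Finset.range n).filter (fun i => k < kapd.part i)).card = n - k := by
  classical
  have h0 := hdual ∞ ((0 : ℝ) : OnePoint ℝ) (OnePoint.infty_ne_coe _)
  obtain ⟨y, hy⟩ := Set.ncard_eq_one.1 h0
  have hyS : y ∈ SchubertY n kap (toC ∞) ∩ SchubertY n kapd (toC ((0 : ℝ) : OnePoint ℝ)) := by
    rw [hy]; rfl
  have hyy : y.map scal = y := by
    have : y.map scal ∈ SchubertY n kap (toC ∞) ∩ SchubertY n kapd (toC ((0 : ℝ) : OnePoint ℝ)) :=
      ⟨SchubertY_scal _ _ _ (fun i => ⟨_, flag_none n i⟩) _ hyS.1,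
        SchubertY_scal _ _ _ (fun i => ⟨_, flag_zero n i⟩) _ hyS.2⟩
    rw [hy] at this
    exact this
  obtain ⟨⟨⟨⟨hdeg, hrk⟩, hiso⟩, hS1⟩, ⟨-, hS2⟩⟩ := hyS
  let p : ℕ → Prop := fun m => (X ^ m : ℂ[X]) ∈ y
  have hp2n : ∀ m, p m → m < 2*n+1 := by
    intro m hm
    by_contra hcon
    have := hdeg hm
    rw [degreeLT_eq] at this
    have := this m (by simp only [Set.mem_setOf_eq]; omega)
    simp at this
  have hyZ : y = ZZ {m | ¬ p m} := by
    apply le_antisymm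
    · intro f hf m hm
      by_contra hne
      exact hm (mono_mem hyy _ f hf rfl m hne)
    · intro f hf
      rw [f.as_sum_support_C_mul_X_pow]
      refine Submodule.sum_mem _ fun m hm => ?_
      rw [← smul_eq_C_mul]
      apply Submodule.smul_mem
      by_contra hne
      exact (mem_support_iff.1 hm) (hf m hne)
  have hinf : ∀ A B : Set ℕ, ZZ A ⊓ ZZ B = ZZ (A ∪ B) := by
    intro A B
    ext f
    simp only [Submodule.mem_inf, mem_ZZ, Set.mem_union]
    constructor
    · rintro ⟨h1, h2⟩ m (h | h)
      · exact h1 m h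
      · exact h2 m h
    · intro h
      exact ⟨fun m hm => h m (Or.inl hm), fun m hm => h m (Or.inr hm)⟩
  have hI : ((Finset.range (2*n+1)).filter p).card = n := by
    have hset : {m | ¬ p m} = {m | m ∉ (Finset.range (2*n+1)).filter p} := by
      ext m
      simp only [Finset.mem_filter, Finset.mem_range, Set.mem_setOf_eq]
      have := hp2n m
      tauto
    have h := finrank_ZZ ((Finset.range (2*n+1)).filter p)
    rw [← hset, ← hyZ, hrk] at h
    exact h.symm
  have hnot : ∀ m, m ≤ 2*n → p m → ¬ p (2*n-m) := by
    intro m hm h1 h2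
    exact form_mono n m hm (hiso _ h1 _ h2)
  have hpn : ¬ p n := by
    intro h
    have := hnot n (by omega) h
    rw [show 2*n - n = n by omega] at this
    exact this h
  have hsym : ∀ m, m < n → (p m ↔ ¬ p (2*n - m)) := by
    intro m hm
    refine ⟨hnot m (by omega), fun h => ?_⟩
    by_contra hpm
    have : ((Finset.range (2*n+1)).filter p).card ≤ ((Finset.range n).erase m).card := by
      apply Finset.card_le_card_of_injOn (fun k => min k (2*n - k))
      · intro k hk
        simp only [Finset.coe_filter, Finset.mem_range, Set.mem_setOf_eq] at hk
        simp only [Finset.coe_erase, Finset.coe_range, Set.mem_sdiff, Set.mem_Iio, Set.mem_singleton_iff]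
        have k1 : k ≠ n := by rintro rfl; exact hpn hk.2
        have k2 : k ≠ m := by rintro rfl; exact hpm hk.2
        have k3 : k ≠ 2*n - m := by rintro rfl; exact h hk.2
        omega
      · intro k hk l hl hkl
        simp only [Finset.coe_filter, Finset.mem_range, Set.mem_setOf_eq] at hk hl hkl
        by_contra hne
        have : l = 2*n - k := by omega
        rw [this] at hl
        exact hnot k (by omega) hk.2 hl.2
    rw [hI, Finset.card_erase_of_mem (Finset.mem_range.2 hm), Finset.card_range] at this
    omega
  refine comb_pair n p (fun m => m ≤ 2*n ∧ p (2*n - m)) hsym hpn (fun m hm => by simp [hm]) kap kapd hdim ?_ ?_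
  · intro i hi
    refine (hS1 i hi).trans ?_
    set x := n + 2 + i - tildeFun kap i
    have : y ⊓ flag n (toC (∞ : OnePoint ℝ)) x =
        ZZ {m | m ∉ (Finset.range x).filter p} := by
      rw [flag_none, hyZ, hinf]
      congr 1
      ext m
      simp only [Finset.mem_filter, Finset.mem_range, Set.mem_setOf_eq, Set.mem_union, not_and_or, not_lt]
      tauto
    rw [this, finrank_ZZ, Nat.count_eq_card_filter_range]
  · intro i hi
    refine (hS2 i hi).trans ?_
    set x := n + 2 + i - tildeFun kapd i
    have : y ⊓ flag n (toC ((0 : ℝ) : OnePoint ℝ)) x =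
        ZZ {m | m ∉ (Finset.range (2*n+1)).filter (fun m => p m ∧ 2*n+1-x ≤ m)} := by
      rw [flag_zero, hyZ, hinf]
      congr 1
      ext m
      simp only [Finset.mem_filter, Finset.mem_range, Set.mem_setOf_eq, Set.mem_union, not_and_or, not_lt, not_le]
      tauto
    rw [this, finrank_ZZ, Nat.count_eq_card_filter_range]
    apply Finset.card_le_card_of_injOn (fun k => 2*n - k)
    · intro k hk
      simp only [Finset.coe_filter, Finset.mem_range, Set.mem_setOf_eq] at hk ⊢
      rw [show 2*n - (2*n - k) = k by omega]
      exact ⟨by omega, by omega, hk.2.1⟩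
    · intro k hk l hl hkl
      simp only [Finset.coe_filter, Finset.mem_range, Set.mem_setOf_eq] at hk hl hkl
      omega

/-- **Lemma 4.5.** Let `κ^∨` be the strict partition Poincaré dual to `κ`
(expressed geometrically: `|κ| + |κ^∨| = dim Y` and generic intersections
`Y_κ(u) ∩ Y_{κ^∨}(v)` consist of a single point).  Then every standard shifted
tableau in `SST(δ/κ)` has rectification shape `κ^∨`. -/
theorem rectification_shape_of_skew_staircase (n : ℕ)
    (kap kapd : StrictPartitionIn n)
    (hkd : shiftedDiag n kap ⊆ shiftedDiag n (staircase n))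
    (hdim : 2 * (swt n kap + swt n kapd) = n*(n+1))
    (hdual : ∀ u v : OnePoint ℝ, u ≠ v →
      (SchubertY n kap (toC u) ∩ SchubertY n kapd (toC v)).ncard = 1)
    (T : Filling)
    (hT : IsTableauOn T (shiftedDiag n (staircase n) \ shiftedDiag n kap)
      (Finset.Icc 1 ((shiftedDiag n (staircase n) \ shiftedDiag n kap).card)))
    (R : Filling) (hR : RectifiesTo T (shiftedDiag n kap) R) :
    cellsOf R = shiftedDiag n kapd := by
  obtain ⟨g1, g2, hc⟩ := geometric_part n kap kapd hdim hdual
  exact combinatorial_part n kap kapd hkd g1 g2 hc T hT R hR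

end OG
end

section
/- For every point y ∈ Y = OG(n, C_{2n}[z]), the Wronskian Wr(y;z) is a perfect square (up to a scalar, it is the square of a polynomial). Consequently, Y ∩ X(a) = ∅ whenever the multiset a of n(n+1) points of RP¹ is not of the form b⋆ = {b_1, b_1, …, b_m, b_m}. -/
open Polynomial OnePoint

namespace OG

/-! ### Helper lemmas -/

theorem exists_distinct_orders (k : ℕ) : ∀ W : Submodule ℂ ℂ[X], FiniteDimensional ℂ W →
    Module.finrank ℂ W = k →
    ∃ g : Fin k → ℂ[X], (∀ i, g i ∈ W) ∧ (∀ i, g i ≠ 0) ∧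
      Function.Injective (fun i => (g i).natTrailingDegree) := by
  induction k with
  | zero =>
    intro W _ _
    exact ⟨fun i => i.elim0, fun i => i.elim0, fun i => i.elim0, fun i => i.elim0⟩
  | succ k ih =>
    intro W hfd hW
    have hne : W ≠ ⊥ := by
      rintro rfl
      simp at hW
    obtain ⟨p, hp, hp0⟩ := Submodule.exists_mem_ne_zero_of_ne_bot hne
    set m := p.natTrailingDegree with hm
    have hpm : p.coeff m ≠ 0 := by
      exact mt trailingCoeff_eq_zero.mp hp0
    let φ : W →ₗ[ℂ] ℂ := (lcoeff ℂ m).domRestrict W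
    have hφ : LinearMap.range φ = ⊤ := by
      rw [LinearMap.range_eq_top]
      refine LinearMap.surjective (fun h => hpm ?_)
      have := LinearMap.congr_fun h ⟨p, hp⟩
      simpa [φ] using this
    have hk := LinearMap.finrank_range_add_finrank_ker φ
    rw [hφ, finrank_top, Module.finrank_self, hW] at hk
    have hk2 : Module.finrank ℂ (LinearMap.ker φ) = k := by omega
    have hfr : Module.finrank ℂ ((LinearMap.ker φ).map W.subtype) = k := by
      rw [← hk2]
      exact (Submodule.equivMapOfInjective W.subtype W.injective_subtype
        (LinearMap.ker φ)).finrank_eq.symm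
    obtain ⟨g, hg1, hg2, hg3⟩ := ih ((LinearMap.ker φ).map W.subtype) inferInstance hfr
    have hmem : ∀ i, g i ∈ W ∧ (g i).coeff m = 0 := by
      intro i
      obtain ⟨w, hw, hw2⟩ := hg1 i
      rw [← hw2]
      refine ⟨w.2, ?_⟩
      simpa [φ] using hw
    have hord : ∀ i, (g i).natTrailingDegree ≠ m := by
      intro i h
      have := mt trailingCoeff_eq_zero.mp (hg2 i)
      rw [trailingCoeff, h] at this
      exact this (hmem i).2
    refine ⟨Fin.cons p g, ?_, ?_, ?_⟩
    · intro i
      refine Fin.cases ?_ (fun j => ?_) i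
      · simpa using hp
      · simpa using (hmem j).1
    · intro i
      refine Fin.cases ?_ (fun j => ?_) i
      · simpa using hp0
      · simpa using hg2 j
    · intro i j
      refine Fin.cases ?_ (fun i => ?_) i <;> refine Fin.cases ?_ (fun j => ?_) j
      · simp
      · intro h
        exact absurd h.symm (by simpa using hord j)
      · intro h
        exact absurd h (by simpa using hord i)
      · intro h
        have := hg3 (by simpa using h : (g i).natTrailingDegree = (g j).natTrailingDegree)
        rw [this]

theorem iter_eq (i : ℕ) (p : ℂ[X]) :
    (fun p : ℂ[X] => derivative p)^[i] p = derivative^[i] p := rfl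

theorem coeff_X_pow_mul_iter (i m : ℕ) (p : ℂ[X]) :
    (X ^ i * derivative^[i] p).coeff m = (m.descFactorial i : ℂ) * p.coeff m := by
  rw [coeff_X_pow_mul']
  split_ifs with h
  · rw [coeff_iterate_derivative, Nat.sub_add_cancel h, nsmul_eq_mul]
  · rw [Nat.descFactorial_of_lt (by omega)]
    simp

theorem exists_quot (p : ℂ[X]) (i : ℕ) : ∃ k : ℂ[X],
    X ^ i * derivative^[i] p = X ^ p.natTrailingDegree * k ∧
      k.coeff 0 = (p.natTrailingDegree.descFactorial i : ℂ) * p.trailingCoeff := by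
  have : X ^ p.natTrailingDegree ∣ X ^ i * derivative^[i] p := by
    rw [X_pow_dvd_iff]
    intro d hd
    rw [coeff_X_pow_mul_iter, coeff_eq_zero_of_lt_natTrailingDegree hd, mul_zero]
  obtain ⟨k, hk⟩ := this
  refine ⟨k, hk, ?_⟩
  rw [trailingCoeff, ← coeff_X_pow_mul_iter, hk]
  simp [coeff_X_pow_mul']

theorem wronskian_order (n : ℕ) (g : Fin n → ℂ[X]) (h0 : ∀ i, g i ≠ 0)
    (hinj : Function.Injective (fun i => (g i).natTrailingDegree)) :
    wronskian n g ≠ 0 ∧ (∑ i : Fin n, (i : ℕ)) + (wronskian n g).natTrailingDegree =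
      ∑ i, (g i).natTrailingDegree := by
  choose k hk hk0 using fun i j : Fin n => exists_quot (g j) i
  let K : Matrix (Fin n) (Fin n) ℂ[X] := Matrix.of k
  have h1 : (∏ i : Fin n, (X : ℂ[X]) ^ (i : ℕ)) * wronskian n g
      = (∏ j, X ^ (g j).natTrailingDegree) * K.det := by
    rw [wronskian, ← Matrix.det_mul_column, ← Matrix.det_mul_row]
    congr 1
    ext1 i j
    simp only [Matrix.of_apply, K]
    exact hk i j
  have hK : K.det.coeff 0 ≠ 0 := by
    rw [coeff_zero_eq_eval_zero, ← coe_evalRingHom, RingHom.map_det]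
    have : (evalRingHom (0:ℂ)).mapMatrix K = Matrix.of (fun i j : Fin n =>
        (g j).trailingCoeff * (Matrix.of (fun j i : Fin n =>
          (descPochhammer ℂ (i : ℕ)).eval (((g j).natTrailingDegree : ℕ) : ℂ))).transpose i j) := by
      ext i j
      simp only [RingHom.mapMatrix_apply, Matrix.map_apply, coe_evalRingHom, K, Matrix.of_apply,
        Matrix.transpose_apply, ← coeff_zero_eq_eval_zero, hk0,
        descPochhammer_eval_eq_descFactorial]
      ring
    rw [this, Matrix.det_mul_row, Matrix.det_transpose,
      ← Matrix.det_eval_matrixOfPolynomials_eq_det_vandermonde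
        (fun j => (((g j).natTrailingDegree : ℕ) : ℂ)) (fun i : Fin n => descPochhammer ℂ (i : ℕ))
        (fun i => descPochhammer_natDegree ℂ i) (fun i => monic_descPochhammer ℂ i)]
    refine mul_ne_zero ?_ ?_
    · rw [Finset.prod_ne_zero_iff]
      intro i _
      exact mt trailingCoeff_eq_zero.mp (h0 i)
    · rw [Matrix.det_vandermonde_ne_zero_iff]
      intro i j hij
      exact hinj (Nat.cast_injective (R := ℂ) hij)
  have hK0 : K.det ≠ 0 := by
    intro h
    rw [h] at hK
    simp at hK
  have hX : ∀ m : ℕ, (X : ℂ[X]) ^ m ≠ 0 := fun m => pow_ne_zero _ X_ne_zero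
  rw [Finset.prod_pow_eq_pow_sum, Finset.prod_pow_eq_pow_sum] at h1
  have hW : wronskian n g ≠ 0 := by
    intro h
    rw [h, mul_zero] at h1
    exact mul_ne_zero (hX _) hK0 h1.symm
  refine ⟨hW, ?_⟩
  have h2 := congrArg natTrailingDegree h1
  rw [natTrailingDegree_mul (hX _) hW, natTrailingDegree_mul (hX _) hK0] at h2
  simp only [natTrailingDegree_X_pow] at h2
  rw [h2, natTrailingDegree_eq_zero.mpr (Or.inr hK), add_zero]

theorem wronskian_change (n : ℕ) (f g : Fin n → ℂ[X])
    (h : ∀ i, g i ∈ Submodule.span ℂ (Set.range f)) :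
    ∃ c : ℂ, wronskian n g = c • wronskian n f := by
  choose P hP using fun i => (Submodule.mem_span_range_iff_exists_fun ℂ).mp (h i)
  refine ⟨(Matrix.of fun i j => P j i).det, ?_⟩
  have : (Matrix.of fun i j : Fin n => (fun p : ℂ[X] => derivative p)^[(i : ℕ)] (g j)) =
      (Matrix.of fun i j : Fin n => (fun p : ℂ[X] => derivative p)^[(i : ℕ)] (f j)) *
      (C : ℂ →+* ℂ[X]).mapMatrix (Matrix.of fun i j => P j i) := by
    ext1 i j
    simp only [Matrix.mul_apply, Matrix.of_apply, RingHom.mapMatrix_apply, Matrix.map_apply,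
      iter_eq, ← hP j, iterate_derivative_sum, iterate_derivative_smul]
    refine Finset.sum_congr rfl fun l _ => ?_
    rw [smul_eq_C_mul, mul_comm]
  rw [wronskian, this, Matrix.det_mul, ← RingHom.map_det, smul_eq_C_mul, mul_comm]
  rfl

theorem order_pair (n : ℕ) (p q : ℂ[X]) (hp : p ≠ 0) (hq : q ≠ 0) (h : form n p q = 0)
    (he : p.natTrailingDegree + q.natTrailingDegree = 2 * n) : False := by
  have hp' := mt trailingCoeff_eq_zero.mp hp
  have hq' := mt trailingCoeff_eq_zero.mp hq
  rw [trailingCoeff] at hp' hq'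
  rw [form, Finset.sum_eq_single p.natTrailingDegree] at h
  · rw [show 2 * n - p.natTrailingDegree = q.natTrailingDegree by omega] at h
    have h1 : ((-1 : ℂ) ^ p.natTrailingDegree) ≠ 0 := pow_ne_zero _ (by norm_num)
    have h2 := Nat.factorial_ne_zero p.natTrailingDegree
    have h3 := Nat.factorial_ne_zero q.natTrailingDegree
    simp_all
  · intro m hm hne
    rw [Finset.mem_range] at hm
    rcases lt_or_gt_of_ne hne with hlt | hgt
    · rw [coeff_eq_zero_of_lt_natTrailingDegree hlt]
      ring
    · rw [coeff_eq_zero_of_lt_natTrailingDegree (p := q) (by omega)]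
      ring
  · intro hm
    rw [Finset.mem_range] at hm
    omega

theorem og_zero (n : ℕ) (y : Submodule ℂ ℂ[X]) (hy : IsOGPt n y) (f : Fin n → ℂ[X])
    (hf : Submodule.span ℂ (Set.range f) = y) :
    wronskian n f ≠ 0 ∧ Even (wronskian n f).natTrailingDegree := by
  have hfd : FiniteDimensional ℂ y := by
    rw [← hf]
    exact FiniteDimensional.span_of_finite ℂ (Set.finite_range f)
  obtain ⟨g, hg, hg0, hinj⟩ := exists_distinct_orders n y hfd hy.1.2
  obtain ⟨hW, hsum⟩ := wronskian_order n g hg0 hinj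
  obtain ⟨c, hc⟩ := wronskian_change n f g (by rw [hf]; exact hg)
  have hc0 : c ≠ 0 := by
    rintro rfl
    rw [zero_smul] at hc
    exact hW hc
  have hWf : wronskian n f ≠ 0 := by
    intro h
    rw [h, smul_zero] at hc
    exact hW hc
  refine ⟨hWf, ?_⟩
  have hdeg : (wronskian n g).natTrailingDegree = (wronskian n f).natTrailingDegree := by
    rw [hc, smul_eq_C_mul, natTrailingDegree_mul (by simpa using hc0) hWf, natTrailingDegree_C,
      zero_add]
  rw [← hdeg]
  set e : Fin n → ℕ := fun i => (g i).natTrailingDegree with he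
  have hle : ∀ i, e i ≤ 2 * n := by
    intro i
    have h1 := hy.1.1 (hg i)
    rw [mem_degreeLT] at h1
    have h2 := natDegree_lt_iff_degree_lt (hg0 i) |>.mpr h1
    have h3 := natTrailingDegree_le_natDegree (g i)
    simp only [he]
    omega
  have hpair : ∀ i j, e i + e j ≠ 2 * n := fun i j h =>
    order_pair n (g i) (g j) (hg0 i) (hg0 j) (hy.2 _ (hg i) _ (hg j)) h
  have hlt : ∀ i, min (e i) (2 * n - e i) < n := by
    intro i
    have := hle i
    have := hpair i i
    omega
  let σ : Fin n → Fin n := fun i => ⟨min (e i) (2 * n - e i), hlt i⟩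
  have hσ : Function.Injective σ := by
    intro i j hij
    have h1 : min (e i) (2 * n - e i) = min (e j) (2 * n - e j) := by
      simpa [σ] using hij
    apply hinj
    show e i = e j
    have := hle i
    have := hle j
    have := hpair i j
    omega
  have hσb : Function.Bijective σ := Finite.injective_iff_bijective.mp hσ
  have h2 : ∑ i : Fin n, ((σ i : Fin n) : ℕ) = ∑ i : Fin n, (i : ℕ) :=
    hσb.sum_comp (fun i : Fin n => (i : ℕ))
  have h3 : ∀ i, ∃ t : ℕ, e i = σ i + 2 * t := by
    intro i
    have := hle i
    rcases le_total (e i) (2 * n - e i) with h | h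
    · exact ⟨0, by simp [σ, h]⟩
    · exact ⟨e i - n, by simp only [σ, min_eq_right h]; omega⟩
  choose t ht using h3
  have h4 : ∑ i, e i = ∑ i : Fin n, (i : ℕ) + 2 * ∑ i, t i := by
    rw [← h2, Finset.mul_sum, ← Finset.sum_add_distrib]
    exact Finset.sum_congr rfl fun i _ => ht i
  have h5 : (wronskian n g).natTrailingDegree = 2 * ∑ i, t i := by
    rw [h4] at hsum
    exact Nat.add_left_cancel hsum
  rw [h5]
  exact even_two_mul _

theorem derivative_taylor' (r : ℂ) (p : ℂ[X]) :
    derivative (taylor r p) = taylor r (derivative p) := by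
  simp [taylor_apply, derivative_comp]

theorem iter_derivative_taylor (r : ℂ) (i : ℕ) (p : ℂ[X]) :
    derivative^[i] (taylor r p) = taylor r (derivative^[i] p) := by
  induction i generalizing p with
  | zero => rfl
  | succ i ih => rw [Function.iterate_succ_apply, derivative_taylor', ih,
      ← Function.iterate_succ_apply]

theorem wronskian_taylor (n : ℕ) (r : ℂ) (f : Fin n → ℂ[X]) :
    wronskian n (fun i => taylor r (f i)) = taylor r (wronskian n f) := by
  have h : ∀ p : ℂ[X], taylor r p = (taylorAlgHom r : ℂ[X] →ₐ[ℂ] ℂ[X]) p := fun p => rfl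
  rw [wronskian, wronskian, h, AlgHom.map_det]
  congr 1
  ext1 i j
  simp only [Matrix.of_apply, iter_eq, iter_derivative_taylor, AlgHom.mapMatrix_apply,
    Matrix.map_apply]
  rfl

/-- The polynomial `Σ (-1)^m p^{(m)} q^{(2n-m)}`. -/
noncomputable def bigForm (n : ℕ) (p q : ℂ[X]) : ℂ[X] :=
  ∑ m ∈ Finset.range (2*n+1), (-1) ^ m * (derivative^[m] p * derivative^[2*n-m] q)

theorem derivative_bigForm (n : ℕ) (p q : ℂ[X]) (hp : p ∈ degreeLT ℂ (2*n+1))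
    (hq : q ∈ degreeLT ℂ (2*n+1)) : derivative (bigForm n p q) = 0 := by
  have hz : ∀ p : ℂ[X], p ∈ degreeLT ℂ (2*n+1) → derivative^[2*n+1] p = 0 := by
    intro p hp
    rw [mem_degreeLT] at hp
    by_cases h0 : p = 0
    · simp [h0]
    · exact iterate_derivative_eq_zero ((natDegree_lt_iff_degree_lt h0).mpr hp)
  have key : ∀ m ∈ Finset.range (2*n+1),
      derivative ((-1) ^ m * (derivative^[m] p * derivative^[2*n-m] q)) =
      (fun m => -((-1 : ℂ[X]) ^ m * (derivative^[m] p * derivative^[2*n+1-m] q))) (m+1) -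
      (fun m => -((-1 : ℂ[X]) ^ m * (derivative^[m] p * derivative^[2*n+1-m] q))) m := by
    intro m hm
    rw [Finset.mem_range] at hm
    have h1 : derivative ((-1 : ℂ[X]) ^ m) = 0 := by
      rw [show ((-1 : ℂ[X]) ^ m) = C ((-1) ^ m) by simp, derivative_C]
    simp only [derivative_mul, h1, zero_mul, zero_add]
    rw [← Function.iterate_succ_apply' derivative, ← Function.iterate_succ_apply' derivative,
      show (2*n-m).succ = 2*n+1-m by omega, show 2*n+1-(m+1) = 2*n-m by omega]
    ring
  rw [bigForm, derivative_sum, Finset.sum_congr rfl key]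
  refine (Finset.sum_range_sub (fun m => -((-1 : ℂ[X]) ^ m *
    (derivative^[m] p * derivative^[2*n+1-m] q))) (2*n+1)).trans ?_
  simp [hz p hp, hz q hq]

theorem eval_bigForm (n : ℕ) (p q : ℂ[X]) (r : ℂ) :
    (bigForm n p q).eval r = form n (taylor r p) (taylor r q) := by
  have h : ∀ (p : ℂ[X]) (m : ℕ),
      (derivative^[m] p).eval r = (m.factorial : ℂ) * (taylor r p).coeff m := by
    intro p m
    rw [← factorial_smul_hasseDeriv, taylor_coeff]
    simp
  rw [bigForm, form, eval_finset_sum]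
  refine Finset.sum_congr rfl fun m _ => ?_
  simp only [eval_mul, eval_pow, eval_neg, eval_one, h]
  ring

theorem form_taylor (n : ℕ) (p q : ℂ[X]) (hp : p ∈ degreeLT ℂ (2*n+1))
    (hq : q ∈ degreeLT ℂ (2*n+1)) (r : ℂ) :
    form n (taylor r p) (taylor r q) = form n p q := by
  have h := natDegree_eq_zero_of_derivative_eq_zero (derivative_bigForm n p q hp hq)
  have h1 := eval_bigForm n p q r
  have h2 := eval_bigForm n p q 0
  rw [eq_C_of_natDegree_eq_zero h, eval_C] at h1 h2
  rw [← h1, h2, taylor_zero, taylor_zero]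

theorem og_taylor (n : ℕ) (r : ℂ) (y : Submodule ℂ ℂ[X]) (hy : IsOGPt n y) :
    IsOGPt n (y.map (taylor r)) := by
  refine ⟨⟨?_, ?_⟩, ?_⟩
  · rintro _ ⟨p, hp, rfl⟩
    have := hy.1.1 hp
    rw [mem_degreeLT] at this ⊢
    rwa [degree_taylor]
  · rw [← hy.1.2]
    exact (Submodule.equivMapOfInjective (taylor r) (taylor_injective r) y).finrank_eq.symm
  · rintro _ ⟨p, hp, rfl⟩ _ ⟨q, hq, rfl⟩
    rw [form_taylor n p q (hy.1.1 hp) (hy.1.1 hq)]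
    exact hy.2 p hp q hq

theorem og_even (n : ℕ) (y : Submodule ℂ ℂ[X]) (hy : IsOGPt n y) (f : Fin n → ℂ[X])
    (hf : Submodule.span ℂ (Set.range f) = y) (r : ℂ) :
    Even ((wronskian n f).rootMultiplicity r) := by
  have := (og_zero n _ (og_taylor n r y hy) (fun i => taylor r (f i)) (by
    rw [← hf, Submodule.map_span, ← Set.range_comp]
    rfl)).2
  rw [wronskian_taylor] at this
  rwa [rootMultiplicity_eq_natTrailingDegree, ← taylor_apply]

theorem multiset_half {α : Type*} [DecidableEq α] (s : Multiset α)
    (h : ∀ x, Even (s.count x)) : ∃ t, s = t + t := by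
  refine ⟨∑ x ∈ s.toFinset, (s.count x / 2) • {x}, ?_⟩
  ext x
  rw [Multiset.count_add, Multiset.count_sum']
  simp only [Multiset.count_nsmul, Multiset.count_singleton, mul_ite, mul_one, mul_zero,
    Finset.sum_ite_eq, Multiset.mem_toFinset]
  split_ifs with hx
  · obtain ⟨k, hk⟩ := h x
    omega
  · simp [Multiset.count_eq_zero_of_notMem hx]

theorem linFactor_coe (r : ℝ) : linFactor (r : OnePoint ℝ) = X + C (r : ℂ) := rfl

theorem linFactor_infty : linFactor (∞ : OnePoint ℝ) = 1 := rfl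

theorem linFactor_ne_zero (t : OnePoint ℝ) : linFactor t ≠ 0 := by
  induction t using OnePoint.rec with
  | infty => rw [linFactor_infty]; exact one_ne_zero
  | coe r => rw [linFactor_coe]; exact X_add_C_ne_zero _

open Classical in
theorem rootMult_fibrePoly (a : Multiset (OnePoint ℝ)) : fibrePoly a ≠ 0 ∧ ∀ r : ℝ,
    (fibrePoly a).rootMultiplicity (-(r : ℂ)) = a.count (r : OnePoint ℝ) := by
  induction a using Multiset.induction_on with
  | empty => simp [fibrePoly, rootMultiplicity_eq_zero]
  | cons x a ih =>
    have h : fibrePoly (x ::ₘ a) = linFactor x * fibrePoly a := by simp [fibrePoly]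
    rw [h]
    have hne := mul_ne_zero (linFactor_ne_zero x) ih.1
    refine ⟨hne, fun r => ?_⟩
    rw [rootMultiplicity_mul hne, ih.2 r, Multiset.count_cons, add_comm]
    congr 1
    induction x using OnePoint.rec with
    | infty =>
      rw [linFactor_infty, if_neg (OnePoint.coe_ne_infty r)]
      exact rootMultiplicity_C 1 _
    | coe s =>
      rw [linFactor_coe, show (X + C (s : ℂ)) = X - C (-(s : ℂ)) by simp,
        rootMultiplicity_X_sub_C]
      simp

/-- For every `y ∈ Y = OG(n, C_{2n}[z])`, the Wronskian `Wr(y;z)` is a perfect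
square up to a scalar; consequently `Y ∩ X(a) = ∅` whenever the multiset `a` is
not of the form `b⋆ = b + b`. -/
theorem wronskian_perfect_square_on_Y (n : ℕ) :
    (∀ y : Submodule ℂ ℂ[X], IsOGPt n y →
      ∀ f : Fin n → ℂ[X], Submodule.span ℂ (Set.range f) = y →
        ∃ c : ℂ, c ≠ 0 ∧ ∃ p : ℂ[X], wronskian n f = c • p^2) ∧
    (∀ a : Multiset (OnePoint ℝ), Multiset.card a = n*(n+1) →
      (∀ b, a ≠ b + b) → {y | IsOGPt n y} ∩ fibre n a = ∅) := by
  refine ⟨?_, ?_⟩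
  · intro y hy f hf
    have hW := (og_zero n y hy f hf).1
    classical
    obtain ⟨t, ht⟩ := multiset_half (wronskian n f).roots (fun r => by
      rw [count_roots]
      exact og_even n y hy f hf r)
    refine ⟨(wronskian n f).leadingCoeff, leadingCoeff_ne_zero.mpr hW,
      (t.map fun r => X - C r).prod, ?_⟩
    have h := (IsAlgClosed.splits (wronskian n f)).eq_prod_roots
    rw [smul_eq_C_mul, sq, ← Multiset.prod_add, ← Multiset.map_add, ← ht]
    exact h
  · intro a ha hb
    classical
    rw [Set.eq_empty_iff_forall_notMem]
    rintro y ⟨hy, -, f, hf, c, hc, hw⟩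
    have hev : ∀ r : ℝ, Even (a.count (r : OnePoint ℝ)) := by
      intro r
      have h := og_even n y hy f hf (-(r : ℂ))
      rw [hw, smul_eq_C_mul, rootMultiplicity_mul (mul_ne_zero (by simpa using hc)
        (rootMult_fibrePoly a).1), rootMultiplicity_C, zero_add, (rootMult_fibrePoly a).2] at h
      convert h
    obtain ⟨t, ht⟩ := multiset_half (a.filter (· ≠ (∞ : OnePoint ℝ))) (fun x => by
      rw [Multiset.count_filter]
      induction x using OnePoint.rec with
      | infty => simp
      | coe r => simpa using hev r)
    have hcard := congrArg Multiset.card (Multiset.filter_add_not (· ≠ (∞ : OnePoint ℝ)) a)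
    rw [Multiset.card_add, ha, ht, Multiset.card_add] at hcard
    have hinf : Even (a.count (∞ : OnePoint ℝ)) := by
      have h1 : (a.filter (fun x => ¬ x ≠ (∞ : OnePoint ℝ))).card = a.count (∞ : OnePoint ℝ) := by
        rw [Multiset.count, Multiset.countP_eq_card_filter]
        congr 1
        refine Multiset.filter_congr fun x _ => ?_
        rw [not_not, eq_comm]
      rw [h1] at hcard
      have h2 := Nat.even_mul_succ_self n
      rw [← hcard] at h2
      simpa [Nat.even_add] using h2
    obtain ⟨b, hb'⟩ := multiset_half a (fun x => by
      induction x using OnePoint.rec with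
      | infty => exact hinf
      | coe r => exact hev r)
    exact hb b hb'

end OG
end
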